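/- Let m ∈ {1,2,3,4,5,6,7,8,9,10,12,14,18} and let c ∈ S(m), subject to the further assumptions: if m = 1 then c ∈ ℕ ∪ (2ℤ ∖ 32ℤ) ∪ {−5} ∪ {1 − 2^k : k ∈ ℕ} (here ℕ denotes the positive integers), and if m = 2 then c ∈ (−ℕ) ∪ (2ℤ ∖ 32ℤ). Then the second generalised Euclid–Mullin sequence GEM₂(Φ_m(cx);1,m) omits infinitely many primes p ≡ 1 (mod m): the set of primes p ≡ 1 (mod m) not occurring as a term of the sequence is infinite. -/

import Mathlib

open Polynomial

/-- The set `S(m)` of admissible values of `c`. -/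
def Sset (m : ℕ) : Set ℤ :=
  if m = 1 then {c : ℤ | c ≠ 0 ∧ c ≠ 1 ∧ c ≠ 2}
  else if m = 2 then
    {c : ℤ | 0 < c ∧ 2 ∣ c} ∪ {c : ℤ | c < 0 ∧ ∀ k : ℕ, ¬ (-c) ∣ (2 ^ k + 1)}
  else if m = 3 then {c : ℤ | c ≠ -2 ∧ c ≠ -1 ∧ c ≠ 0 ∧ c ≠ 1}
  else if m = 6 then {c : ℤ | c ≠ -1 ∧ c ≠ 0 ∧ c ≠ 1 ∧ c ≠ 2}
  else {c : ℤ | c ≠ -1 ∧ c ≠ 0 ∧ c ≠ 1}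

/-- `P` is the second generalised Euclid–Mullin sequence of `f` for `a mod m`. -/
def IsGEM2Seq (a m : ℕ) (f : Polynomial ℤ) (P : ℕ → ℕ) : Prop :=
  ∀ n : ℕ, IsGreatest {p : ℕ | p.Prime ∧ (p : ℤ) ∣ f.eval (∏ i ∈ Finset.range n, (P i : ℤ)) ∧
    ¬ (p : ℤ) ∣ f.eval 0 ∧ p ≡ a [MOD m]} (P n)

section Stepanov

variable {p : ℕ} [Fact p.Prime]

/-- The operator `r ↦ f ^ (k - c) * D ^ k (f ^ c * r)`. -/
noncomputable def stepanovOp (f : (ZMod p)[X]) (c : ℕ) :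
    ℕ → ((ZMod p)[X] →ₗ[ZMod p] (ZMod p)[X])
  | 0 => LinearMap.id
  | k + 1 => LinearMap.mulLeft (ZMod p) f ∘ₗ Polynomial.derivative ∘ₗ stepanovOp f c k +
      LinearMap.mulLeft (ZMod p) (C ((c : ZMod p) - k) * derivative f) ∘ₗ stepanovOp f c k

theorem stepanovOp_succ (f : (ZMod p)[X]) (c k : ℕ) (r : (ZMod p)[X]) :
    stepanovOp f c (k + 1) r = f * derivative (stepanovOp f c k r) +
      C ((c : ZMod p) - k) * derivative f * stepanovOp f c k r := by
  simp only [stepanovOp, LinearMap.add_apply, LinearMap.comp_apply, LinearMap.mulLeft_apply]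

theorem natDegree_stepanovOp_le {f : (ZMod p)[X]} {d : ℕ} (hf : f.natDegree ≤ d) (c k : ℕ)
    (r : (ZMod p)[X]) : (stepanovOp f c k r).natDegree ≤ r.natDegree + k * d := by
  induction k with
  | zero => simp [stepanovOp]
  | succ k ih =>
    rw [stepanovOp_succ]
    refine (natDegree_add_le _ _).trans (max_le ?_ ?_)
    · refine natDegree_mul_le.trans ?_
      have := natDegree_derivative_le (stepanovOp f c k r)
      have : (k + 1) * d = k * d + d := by ring
      omega
    · refine natDegree_mul_le.trans ?_
      have h1 := natDegree_C_mul_le ((c : ZMod p) - k) (derivative f)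
      have h2 := natDegree_derivative_le f
      have : (k + 1) * d = k * d + d := by ring
      omega

theorem iterate_derivative_stepanov (f r : (ZMod p)[X]) (c j : ℕ) {k : ℕ} (hk : k ≤ c) :
    derivative^[k] (f ^ c * r * X ^ (j * p)) =
      f ^ (c - k) * stepanovOp f c k r * X ^ (j * p) := by
  induction k with
  | zero => simp [stepanovOp]
  | succ k ih =>
    rw [Function.iterate_succ_apply', ih (by omega), stepanovOp_succ]
    obtain ⟨n, rfl⟩ : ∃ n, c = k + 1 + n := ⟨c - (k + 1), by omega⟩
    have h1 : k + 1 + n - k = n + 1 := by omega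
    have h2 : k + 1 + n - (k + 1) = n := by omega
    have h3 : derivative (X ^ (j * p) : (ZMod p)[X]) = 0 := by
      simp [derivative_X_pow]
    have h4 : (((k + 1 + n : ℕ) : ZMod p) - k) = n + 1 := by push_cast; ring
    rw [h1, h2, derivative_mul, h3, derivative_mul, derivative_pow, h4]
    simp only [Nat.cast_add, Nat.cast_one, Nat.add_sub_cancel]
    ring

theorem odd_rootMultiplicity_sq_mul_ne {f : (ZMod p)[X]} {α b : ZMod p}
    (hα : Odd (f.rootMultiplicity α)) (hb : b ≠ 0) {r s : (ZMod p)[X]}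
    (h : r ^ 2 * f = C b * s ^ 2) : r = 0 ∧ s = 0 := by
  have hf : f ≠ 0 := by rintro rfl; simp at hα
  by_cases hr : r = 0
  · subst hr
    refine ⟨rfl, ?_⟩
    have : C b * s ^ 2 = 0 := by rw [← h]; ring
    simpa [hb] using this
  · exfalso
    have hs : s ≠ 0 := by
      rintro rfl
      have : r ^ 2 * f = 0 := by rw [h]; ring
      simp [hr, hf] at this
    have h1 : (r ^ 2 * f).rootMultiplicity α =
        2 * r.rootMultiplicity α + f.rootMultiplicity α := by
      rw [rootMultiplicity_mul (mul_ne_zero (pow_ne_zero _ hr) hf), sq,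
        rootMultiplicity_mul (mul_ne_zero hr hr)]; ring
    have h2 : (C b * s ^ 2).rootMultiplicity α = 2 * s.rootMultiplicity α := by
      rw [rootMultiplicity_mul (mul_ne_zero (by simpa using hb) (pow_ne_zero _ hs)),
        sq, rootMultiplicity_mul (mul_ne_zero hs hs), rootMultiplicity_C]
      ring
    rw [h, h2] at h1
    rw [Nat.odd_iff] at hα
    omega

theorem pow_char_eq_C_add (f : (ZMod p)[X]) : ∃ g, f ^ p = C (f.eval 0) + X ^ p * g := by
  have h : (X : (ZMod p)[X]) ∣ f - C (f.eval 0) := by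
    rw [X_dvd_iff]; simp [coeff_zero_eq_eval_zero]
  obtain ⟨g, hg⟩ := h
  refine ⟨g ^ p, ?_⟩
  have : f = C (f.eval 0) + X * g := by rw [← hg]; ring
  conv_lhs => rw [this]
  rw [add_pow_char, mul_pow, ← C_pow, ZMod.pow_card]

theorem natDegree_lt_of_degree_lt' {f : (ZMod p)[X]} {A : ℕ} (hA : 0 < A)
    (h : f.degree < A) : f.natDegree < A := by
  by_cases hf : f = 0
  · simpa [hf] using hA
  · exact (natDegree_lt_iff_degree_lt hf).2 h

theorem stepanov_nonvanishing {f : (ZMod p)[X]} {d A : ℕ} (hf : f.natDegree ≤ d)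
    (hA : 2 * A + d ≤ p + 1) (h0 : f.eval 0 ≠ 0) {α : ZMod p} (hα : Odd (f.rootMultiplicity α))
    (J : ℕ) (r s : Fin J → (ZMod p)[X]) (hr : ∀ j, (r j).degree < A) (hs : ∀ j, (s j).degree < A)
    (h : (∑ j, r j * X ^ (j.1 * p)) ^ 2 * f = f ^ p * (∑ j, s j * X ^ (j.1 * p)) ^ 2) :
    (∀ j, r j = 0) ∧ ∀ j, s j = 0 := by
  have hp : p.Prime := Fact.out
  induction J with
  | zero => exact ⟨fun j => j.elim0, fun j => j.elim0⟩
  | succ J ih =>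
    set R := ∑ j : Fin J, r j.succ * X ^ (j.1 * p) with hR
    set S := ∑ j : Fin J, s j.succ * X ^ (j.1 * p) with hS
    have eR : ∑ j, r j * X ^ (j.1 * p) = r 0 + X ^ p * R := by
      rw [Fin.sum_univ_succ, hR, Finset.mul_sum]
      congr 1
      · simp
      · refine Finset.sum_congr rfl fun j _ => ?_
        rw [Fin.val_succ]; ring
    have eS : ∑ j, s j * X ^ (j.1 * p) = s 0 + X ^ p * S := by
      rw [Fin.sum_univ_succ, hS, Finset.mul_sum]
      congr 1
      · simp
      · refine Finset.sum_congr rfl fun j _ => ?_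
        rw [Fin.val_succ]; ring
    rw [eR, eS] at h
    obtain ⟨g, hg⟩ := pow_char_eq_C_add f
    have hdvd : (X : (ZMod p)[X]) ^ p ∣ r 0 ^ 2 * f - C (f.eval 0) * s 0 ^ 2 := by
      refine ⟨g * (s 0 + X ^ p * S) ^ 2 + C (f.eval 0) * (2 * s 0 * S + X ^ p * S ^ 2)
        - (2 * r 0 * R + X ^ p * R ^ 2) * f, ?_⟩
      rw [hg] at h
      linear_combination h
    have hA0 : 0 < A ∨ A = 0 := by omega
    have hz : r 0 = 0 ∧ s 0 = 0 := by
      rcases hA0 with hA0 | hA0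
      · apply odd_rootMultiplicity_sq_mul_ne hα h0
        rw [← sub_eq_zero]
        refine eq_zero_of_dvd_of_natDegree_lt hdvd ?_
        have hr0 : (r 0).natDegree < A := natDegree_lt_of_degree_lt' hA0 (hr 0)
        have hs0 : (s 0).natDegree < A := natDegree_lt_of_degree_lt' hA0 (hs 0)
        rw [natDegree_X_pow]
        refine (natDegree_sub_le _ _).trans_lt (max_lt ?_ ?_)
        · refine natDegree_mul_le.trans_lt ?_
          have := natDegree_pow_le (p := r 0) (n := 2)
          omega
        · refine (natDegree_C_mul_le _ _).trans_lt ?_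
          have := natDegree_pow_le (p := s 0) (n := 2)
          omega
      · subst hA0
        have := hr 0
        have := hs 0
        simp_all
    obtain ⟨hr0, hs0⟩ := hz
    have hc : R ^ 2 * f = f ^ p * S ^ 2 := by
      have hx : (X ^ p : (ZMod p)[X]) ^ 2 ≠ 0 := pow_ne_zero _ (pow_ne_zero _ X_ne_zero)
      apply mul_left_cancel₀ hx
      rw [hr0, hs0] at h
      linear_combination h
    obtain ⟨h1, h2⟩ := ih (fun j => r j.succ) (fun j => s j.succ) (fun j => hr _) (fun j => hs _) hc
    exact ⟨fun j => Fin.cases hr0 h1 j, fun j => Fin.cases hs0 h2 j⟩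

theorem exists_stepanov_coeffs {f : (ZMod p)[X]} {d A J l : ℕ} (hf : f.natDegree ≤ d)
    (a : ZMod p) (c₁ c₂ : ℕ) (h : l * (A + l * d + J) < 2 * J * A) :
    ∃ r s : Fin J → (ZMod p)[X], (∀ j, (r j).degree < A) ∧ (∀ j, (s j).degree < A) ∧
      ¬ ((∀ j, r j = 0) ∧ ∀ j, s j = 0) ∧
      ∀ k < l, ∑ j, (stepanovOp f c₁ k (r j) + a • stepanovOp f c₂ k (s j)) * X ^ j.1 = 0 := by
  have hA : 0 < A := by
    rcases Nat.eq_zero_or_pos A with rfl | h'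
    · simp at h
    · exact h'
  let V := Fin J → degreeLT (ZMod p) A × degreeLT (ZMod p) A
  let ψ : ℕ → (V →ₗ[ZMod p] (ZMod p)[X]) := fun k => ∑ j : Fin J,
    LinearMap.mulRight (ZMod p) (X ^ j.1) ∘ₗ
      (stepanovOp f c₁ k ∘ₗ (degreeLT (ZMod p) A).subtype ∘ₗ LinearMap.fst _ _ _ +
        a • stepanovOp f c₂ k ∘ₗ (degreeLT (ZMod p) A).subtype ∘ₗ LinearMap.snd _ _ _) ∘ₗ
      LinearMap.proj j
  have hψ : ∀ k v, ψ k v = ∑ j, (stepanovOp f c₁ k (v j).1 + a • stepanovOp f c₂ k (v j).2) *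
      X ^ j.1 := by
    intro k v
    simp [ψ, LinearMap.sum_apply]
    rfl
  have hmem : ∀ k < l, ∀ v, ψ k v ∈ degreeLT (ZMod p) (A + l * d + J) := by
    intro k hk v
    rw [hψ]
    refine Submodule.sum_mem _ fun j _ => ?_
    rw [mem_degreeLT]
    refine degree_le_natDegree.trans_lt (Nat.cast_lt.2 ?_)
    have hkd : k * d ≤ l * d := Nat.mul_le_mul_right _ hk.le
    have h1 := natDegree_stepanovOp_le hf c₁ k (v j).1.1
    have h2 := natDegree_stepanovOp_le hf c₂ k (v j).2.1
    have h3 := natDegree_lt_of_degree_lt' hA (mem_degreeLT.1 (v j).1.2)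
    have h4 := natDegree_lt_of_degree_lt' hA (mem_degreeLT.1 (v j).2.2)
    have h5 := natDegree_smul_le a (stepanovOp f c₂ k (v j).2.1)
    have h6 := natDegree_add_le (stepanovOp f c₁ k (v j).1.1) (a • stepanovOp f c₂ k (v j).2.1)
    have h7 : (stepanovOp f c₁ k (v j).1.1 + a • stepanovOp f c₂ k (v j).2.1).natDegree <
      A + l * d := lt_of_le_of_lt h6 (max_lt (by omega) (by omega))
    refine (natDegree_mul_le).trans_lt ?_
    rw [natDegree_X_pow]
    have := j.2
    omega
  let Ψ : V →ₗ[ZMod p] (Fin l → degreeLT (ZMod p) (A + l * d + J)) :=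
    LinearMap.pi fun k => LinearMap.codRestrict _ (ψ k) (hmem k.1 k.2)
  have hdim : ∀ n, Module.finrank (ZMod p) (degreeLT (ZMod p) n) = n := by
    intro n
    rw [(degreeLTEquiv (ZMod p) n).finrank_eq]
    simp
  have hfin : ∀ n, Module.Finite (ZMod p) (degreeLT (ZMod p) n) := fun n =>
    Module.Finite.equiv (degreeLTEquiv (ZMod p) n).symm
  have hker : LinearMap.ker Ψ ≠ ⊥ := by
    apply LinearMap.ker_ne_bot_of_finrank_lt
    have e1 : Module.finrank (ZMod p) V = 2 * J * A := by
      simp only [V]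
      rw [Module.finrank_pi_fintype]
      simp [Module.finrank_prod, hdim]
      ring
    have e2 : Module.finrank (ZMod p) (Fin l → degreeLT (ZMod p) (A + l * d + J)) =
        l * (A + l * d + J) := by
      rw [Module.finrank_pi_fintype]
      simp [hdim]
    rw [e1, e2]
    exact h
  obtain ⟨v, hv, hv0⟩ := Submodule.exists_mem_ne_zero_of_ne_bot hker
  refine ⟨fun j => (v j).1.1, fun j => (v j).2.1, fun j => mem_degreeLT.1 (v j).1.2,
    fun j => mem_degreeLT.1 (v j).2.2, ?_, ?_⟩
  · rintro ⟨h1, h2⟩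
    apply hv0
    funext j
    exact Prod.ext (Subtype.ext (h1 j)) (Subtype.ext (h2 j))
  · intro k hk
    have : Ψ v ⟨k, hk⟩ = 0 := by
      rw [LinearMap.mem_ker.1 hv]; rfl
    have := congrArg Subtype.val this
    rw [← hψ]
    exact this

theorem card_mul_le_natDegree {Θ : (ZMod p)[X]} {l : ℕ} (S : Finset (ZMod p))
    (h : ∀ x ∈ S, l ≤ Θ.rootMultiplicity x) : S.card * l ≤ Θ.natDegree := by
  classical
  rcases Nat.eq_zero_or_pos l with rfl | hl
  · simp
  have hsub : S ⊆ Θ.roots.toFinset := by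
    intro x hx
    rw [Multiset.mem_toFinset, ← Multiset.count_pos, count_roots]
    exact hl.trans_le (h x hx)
  calc S.card * l = ∑ x ∈ S, l := by simp
    _ ≤ ∑ x ∈ S, Θ.roots.count x := Finset.sum_le_sum fun x hx => by
        rw [count_roots]; exact h x hx
    _ ≤ ∑ x ∈ Θ.roots.toFinset, Θ.roots.count x := Finset.sum_le_sum_of_subset hsub
    _ = Θ.roots.card := Multiset.toFinset_sum_count_eq _
    _ ≤ Θ.natDegree := card_roots' _

theorem stepanov_card_le {f : (ZMod p)[X]} {d A J l e : ℕ} (hf : f.natDegree ≤ d)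
    (hp : p = 2 * e + 1) (hA : 2 * A + d ≤ p + 1) (hl : l ≤ p)
    (h0 : f.eval 0 ≠ 0) {α : ZMod p} (hα : Odd (f.rootMultiplicity α))
    (h : l * (A + l * d + J) < 2 * J * A) (a : ZMod p) (S : Finset (ZMod p))
    (hS : ∀ x ∈ S, f.eval x ^ e = a) :
    S.card * l ≤ (l + e) * d + A + J * p := by
  classical
  have hpp : p.Prime := Fact.out
  have hf0 : f ≠ 0 := by rintro rfl; simp at hα
  obtain ⟨r, s, hr, hs, hne, hΨ⟩ := exists_stepanov_coeffs hf a l (l + e) h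
  have hA0 : 0 < A := by
    rcases Nat.eq_zero_or_pos A with rfl | h'
    · simp at h
    · exact h'
  set Θ : (ZMod p)[X] := ∑ j, (f ^ l * r j * X ^ (j.1 * p) + f ^ (l + e) * s j * X ^ (j.1 * p))
    with hΘ
  have hΘ0 : Θ ≠ 0 := by
    intro hz
    apply hne
    refine stepanov_nonvanishing hf hA h0 hα J r s hr hs ?_
    have h1 : Θ = f ^ l * ((∑ j, r j * X ^ (j.1 * p)) + f ^ e * ∑ j, s j * X ^ (j.1 * p)) := by
      rw [hΘ, Finset.sum_add_distrib, mul_add, Finset.mul_sum, Finset.mul_sum, Finset.mul_sum]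
      congr 1
      · exact Finset.sum_congr rfl fun j _ => by ring
      · exact Finset.sum_congr rfl fun j _ => by ring
    rw [hz] at h1
    have h2 := (mul_eq_zero.1 h1.symm).resolve_left (pow_ne_zero _ hf0)
    have h3 : f ^ p = f ^ e * f ^ e * f := by
      calc f ^ p = f ^ (2 * e + 1) := congrArg (f ^ ·) hp
        _ = _ := by ring
    rw [eq_neg_of_add_eq_zero_left h2, h3]
    ring
  have hroot : ∀ x ∈ S, l ≤ Θ.rootMultiplicity x := by
    intro x hx
    rcases Nat.eq_zero_or_pos l with rfl | hlpos
    · simp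
    have := lt_rootMultiplicity_of_isRoot_iterate_derivative_of_mem_nonZeroDivisors' (n := l - 1)
      (t := x) hΘ0 ?_ ?_
    · omega
    · intro k hk
      have hk' : k < l := by omega
      rw [IsRoot, hΘ, iterate_derivative_sum, eval_finsetSum]
      have h1 := congrArg (eval x) (hΨ k hk')
      rw [eval_finsetSum, eval_zero] at h1
      calc _ = ∑ j, f.eval x ^ (l - k) * eval x ((stepanovOp f l k (r j) +
              a • stepanovOp f (l + e) k (s j)) * X ^ j.1) := by
            refine Finset.sum_congr rfl fun j _ => ?_
            rw [iterate_map_add, iterate_derivative_stepanov f _ _ _ (by omega),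
              iterate_derivative_stepanov f _ _ _ (by omega)]
            have e1 : l + e - k = (l - k) + e := by omega
            have e2 : x ^ (j.1 * p) = x ^ j.1 := by
              rw [mul_comm, pow_mul, ZMod.pow_card]
            simp only [eval_add, eval_mul, eval_pow, eval_X, eval_smul, smul_eq_mul, e1, e2,
              pow_add, hS x hx]
            ring
        _ = 0 := by rw [← Finset.mul_sum, h1, mul_zero]
    · intro m hm hm0
      rw [mem_nonZeroDivisors_iff_ne_zero, Ne, ZMod.natCast_eq_zero_iff]
      exact Nat.not_dvd_of_pos_of_lt (by omega) (by omega)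
  refine (card_mul_le_natDegree S hroot).trans ?_
  rw [hΘ]
  refine natDegree_sum_le_of_forall_le _ _ fun j _ => ?_
  have hj : (j.1 + 1) * p ≤ J * p := Nat.mul_le_mul_right _ j.2
  have hr1 := natDegree_lt_of_degree_lt' hA0 (hr j)
  have hs1 := natDegree_lt_of_degree_lt' hA0 (hs j)
  have hp1 : (f ^ l).natDegree ≤ (l + e) * d := natDegree_pow_le.trans
    (Nat.mul_le_mul (by omega) hf)
  have hp2 : (f ^ (l + e)).natDegree ≤ (l + e) * d := natDegree_pow_le.trans
    (Nat.mul_le_mul le_rfl hf)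
  have hjj : (j.1 + 1) * p = j.1 * p + p := by ring
  refine (natDegree_add_le _ _).trans (max_le ?_ ?_)
  · refine natDegree_mul_le.trans ?_
    have := natDegree_mul_le (p := f ^ l) (q := r j)
    rw [natDegree_X_pow]
    omega
  · refine natDegree_mul_le.trans ?_
    have := natDegree_mul_le (p := f ^ (l + e)) (q := s j)
    rw [natDegree_X_pow]
    omega

/-- Stepanov's bound for the number of points at which the power `f ^ (p / 2)` takes a given
value. -/
theorem stepanov_card_le_sqrt {f : (ZMod p)[X]} {d : ℕ} (hf : f.natDegree ≤ d) (hp2 : p ≠ 2)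
    (hlarge : 16 * (d + 2) ^ 2 ≤ p) (h0 : f.eval 0 ≠ 0) {α : ZMod p}
    (hα : Odd (f.rootMultiplicity α)) (a : ZMod p) (S : Finset (ZMod p))
    (hS : ∀ x ∈ S, f.eval x ^ (p / 2) = a) :
    (S.card : ℝ) ≤ p / 2 + (4 * d + 6) * √p := by
  have hpp : p.Prime := Fact.out
  have hodd : p = 2 * (p / 2) + 1 := by
    have := hpp.eq_two_or_odd
    omega
  have hl1 : p.sqrt * p.sqrt ≤ p := Nat.sqrt_le p
  have hl2 : p < (p.sqrt + 1) * (p.sqrt + 1) := Nat.lt_succ_sqrt p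
  set l := p.sqrt with hl
  have hl4 : 4 * (d + 2) ≤ l := by
    rw [hl, Nat.le_sqrt]
    nlinarith
  have hlp : l ≤ p := Nat.sqrt_le_self p
  set A := (p + 1 - d) / 2 with hA
  have hA1 : 2 * A + d ≤ p + 1 := by
    have : d ≤ p := by nlinarith
    omega
  have hA2 : p ≤ 2 * A + d := by omega
  set J := l / 2 + d + 2 with hJ
  have hJ1 : l ≤ 2 * (l / 2) + 1 := by omega
  have hcond : l * (A + l * d + J) < 2 * J * A := by
    have e1 : l * A ≤ (2 * (l / 2) + 1) * A := Nat.mul_le_mul_right _ hJ1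
    have e2 : l * l * d ≤ p * d := Nat.mul_le_mul_right _ hl1
    have e3 : 2 * (l * (l / 2)) ≤ p := by
      have : 2 * (l / 2) ≤ l := by omega
      nlinarith
    have e4 : l * (d + 2) * 4 ≤ p := by nlinarith
    have e5 : p * (2 * d + 3) ≤ (2 * A + d) * (2 * d + 3) := Nat.mul_le_mul_right _ hA2
    have e6 : l * (A + l * d + J) = l * A + l * l * d + l * (l / 2) + l * (d + 2) := by
      rw [hJ]; ring
    have e7 : 2 * J * A = (2 * (l / 2) + 1) * A + (2 * d + 3) * A := by rw [hJ]; ring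
    rw [e6, e7]
    nlinarith
  have key := stepanov_card_le hf hodd hA1 hlp h0 hα hcond a S hS
  have hkey : (S.card : ℝ) * l ≤ (l + (p / 2 : ℕ)) * d + A + J * p := by exact_mod_cast key
  have hsq : √(p : ℝ) * √p = p := Real.mul_self_sqrt (Nat.cast_nonneg p)
  have hs0 : 0 ≤ √(p : ℝ) := Real.sqrt_nonneg _
  have hs1 : √(p : ℝ) ≤ l + 1 := by
    rw [Real.sqrt_le_left (by positivity)]
    have : (p : ℝ) < (l + 1) * (l + 1) := by exact_mod_cast hl2
    nlinarith
  have hl8 : (8 : ℝ) ≤ l := by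
    have : 8 ≤ l := by omega
    exact_mod_cast this
  have hp1 : (p : ℝ) ≤ 2 * l * √p := by nlinarith
  have he : ((p / 2 : ℕ) : ℝ) ≤ p / 2 := Nat.cast_div_le
  have hA' : (A : ℝ) ≤ p := by
    have : A ≤ p := by
      have := hpp.one_lt
      omega
    exact_mod_cast this
  have hJ' : (J : ℝ) ≤ l / 2 + d + 2 := by
    rw [hJ]
    push_cast
    have : ((l / 2 : ℕ) : ℝ) ≤ l / 2 := Nat.cast_div_le
    linarith
  have hs2 : 1 ≤ √(p : ℝ) := by
    rw [Real.one_le_sqrt]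
    exact_mod_cast hpp.one_lt.le
  have hd0 : (0 : ℝ) ≤ d := Nat.cast_nonneg d
  have hlpos : (0 : ℝ) < l := by linarith
  have hbound : (S.card : ℝ) * l ≤ (p / 2 + (4 * d + 6) * √p) * l := by
    have e1 : ((p / 2 : ℕ) : ℝ) * d ≤ p / 2 * d := by gcongr
    have e2 : (J : ℝ) * p ≤ (l / 2 + d + 2) * p := by gcongr
    have e3 : (p : ℝ) * (3 / 2 * d + 3) ≤ 2 * l * √p * (3 / 2 * d + 3) := by gcongr
    have e4 : (l : ℝ) * d * 1 ≤ l * d * √p := by gcongr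
    nlinarith
  exact le_of_mul_le_mul_right hbound hlpos

/-- A Weil-type bound, by Stepanov's method, for quadratic character sums of polynomials. -/
theorem abs_sum_quadraticChar_eval_le {f : (ZMod p)[X]} {d : ℕ} (hf : f.natDegree ≤ d)
    (hp2 : p ≠ 2) (h0 : f.eval 0 ≠ 0) {α : ZMod p} (hα : Odd (f.rootMultiplicity α)) :
    |(∑ x, quadraticChar (ZMod p) (f.eval x) : ℝ)| ≤ (9 * d + 12) * √p := by
  classical
  have hpp : p.Prime := Fact.out
  have hsq : √(p : ℝ) * √p = p := Real.mul_self_sqrt (Nat.cast_nonneg p)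
  have hs0 : 0 ≤ √(p : ℝ) := Real.sqrt_nonneg _
  have hd0 : (0 : ℝ) ≤ d := Nat.cast_nonneg d
  have hs2 : 1 ≤ √(p : ℝ) := by
    rw [Real.one_le_sqrt]
    exact_mod_cast hpp.one_lt.le
  have hcharF : ringChar (ZMod p) ≠ 2 := by rwa [ZMod.ringChar_zmod_n]
  have hf0 : f ≠ 0 := by rintro rfl; simp at hα
  rcases lt_or_ge p (16 * (d + 2) ^ 2) with hlt | hlarge
  · have h1 : |(∑ x, quadraticChar (ZMod p) (f.eval x) : ℝ)| ≤ p := by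
      refine (Finset.abs_sum_le_sum_abs _ _).trans ?_
      calc _ ≤ ∑ x : ZMod p, (1 : ℝ) := by
            refine Finset.sum_le_sum fun x _ => ?_
            by_cases hx : f.eval x = 0
            · simp [hx]
            · rcases quadraticChar_dichotomy hx with h | h <;> simp [h]
        _ = p := by simp [ZMod.card]
    have h2 : √(p : ℝ) ≤ 4 * (d + 2) := by
      rw [Real.sqrt_le_left (by positivity)]
      have : (p : ℝ) < 16 * (d + 2) ^ 2 := by exact_mod_cast hlt
      nlinarith
    nlinarith
  · set S₁ : Finset (ZMod p) := Finset.univ.filter fun x => quadraticChar (ZMod p) (f.eval x) = 1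
      with hS₁
    set S₂ : Finset (ZMod p) := Finset.univ.filter fun x => quadraticChar (ZMod p) (f.eval x) = -1
      with hS₂
    set S₀ : Finset (ZMod p) := Finset.univ.filter fun x => f.eval x = 0 with hS₀
    have b₁ : (S₁.card : ℝ) ≤ p / 2 + (4 * d + 6) * √p := by
      refine stepanov_card_le_sqrt hf hp2 hlarge h0 hα 1 S₁ fun x hx => ?_
      have := quadraticChar_eq_pow_of_char_ne_two' hcharF (f.eval x)
      rw [(Finset.mem_filter.1 hx).2, ZMod.card] at this
      simpa using this.symm
    have b₂ : (S₂.card : ℝ) ≤ p / 2 + (4 * d + 6) * √p := by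
      refine stepanov_card_le_sqrt hf hp2 hlarge h0 hα (-1) S₂ fun x hx => ?_
      have := quadraticChar_eq_pow_of_char_ne_two' hcharF (f.eval x)
      rw [(Finset.mem_filter.1 hx).2, ZMod.card] at this
      simpa using this.symm
    have b₀ : (S₀.card : ℝ) ≤ d := by
      have : S₀.card * 1 ≤ f.natDegree := by
        refine card_mul_le_natDegree S₀ fun x hx => ?_
        exact (rootMultiplicity_pos hf0).2 (Finset.mem_filter.1 hx).2
      exact_mod_cast (by omega : S₀.card ≤ d)
    have hsum : (∑ x, quadraticChar (ZMod p) (f.eval x) : ℝ) = S₁.card - S₂.card := by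
      rw [Finset.card_filter, Finset.card_filter]
      push_cast
      rw [← Finset.sum_sub_distrib]
      refine Finset.sum_congr rfl fun x _ => ?_
      by_cases hx : f.eval x = 0
      · simp [hx]
      · rcases quadraticChar_dichotomy hx with h | h <;> simp [h]
    have htot : (p : ℝ) = S₀.card + S₁.card + S₂.card := by
      have : (p : ℝ) = ∑ x : ZMod p, (1 : ℝ) := by simp [ZMod.card]
      rw [this, Finset.card_filter, Finset.card_filter, Finset.card_filter]
      push_cast
      rw [← Finset.sum_add_distrib, ← Finset.sum_add_distrib]
      refine Finset.sum_congr rfl fun x _ => ?_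
      by_cases hx : f.eval x = 0
      · simp [hx]
      · rcases quadraticChar_dichotomy hx with h | h <;> simp [h, hx]
    have hdd : (d : ℝ) * 1 ≤ d * √p := by gcongr
    rw [hsum, abs_le]
    constructor <;> nlinarith

end Stepanov

section Burgess

variable {p : ℕ} [Fact p.Prime]

/-- The quadratic character modulo `p` as a real-valued function. -/
noncomputable def qchar (p : ℕ) [Fact p.Prime] (x : ZMod p) : ℝ := (quadraticChar (ZMod p) x : ℤ)

theorem qchar_mul (x y : ZMod p) : qchar p (x * y) = qchar p x * qchar p y := by
  rw [qchar, map_mul]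
  push_cast
  rfl

theorem abs_qchar_of_ne_zero {x : ZMod p} (hx : x ≠ 0) : |qchar p x| = 1 := by
  rcases quadraticChar_dichotomy hx with h | h <;> simp [qchar, h]

theorem abs_qchar_le_one (x : ZMod p) : |qchar p x| ≤ 1 := by
  by_cases hx : x = 0
  · simp [qchar, hx]
  · exact (abs_qchar_of_ne_zero hx).le

theorem card_even_fibers_le (R H : ℕ) :
    (Finset.univ.filter fun h : Fin (2 * R) → Fin H =>
      ∀ v, Even (Finset.univ.filter fun i => h i = v).card).card ≤ R ^ (2 * R) * H ^ R := by
  classical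
  rcases Nat.eq_zero_or_pos R with rfl | hR
  · refine (Finset.card_le_univ _).trans ?_
    simp
  have hsub : (Finset.univ.filter fun h : Fin (2 * R) → Fin H =>
      ∀ v, Even (Finset.univ.filter fun i => h i = v).card) ⊆
      (Finset.univ : Finset ((Fin (2 * R) → Fin R) × (Fin R → Fin H))).image
        fun x => x.2 ∘ x.1 := by
    intro h hh
    have hev := (Finset.mem_filter.1 hh).2
    set I := Finset.univ.image h with hI
    have hcard : I.card * 2 ≤ 2 * R := by
      have h1 : 2 * R = ∑ v ∈ I, (Finset.univ.filter fun i => h i = v).card := by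
        have := Finset.card_eq_sum_card_image h (Finset.univ : Finset (Fin (2 * R)))
        simpa using this
      rw [h1, ← smul_eq_mul, ← Finset.sum_const]
      refine Finset.sum_le_sum fun v hv => ?_
      obtain ⟨i, -, hi⟩ := Finset.mem_image.1 hv
      have hpos : 0 < (Finset.univ.filter fun i => h i = v).card :=
        Finset.card_pos.2 ⟨i, by simp [hi]⟩
      obtain ⟨k, hk⟩ := hev v
      omega
    have hIR : I.card ≤ R := by omega
    let i₀ : Fin (2 * R) := ⟨0, by omega⟩
    let g : Fin R → Fin H := fun j => if hj : j.1 < I.card then (I.equivFin.symm ⟨j.1, hj⟩).1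
      else h i₀
    let k : Fin (2 * R) → Fin R := fun i =>
      ⟨(I.equivFin ⟨h i, Finset.mem_image_of_mem h (Finset.mem_univ i)⟩).1,
        (I.equivFin _).2.trans_le hIR⟩
    refine Finset.mem_image.2 ⟨(k, g), Finset.mem_univ _, ?_⟩
    funext i
    simp [g, k]
  refine (Finset.card_le_card hsub).trans (Finset.card_image_le.trans ?_)
  simp

theorem abs_sum_prod_qchar_le (hp2 : p ≠ 2) {R H : ℕ} (hH : H < p) (h : Fin (2 * R) → Fin H)
    (hodd : ¬ ∀ v, Even (Finset.univ.filter fun i => h i = v).card) :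
    |∑ t, ∏ i, qchar p (t + ((h i : ℕ) + 1 : ℕ))| ≤ (18 * R + 12) * √p := by
  classical
  let a : Fin (2 * R) → ZMod p := fun i => -(((h i : ℕ) + 1 : ℕ) : ZMod p)
  let f : (ZMod p)[X] := ((Finset.univ.val.map a).map fun b => X - C b).prod
  have hroots : f.roots = Finset.univ.val.map a := roots_multiset_prod_X_sub_C _
  have heval : ∀ t, f.eval t = ∏ i, (t + ((h i : ℕ) + 1 : ℕ)) := by
    intro t
    simp only [f, Multiset.map_map, Function.comp_def]
    change eval t (∏ i, (X - C (a i))) = _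
    rw [eval_prod]
    simp only [a, eval_sub, eval_X, eval_C, sub_neg_eq_add]
  have hne : ∀ m : ℕ, m < H → (((m + 1 : ℕ)) : ZMod p) ≠ 0 := by
    intro m hm h0
    rw [ZMod.natCast_eq_zero_iff] at h0
    exact Nat.not_dvd_of_pos_of_lt (by omega) (by omega) h0
  have hinj : ∀ i v, a i = -(((v : Fin H).1 + 1 : ℕ) : ZMod p) ↔ h i = v := by
    intro i v
    constructor
    · intro he
      have h1 := neg_injective he
      rw [ZMod.natCast_eq_natCast_iff] at h1
      have h2 := Nat.ModEq.eq_of_lt_of_lt h1 (by omega) (by omega)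
      exact Fin.ext (by omega)
    · rintro rfl
      rfl
  push Not at hodd
  obtain ⟨v, hv⟩ := hodd
  have hmult : Odd (f.rootMultiplicity (-((v.1 + 1 : ℕ) : ZMod p))) := by
    rw [← count_roots, hroots, Multiset.count_map]
    rw [← Nat.not_even_iff_odd]
    convert hv using 3
    rw [Finset.card_def, Finset.filter_val]
    congr 1
    refine Multiset.filter_congr fun i _ => ?_
    rw [← hinj i v, eq_comm]
  have hdeg : f.natDegree ≤ 2 * R := by
    simp only [f]
    rw [natDegree_multiset_prod_X_sub_C_eq_card]
    simp
  have := abs_sum_quadraticChar_eval_le hdeg hp2 (by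
    rw [heval]
    refine Finset.prod_ne_zero_iff.2 fun i _ => ?_
    rw [zero_add]
    exact hne _ (h i).2) hmult
  refine le_trans (le_of_eq ?_) (this.trans (le_of_eq (by push_cast; ring)))
  congr 1
  refine Finset.sum_congr rfl fun t _ => ?_
  rw [heval, map_prod]
  simp [qchar]

theorem moment_le (hp2 : p ≠ 2) (R : ℕ) {H : ℕ} (hH : H < p) :
    ∑ t, (∑ b : Fin H, qchar p (t + ((b : ℕ) + 1 : ℕ))) ^ (2 * R) ≤
      R ^ (2 * R) * H ^ R * p + (18 * R + 12) * √p * H ^ (2 * R) := by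
  classical
  simp only [Fintype.sum_pow]
  rw [Finset.sum_comm]
  set E := (Finset.univ.filter fun h : Fin (2 * R) → Fin H =>
      ∀ v, Even (Finset.univ.filter fun i => h i = v).card) with hE
  rw [← Finset.sum_filter_add_sum_filter_not Finset.univ (fun h : Fin (2 * R) → Fin H =>
      ∀ v, Even (Finset.univ.filter fun i => h i = v).card)]
  refine add_le_add ?_ ?_
  · calc _ ≤ ∑ h ∈ E, (p : ℝ) := by
          refine Finset.sum_le_sum fun h _ => ?_
          calc _ ≤ ∑ t : ZMod p, (1 : ℝ) := by
                refine Finset.sum_le_sum fun t _ => (le_abs_self _).trans ?_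
                rw [Finset.abs_prod]
                exact Finset.prod_le_one (fun i _ => abs_nonneg _) fun i _ => abs_qchar_le_one _
            _ = p := by simp [ZMod.card]
      _ = E.card * p := by simp
      _ ≤ _ := by
          have : (E.card : ℝ) ≤ R ^ (2 * R) * H ^ R := by exact_mod_cast card_even_fibers_le R H
          gcongr
  · calc _ ≤ ∑ h ∈ Finset.univ.filter (fun h : Fin (2 * R) → Fin H =>
              ¬ ∀ v, Even (Finset.univ.filter fun i => h i = v).card),
            (18 * R + 12) * √(p : ℝ) := by
          refine Finset.sum_le_sum fun h hh => (le_abs_self _).trans ?_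
          exact abs_sum_prod_qchar_le hp2 hH h (Finset.mem_filter.1 hh).2
      _ ≤ ∑ h : Fin (2 * R) → Fin H, (18 * R + 12) * √(p : ℝ) :=
          Finset.sum_le_sum_of_subset_of_nonneg (Finset.filter_subset _ _)
            fun _ _ _ => by positivity
      _ = _ := by simp; ring

theorem card_le_of_forall_modEq {T : Finset ℕ} {N k : ℕ} (hT : T ⊆ Finset.range N)
    (h : ∀ x ∈ T, ∀ y ∈ T, x ≡ y [MOD k]) : T.card ≤ N / k + 1 := by
  have : Set.InjOn (fun x => x / k) T := by
    intro x hx y hy hxy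
    have h1 := h x hx y hy
    have h2 := Nat.div_add_mod x k
    have h3 := Nat.div_add_mod y k
    simp only at hxy
    rw [← h2, ← h3, hxy, h1]
  rw [← Finset.card_image_of_injOn this]
  refine (Finset.card_le_card (t := Finset.range (N / k + 1)) ?_).trans (by simp)
  intro z hz
  obtain ⟨x, hx, rfl⟩ := Finset.mem_image.1 hz
  have := Finset.mem_range.1 (hT hx)
  exact Finset.mem_range.2 (Nat.lt_succ_of_le (Nat.div_le_div_right this.le))

theorem sum_inv_multiples_le (A d : ℕ) :
    ∑ a ∈ (Finset.Icc 1 A).filter (fun a => d ∣ a), (1 / a : ℝ) ≤ 1 / d * (1 + Real.log A) := by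
  rcases Nat.eq_zero_or_pos d with rfl | hd
  · refine le_of_eq ?_
    simp only [CharP.cast_eq_zero, div_zero, zero_mul]
    refine Finset.sum_eq_zero fun a ha => ?_
    have := (Finset.mem_filter.1 ha).2
    rw [zero_dvd_iff] at this
    simp [this]
  have hsub : (Finset.Icc 1 A).filter (fun a => d ∣ a) ⊆
      (Finset.Icc 1 A).image fun u => d * u := by
    intro a ha
    obtain ⟨h1, u, rfl⟩ := Finset.mem_filter.1 ha
    rw [Finset.mem_Icc] at h1
    refine Finset.mem_image.2 ⟨u, Finset.mem_Icc.2 ⟨?_, ?_⟩, rfl⟩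
    · exact Nat.pos_of_ne_zero (by rintro rfl; simp at h1)
    · nlinarith
  calc _ ≤ ∑ a ∈ (Finset.Icc 1 A).image fun u => d * u, (1 / a : ℝ) :=
        Finset.sum_le_sum_of_subset_of_nonneg hsub fun _ _ _ => by positivity
    _ = ∑ u ∈ Finset.Icc 1 A, (1 / (d * u : ℕ) : ℝ) :=
        Finset.sum_image fun u _ v _ h => Nat.eq_of_mul_eq_mul_left hd h
    _ = 1 / d * ∑ u ∈ Finset.Icc 1 A, (1 / u : ℝ) := by
        rw [Finset.mul_sum]
        refine Finset.sum_congr rfl fun u _ => ?_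
        push_cast
        rw [one_div_mul_one_div]
    _ ≤ _ := by
        gcongr
        have := harmonic_le_one_add_log A
        rw [harmonic_eq_sum_Icc] at this
        push_cast at this
        simpa using this

theorem card_multiples_le (A d : ℕ) (hd : 0 < d) :
    ((Finset.Icc 1 A).filter (fun a => d ∣ a)).card ≤ A / d := by
  have hsub : (Finset.Icc 1 A).filter (fun a => d ∣ a) ⊆
      (Finset.Icc 1 (A / d)).image fun u => d * u := by
    intro a ha
    obtain ⟨h1, u, rfl⟩ := Finset.mem_filter.1 ha
    rw [Finset.mem_Icc] at h1
    refine Finset.mem_image.2 ⟨u, Finset.mem_Icc.2 ⟨?_, ?_⟩, rfl⟩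
    · exact Nat.pos_of_ne_zero (by rintro rfl; simp at h1)
    · rw [Nat.le_div_iff_mul_le hd]; linarith
  refine (Finset.card_le_card hsub).trans (Finset.card_image_le.trans ?_)
  simp

theorem sum_gcd_div_le (A : ℕ) :
    ∑ a ∈ Finset.Icc 1 A, ∑ a' ∈ Finset.Icc 1 A, (Nat.gcd a a' : ℝ) / a ≤
      A * (1 + Real.log A) ^ 2 := by
  have hL : 0 ≤ 1 + Real.log A := by
    have := Real.log_natCast_nonneg A
    linarith
  calc _ ≤ ∑ a ∈ Finset.Icc 1 A, ∑ a' ∈ Finset.Icc 1 A, ∑ d ∈ Finset.Icc 1 A,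
        (if d ∣ a then (1 / a : ℝ) else 0) * (d * if d ∣ a' then (1 : ℝ) else 0) := by
        refine Finset.sum_le_sum fun a ha => Finset.sum_le_sum fun a' ha' => ?_
        rw [Finset.mem_Icc] at ha ha'
        have hg : Nat.gcd a a' ∈ Finset.Icc 1 A := Finset.mem_Icc.2
          ⟨Nat.gcd_pos_of_pos_left _ (by omega), (Nat.gcd_le_left _ (by omega)).trans ha.2⟩
        refine le_trans (le_of_eq ?_) (Finset.single_le_sum (f := fun d : ℕ =>
          (if d ∣ a then (1 / a : ℝ) else 0) * (d * if d ∣ a' then (1 : ℝ) else 0))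
          (fun d _ => by positivity) hg)
        simp only [Nat.gcd_dvd_left, Nat.gcd_dvd_right, if_true]
        ring
    _ = ∑ d ∈ Finset.Icc 1 A, (∑ a ∈ Finset.Icc 1 A, if d ∣ a then (1 / a : ℝ) else 0) *
          (d * ∑ a' ∈ Finset.Icc 1 A, if d ∣ a' then (1 : ℝ) else 0) := by
        simp_rw [Finset.mul_sum, Finset.sum_mul]
        rw [Finset.sum_congr rfl fun a _ => Finset.sum_comm]
        rw [Finset.sum_comm]
        refine Finset.sum_congr rfl fun d _ => ?_
        rw [Finset.sum_comm]
    _ ≤ ∑ d ∈ Finset.Icc 1 A, (1 / d * (1 + Real.log A)) * A := by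
        refine Finset.sum_le_sum fun d hd => ?_
        rw [Finset.mem_Icc] at hd
        have hd0 : (0 : ℝ) < d := by exact_mod_cast hd.1
        rw [← Finset.sum_filter, ← Finset.sum_filter]
        gcongr
        · exact sum_inv_multiples_le A d
        · rw [Finset.sum_const, nsmul_eq_mul, mul_one]
          have h1 : (((Finset.Icc 1 A).filter (fun a => d ∣ a)).card : ℝ) ≤ A / d :=
            (Nat.cast_le.2 (card_multiples_le A d hd.1)).trans Nat.cast_div_le
          calc _ ≤ (d : ℝ) * (A / d) := by gcongr
            _ = A := by field_simp
    _ = A * (1 + Real.log A) * ∑ d ∈ (Finset.Icc 1 A).filter (fun a => 1 ∣ a), (1 / d : ℝ) := by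
        rw [Finset.filter_true_of_mem (by simp), Finset.mul_sum]
        exact Finset.sum_congr rfl fun d _ => by ring
    _ ≤ A * (1 + Real.log A) * (1 / (1 : ℕ) * (1 + Real.log A)) := by
        gcongr
        exact sum_inv_multiples_le A 1
    _ = _ := by simp; ring

theorem natCast_ne_zero_of_lt {a : ℕ} (h0 : 0 < a) (h : a < p) : (a : ZMod p) ≠ 0 := by
  rw [Ne, ZMod.natCast_eq_zero_iff]
  exact Nat.not_dvd_of_pos_of_lt h0 h

theorem card_ratio_eq_le {A N : ℕ} (hAN : 2 * (A * N) < p) (hAp : A < p) (hNp : N < p)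
    (s : ZMod p) {a a' : ℕ}
    (ha : a ∈ Finset.Icc 1 A) (ha' : a' ∈ Finset.Icc 1 A) :
    ((Finset.range N ×ˢ Finset.range N).filter fun n : ℕ × ℕ =>
      (s + n.1) * (a : ZMod p)⁻¹ = (s + n.2) * (a' : ZMod p)⁻¹).card ≤
      N * ((Nat.gcd a a' : ℝ) / a) + 1 := by
  rw [Finset.mem_Icc] at ha ha'
  set T := (Finset.range N ×ˢ Finset.range N).filter fun n : ℕ × ℕ =>
      (s + n.1) * (a : ZMod p)⁻¹ = (s + n.2) * (a' : ZMod p)⁻¹ with hT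
  have ha0 := natCast_ne_zero_of_lt (p := p) ha.1 (by omega)
  have ha0' := natCast_ne_zero_of_lt (p := p) ha'.1 (by omega)
  have hTm : ∀ n ∈ T, n.1 < N ∧ n.2 < N ∧ (a' : ZMod p) * (s + n.1) = a * (s + n.2) := by
    intro n hn
    rw [hT, Finset.mem_filter, Finset.mem_product, Finset.mem_range, Finset.mem_range] at hn
    refine ⟨hn.1.1, hn.1.2, ?_⟩
    have := hn.2
    field_simp at this
    linear_combination this
  have hinj : Set.InjOn Prod.fst (T : Set (ℕ × ℕ)) := by
    intro x hx y hy hxy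
    obtain ⟨h1, h2, h3⟩ := hTm x hx
    obtain ⟨h4, h5, h6⟩ := hTm y hy
    rw [hxy, h6] at h3
    have h7 := add_left_cancel (mul_left_cancel₀ ha0 h3)
    rw [ZMod.natCast_eq_natCast_iff] at h7
    have h8 := Nat.ModEq.eq_of_lt_of_lt h7 (by omega) (by omega)
    exact Prod.ext hxy h8.symm
  rw [← Finset.card_image_of_injOn hinj]
  set g := Nat.gcd a a' with hg
  have hg0 : 0 < g := Nat.gcd_pos_of_pos_left _ ha.1
  have hkey : (T.image Prod.fst).card ≤ N / (a / g) + 1 := by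
    refine card_le_of_forall_modEq ?_ ?_
    · intro n hn
      obtain ⟨x, hx, rfl⟩ := Finset.mem_image.1 hn
      exact Finset.mem_range.2 (hTm x hx).1
    · intro n hn n' hn'
      obtain ⟨x, hx, rfl⟩ := Finset.mem_image.1 hn
      obtain ⟨y, hy, rfl⟩ := Finset.mem_image.1 hn'
      obtain ⟨h1, h2, h3⟩ := hTm x hx
      obtain ⟨h4, h5, h6⟩ := hTm y hy
      have hmod : (((a' : ℤ) * (x.1 - y.1) - a * (x.2 - y.2) : ℤ) : ZMod p) = 0 := by
        push_cast
        linear_combination h3 - h6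
      rw [ZMod.intCast_zmod_eq_zero_iff_dvd] at hmod
      have hzero : (a' : ℤ) * (x.1 - y.1) - a * (x.2 - y.2) = 0 := by
        apply Int.eq_zero_of_abs_lt_dvd hmod
        have b1 : |(a' : ℤ) * (x.1 - y.1)| ≤ A * N := by
          rw [abs_mul, Nat.abs_cast]
          refine mul_le_mul (by exact_mod_cast ha'.2) ?_ (abs_nonneg _) (by positivity)
          rw [abs_le]; constructor <;> linarith [(by exact_mod_cast h1 : (x.1 : ℤ) < N),
            (by exact_mod_cast h4 : (y.1 : ℤ) < N)]
        have b2 : |(a : ℤ) * (x.2 - y.2)| ≤ A * N := by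
          rw [abs_mul, Nat.abs_cast]
          refine mul_le_mul (by exact_mod_cast ha.2) ?_ (abs_nonneg _) (by positivity)
          rw [abs_le]; constructor <;> linarith [(by exact_mod_cast h2 : (x.2 : ℤ) < N),
            (by exact_mod_cast h5 : (y.2 : ℤ) < N)]
        refine (abs_sub _ _).trans_lt ?_
        have : 2 * ((A : ℤ) * N) < p := by exact_mod_cast hAN
        linarith
      obtain ⟨u, hu⟩ : g ∣ a := Nat.gcd_dvd_left _ _
      obtain ⟨u', hu'⟩ : g ∣ a' := Nat.gcd_dvd_right _ _
      have hau : a / g = u := by rw [hu]; exact Nat.mul_div_cancel_left _ hg0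
      have hcop : Nat.Coprime u u' := by
        have h7 := Nat.coprime_div_gcd_div_gcd (m := a) (n := a') hg0
        rw [← hg] at h7
        rwa [hau, hu', Nat.mul_div_cancel_left _ hg0] at h7
      have hd : (u : ℤ) ∣ u' * (x.1 - y.1) := by
        refine ⟨x.2 - y.2, ?_⟩
        have hgz : (g : ℤ) ≠ 0 := by exact_mod_cast hg0.ne'
        apply mul_left_cancel₀ hgz
        have e1 : (a : ℤ) = g * u := by exact_mod_cast hu
        have e2 : (a' : ℤ) = g * u' := by exact_mod_cast hu'
        rw [e1, e2] at hzero
        linear_combination hzero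
      have hd' := IsCoprime.dvd_of_dvd_mul_left (Nat.isCoprime_iff_coprime.2 hcop) hd
      rw [hau, Nat.ModEq.comm, Nat.modEq_iff_dvd]
      exact hd'
  have : ((T.image Prod.fst).card : ℝ) ≤ (N / (a / g) : ℕ) + 1 := by exact_mod_cast hkey
  refine this.trans ?_
  gcongr
  refine Nat.cast_div_le.trans (le_of_eq ?_)
  rw [Nat.cast_div (Nat.gcd_dvd_left _ _) (by exact_mod_cast hg0.ne')]
  rw [div_div_eq_mul_div, mul_div_assoc]

theorem sum_sq_fiber_le {A N : ℕ} (hA : 1 ≤ A) (hAleN : A ≤ N) (hAN : 2 * (A * N) < p)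
    (s : ZMod p) :
    ∑ t : ZMod p, (((Finset.Icc 1 A ×ˢ Finset.range N).filter fun x : ℕ × ℕ =>
      (s + x.2) * (x.1 : ZMod p)⁻¹ = t).card : ℝ) ^ 2 ≤ 2 * A * N * (1 + Real.log A) ^ 2 := by
  classical
  have hL : 1 ≤ 1 + Real.log A := by
    have := Real.log_natCast_nonneg A
    linarith
  have hAp : A < p := by nlinarith
  have hNp : N < p := by nlinarith
  calc _ = ∑ a ∈ Finset.Icc 1 A, ∑ a' ∈ Finset.Icc 1 A,
          (((Finset.range N ×ˢ Finset.range N).filter fun n : ℕ × ℕ =>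
            (s + n.1) * (a : ZMod p)⁻¹ = (s + n.2) * (a' : ZMod p)⁻¹).card : ℝ) := by
        have e1 : ∀ t : ZMod p, (((Finset.Icc 1 A ×ˢ Finset.range N).filter fun x : ℕ × ℕ =>
            (s + x.2) * (x.1 : ZMod p)⁻¹ = t).card : ℝ) ^ 2 =
            ∑ a ∈ Finset.Icc 1 A, ∑ n ∈ Finset.range N, ∑ a' ∈ Finset.Icc 1 A,
            ∑ n' ∈ Finset.range N, if (s + n) * (a : ZMod p)⁻¹ = t then
              (if (s + n') * (a' : ZMod p)⁻¹ = t then (1 : ℝ) else 0) else 0 := by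
          intro t
          rw [Finset.card_filter, Nat.cast_sum, Finset.sum_product, sq, Finset.sum_mul]
          refine Finset.sum_congr rfl fun a _ => ?_
          rw [Finset.sum_mul]
          refine Finset.sum_congr rfl fun n _ => ?_
          rw [Finset.mul_sum]
          refine Finset.sum_congr rfl fun a' _ => ?_
          rw [Finset.mul_sum]
          refine Finset.sum_congr rfl fun n' _ => ?_
          split_ifs <;> simp
        simp_rw [e1]
        rw [Finset.sum_comm]
        refine Finset.sum_congr rfl fun a _ => ?_
        rw [Finset.sum_comm]
        rw [Finset.sum_congr rfl fun n _ => Finset.sum_comm]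
        rw [Finset.sum_comm]
        refine Finset.sum_congr rfl fun a' _ => ?_
        rw [Finset.card_filter, Nat.cast_sum, Finset.sum_product]
        refine Finset.sum_congr rfl fun n _ => ?_
        rw [Finset.sum_comm]
        refine Finset.sum_congr rfl fun n' _ => ?_
        rw [Finset.sum_ite_eq Finset.univ]
        simp [eq_comm]
    _ ≤ ∑ a ∈ Finset.Icc 1 A, ∑ a' ∈ Finset.Icc 1 A, (N * ((Nat.gcd a a' : ℝ) / a) + 1) :=
        Finset.sum_le_sum fun a ha => Finset.sum_le_sum fun a' ha' =>
          card_ratio_eq_le hAN hAp hNp s ha ha'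
    _ = N * (∑ a ∈ Finset.Icc 1 A, ∑ a' ∈ Finset.Icc 1 A, (Nat.gcd a a' : ℝ) / a) + A * A := by
        simp_rw [Finset.sum_add_distrib, ← Finset.mul_sum]
        simp
    _ ≤ N * (A * (1 + Real.log A) ^ 2) + A * N * (1 + Real.log A) ^ 2 := by
        have h1 := sum_gcd_div_le A
        have h2 : (A : ℝ) ≤ N := by exact_mod_cast hAleN
        have h3 : (1 : ℝ) ≤ (1 + Real.log A) ^ 2 := one_le_pow₀ hL
        have h4 : (A : ℝ) * A ≤ A * N := by gcongr
        have h5 : (A : ℝ) * N * 1 ≤ A * N * (1 + Real.log A) ^ 2 := by gcongr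
        have h6 := mul_le_mul_of_nonneg_left h1 (Nat.cast_nonneg (α := ℝ) N)
        linarith
    _ = _ := by ring

theorem abs_sum_shift_sub_le (g : ℕ → ℝ) (hg : ∀ n, |g n| ≤ 1) (N k : ℕ) :
    |∑ n ∈ Finset.range N, g (n + k) - ∑ n ∈ Finset.range N, g n| ≤ 2 * k := by
  induction k with
  | zero => simp
  | succ k ih =>
    have h1 : ∑ n ∈ Finset.range N, g (n + (k + 1)) - ∑ n ∈ Finset.range N, g (n + k) =
        g (N + k) - g k := by
      rw [← Finset.sum_sub_distrib]
      have := Finset.sum_range_sub (fun n => g (n + k)) N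
      rw [zero_add] at this
      rw [← this]
      exact Finset.sum_congr rfl fun n _ => by rw [show n + (k + 1) = n + 1 + k by ring]
    have h2 : |g (N + k) - g k| ≤ 2 := by
      have a1 := abs_le.1 (hg (N + k))
      have a2 := abs_le.1 (hg k)
      rw [abs_le]; constructor <;> linarith
    have h3 : ∑ n ∈ Finset.range N, g (n + (k + 1)) - ∑ n ∈ Finset.range N, g n =
        (g (N + k) - g k) + (∑ n ∈ Finset.range N, g (n + k) - ∑ n ∈ Finset.range N, g n) := by
      rw [← h1]; ring
    rw [h3]
    refine (abs_add_le _ _).trans ?_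
    push_cast
    linarith

/-- The sum over pairs `(a, n)` of the short character sums that occur after shifting. -/
noncomputable def shiftedSum (p : ℕ) [Fact p.Prime] (A H N : ℕ) (s : ZMod p) : ℝ :=
  ∑ x ∈ Finset.Icc 1 A ×ˢ Finset.range N,
    |∑ b : Fin H, qchar p ((s + x.2) * (x.1 : ZMod p)⁻¹ + ((b : ℕ) + 1 : ℕ))|

theorem abs_sum_qchar_le_shiftedSum {A H N : ℕ} (hA : A < p) (s : ZMod p) :
    (A * H : ℝ) * |∑ n ∈ Finset.range N, qchar p (s + n)| ≤
      shiftedSum p A H N s + A * H * (2 * (A * H)) := by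
  classical
  set S := ∑ n ∈ Finset.range N, qchar p (s + n) with hS
  have h1 : ∀ a ∈ Finset.Icc 1 A, ∀ b : Fin H,
      |∑ n ∈ Finset.range N, qchar p (s + n + (a : ZMod p) * ((b : ℕ) + 1 : ℕ)) - S| ≤
        2 * (A * H) := by
    intro a ha b
    have := abs_sum_shift_sub_le (fun n => qchar p (s + n)) (fun n => abs_qchar_le_one _) N
      (a * (b + 1))
    refine le_trans (le_of_eq ?_) (this.trans ?_)
    · congr 2
      refine Finset.sum_congr rfl fun n _ => ?_
      congr 1
      push_cast
      ring
    · have h2 : a * (b.1 + 1) ≤ A * H := Nat.mul_le_mul (Finset.mem_Icc.1 ha).2 b.2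
      have h3 : ((a * (b.1 + 1) : ℕ) : ℝ) ≤ A * H := by exact_mod_cast h2
      linarith
  have h2 : |∑ a ∈ Finset.Icc 1 A, ∑ b : Fin H,
      (∑ n ∈ Finset.range N, qchar p (s + n + (a : ZMod p) * ((b : ℕ) + 1 : ℕ)) - S)| ≤
        A * H * (2 * (A * H)) := by
    refine (Finset.abs_sum_le_sum_abs _ _).trans ?_
    calc _ ≤ ∑ a ∈ Finset.Icc 1 A, ∑ b : Fin H, (2 * (A * H) : ℝ) := by
          refine Finset.sum_le_sum fun a ha => (Finset.abs_sum_le_sum_abs _ _).trans ?_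
          exact Finset.sum_le_sum fun b _ => h1 a ha b
      _ = _ := by simp; ring
  have h3 : ∑ a ∈ Finset.Icc 1 A, ∑ b : Fin H,
      (∑ n ∈ Finset.range N, qchar p (s + n + (a : ZMod p) * ((b : ℕ) + 1 : ℕ)) - S) =
      (∑ a ∈ Finset.Icc 1 A, ∑ n ∈ Finset.range N, ∑ b : Fin H,
        qchar p (s + n + (a : ZMod p) * ((b : ℕ) + 1 : ℕ))) - A * H * S := by
    simp_rw [Finset.sum_sub_distrib]
    congr 1
    · refine Finset.sum_congr rfl fun a _ => Finset.sum_comm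
    · simp; ring
  have h4 : |∑ a ∈ Finset.Icc 1 A, ∑ n ∈ Finset.range N, ∑ b : Fin H,
        qchar p (s + n + (a : ZMod p) * ((b : ℕ) + 1 : ℕ))| ≤ shiftedSum p A H N s := by
    rw [shiftedSum, Finset.sum_product]
    refine (Finset.abs_sum_le_sum_abs _ _).trans (Finset.sum_le_sum fun a ha => ?_)
    refine (Finset.abs_sum_le_sum_abs _ _).trans (Finset.sum_le_sum fun n _ => ?_)
    rw [Finset.mem_Icc] at ha
    have ha0 := natCast_ne_zero_of_lt (p := p) ha.1 (by omega)
    have : ∑ b : Fin H, qchar p (s + n + (a : ZMod p) * ((b : ℕ) + 1 : ℕ)) =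
        qchar p a * ∑ b : Fin H, qchar p ((s + n) * (a : ZMod p)⁻¹ + ((b : ℕ) + 1 : ℕ)) := by
      rw [Finset.mul_sum]
      refine Finset.sum_congr rfl fun b _ => ?_
      rw [← qchar_mul]
      congr 1
      field_simp
    rw [this, abs_mul, abs_qchar_of_ne_zero ha0, one_mul]
  rw [h3] at h2
  have h5 : (A * H : ℝ) * |S| = |A * H * S| := by
    rw [abs_mul, abs_of_nonneg (by positivity : (0 : ℝ) ≤ A * H)]
  rw [h5]
  have := abs_sub_abs_le_abs_sub (A * H * S) (∑ a ∈ Finset.Icc 1 A, ∑ n ∈ Finset.range N,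
    ∑ b : Fin H, qchar p (s + n + (a : ZMod p) * ((b : ℕ) + 1 : ℕ)))
  rw [abs_sub_comm] at this
  linarith

theorem shiftedSum_pow_le (hp2 : p ≠ 2) {R A H N : ℕ} (hR : 1 ≤ R) (hA : 1 ≤ A) (hAleN : A ≤ N)
    (hAN : 2 * (A * N) < p) (hH : H < p) (hHR : √(p : ℝ) ≤ H ^ R) (s : ZMod p) :
    shiftedSum p A H N s ^ (2 * R) ≤ (A * N * H : ℝ) ^ (2 * R) *
      (2 * (R ^ (2 * R) + 18 * R + 12) * (1 + Real.log A) ^ 2 * √p / (A * N)) := by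
  classical
  obtain ⟨Q, rfl⟩ : ∃ Q, R = Q + 1 := ⟨R - 1, by omega⟩
  set I := Finset.Icc 1 A ×ˢ Finset.range N with hI
  set τ : ℕ × ℕ → ZMod p := fun x => (s + x.2) * (x.1 : ZMod p)⁻¹ with hτ
  set M : ZMod p → ℝ := fun t => |∑ b : Fin H, qchar p (t + ((b : ℕ) + 1 : ℕ))| with hM
  have hIc : (I.card : ℝ) = A * N := by simp [hI]
  have hANpos : (0 : ℝ) < A * N := by
    have : 0 < A * N := Nat.mul_pos (by omega) (by omega)
    exact_mod_cast this
  have hT : shiftedSum p A H N s = ∑ x ∈ I, M (τ x) := rfl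
  have h1 : (∑ x ∈ I, M (τ x)) ^ (Q + 1) ≤ (A * N : ℝ) ^ Q * ∑ x ∈ I, M (τ x) ^ (Q + 1) := by
    have := pow_sum_div_card_le_sum_pow (s := I) (f := fun x => M (τ x))
      (fun x _ => abs_nonneg _) Q
    rw [hIc, div_le_iff₀ (by positivity)] at this
    linarith
  have h2 : ∑ x ∈ I, M (τ x) ^ (Q + 1) =
      ∑ t, ((I.filter fun x => τ x = t).card : ℝ) * M t ^ (Q + 1) := by
    rw [← Finset.sum_fiberwise I τ]
    refine Finset.sum_congr rfl fun t _ => ?_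
    rw [← nsmul_eq_mul, ← Finset.sum_const]
    exact Finset.sum_congr rfl fun x hx => by rw [(Finset.mem_filter.1 hx).2]
  have h3 : (∑ x ∈ I, M (τ x) ^ (Q + 1)) ^ 2 ≤
      (2 * A * N * (1 + Real.log A) ^ 2) *
        (((Q + 1 : ℕ) ^ (2 * (Q + 1)) + 18 * (Q + 1 : ℕ) + 12) * √p * H ^ (2 * (Q + 1))) := by
    rw [h2]
    refine (Finset.sum_mul_sq_le_sq_mul_sq _ _ _).trans ?_
    gcongr
    · exact sum_sq_fiber_le hA hAleN hAN s
    · have e1 : ∀ t, (M t ^ (Q + 1)) ^ 2 =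
          (∑ b : Fin H, qchar p (t + ((b : ℕ) + 1 : ℕ))) ^ (2 * (Q + 1)) := by
        intro t
        rw [← pow_mul, mul_comm (Q + 1) 2]
        exact (even_two_mul _).pow_abs _
      simp_rw [e1]
      refine (moment_le hp2 (Q + 1) hH).trans ?_
      have hsq : √(p : ℝ) * √p = p := Real.mul_self_sqrt (Nat.cast_nonneg p)
      have e2 : (H : ℝ) ^ (Q + 1) * p ≤ √p * H ^ (2 * (Q + 1)) := by
        calc (H : ℝ) ^ (Q + 1) * p = H ^ (Q + 1) * √p * √p := by rw [mul_assoc, hsq]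
          _ ≤ H ^ (Q + 1) * H ^ (Q + 1) * √p := by gcongr
          _ = _ := by ring
      have e3 : (0 : ℝ) ≤ (Q + 1 : ℕ) ^ (2 * (Q + 1)) := by positivity
      have e4 := mul_le_mul_of_nonneg_left e2 e3
      nlinarith
  have hM0 : 0 ≤ ∑ x ∈ I, M (τ x) := Finset.sum_nonneg fun x _ => abs_nonneg _
  have h4 : (∑ x ∈ I, M (τ x)) ^ (2 * (Q + 1)) ≤ ((A * N : ℝ) ^ Q) ^ 2 *
      (∑ x ∈ I, M (τ x) ^ (Q + 1)) ^ 2 := by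
    calc _ = ((∑ x ∈ I, M (τ x)) ^ (Q + 1)) ^ 2 := by rw [← pow_mul, mul_comm 2]
      _ ≤ ((A * N : ℝ) ^ Q * ∑ x ∈ I, M (τ x) ^ (Q + 1)) ^ 2 := by gcongr
      _ = _ := by rw [mul_pow]
  rw [hT]
  refine h4.trans ((mul_le_mul_of_nonneg_left h3 (by positivity)).trans (le_of_eq ?_))
  have hAne : (A : ℝ) ≠ 0 := left_ne_zero_of_mul hANpos.ne'
  have hNne : (N : ℝ) ≠ 0 := right_ne_zero_of_mul hANpos.ne'
  field_simp
  ring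

end Burgess

section Burgess

theorem eventually_burgess_params (K : ℝ) : ∀ᶠ x : ℝ in Filter.atTop, 3 ≤ x ∧
    4 * K * (1 + Real.log x) ^ 2 ≤ x ^ (0.005 : ℝ) ∧ 8 * x ^ (0.51 : ℝ) < x ∧
    2 * x ^ (0.005 : ℝ) < x ∧ 4 ≤ x ^ (0.004 : ℝ) ∧ 2 ≤ x ^ (0.000005 : ℝ) := by
  have hl := (isLittleO_log_rpow_atTop (r := 0.002) (by norm_num)).bound (c := 1) one_pos
  have ht : ∀ r : ℝ, 0 < r → ∀ c : ℝ, ∀ᶠ x : ℝ in Filter.atTop, c ≤ x ^ r := fun r hr c =>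
    (tendsto_rpow_atTop hr).eventually_ge_atTop c
  filter_upwards [hl, ht 0.001 (by norm_num) (16 * |K|), ht 0.49 (by norm_num) 9,
    ht 0.995 (by norm_num) 3, ht 0.004 (by norm_num) 4, ht 0.000005 (by norm_num) 2,
    Filter.eventually_ge_atTop 3] with x h1 h2 h3 h4 h5 h6 h7
  have hx : 0 < x := by linarith
  have hlog : 1 ≤ Real.log x := by
    rw [Real.le_log_iff_exp_le hx]
    exact Real.exp_one_lt_three.le.trans h7
  refine ⟨h7, ?_, ?_, ?_, h5, h6⟩
  · rw [one_mul, Real.norm_of_nonneg (by linarith), Real.norm_of_nonneg (by positivity)] at h1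
    calc 4 * K * (1 + Real.log x) ^ 2 ≤ 4 * |K| * (2 * x ^ (0.002 : ℝ)) ^ 2 := by
          have := le_abs_self K
          gcongr
          linarith
      _ = 16 * |K| * (x ^ (0.002 : ℝ)) ^ 2 := by ring
      _ ≤ x ^ (0.001 : ℝ) * (x ^ (0.002 : ℝ)) ^ 2 := by gcongr
      _ = x ^ (0.005 : ℝ) := by
          rw [← Real.rpow_natCast, ← Real.rpow_mul hx.le, ← Real.rpow_add hx]
          norm_num
  · calc 8 * x ^ (0.51 : ℝ) < 9 * x ^ (0.51 : ℝ) := by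
          have : 0 < x ^ (0.51 : ℝ) := by positivity
          linarith
      _ ≤ x ^ (0.49 : ℝ) * x ^ (0.51 : ℝ) := by gcongr
      _ = x := by rw [← Real.rpow_add hx]; norm_num
  · calc 2 * x ^ (0.005 : ℝ) < 3 * x ^ (0.005 : ℝ) := by
          have : 0 < x ^ (0.005 : ℝ) := by positivity
          linarith
      _ ≤ x ^ (0.995 : ℝ) * x ^ (0.005 : ℝ) := by gcongr
      _ = x := by rw [← Real.rpow_add hx]; norm_num

theorem burgess_short {p : ℕ} [Fact p.Prime] {K : ℝ}
    (hK : K = ((100 : ℕ) : ℝ) ^ (2 * 100) + 18 * (100 : ℕ) + 12)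
    (hx3 : 3 ≤ (p : ℝ)) (hx1 : 4 * K * (1 + Real.log p) ^ 2 ≤ (p : ℝ) ^ (0.005 : ℝ))
    (hx2 : 8 * (p : ℝ) ^ (0.51 : ℝ) < p)
    (hx4 : 2 * (p : ℝ) ^ (0.005 : ℝ) < p) (hx5 : 4 ≤ (p : ℝ) ^ (0.004 : ℝ))
    (hx6 : 2 ≤ (p : ℝ) ^ (0.000005 : ℝ)) (s : ZMod p) {N : ℕ} (hN : (p : ℝ) ^ (0.26 : ℝ) ≤ N)
    (hN2 : N < 2 * ⌈(p : ℝ) ^ (0.26 : ℝ)⌉₊) :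
    |∑ n ∈ Finset.range N, qchar p (s + n)| ≤ N * (p : ℝ) ^ (-(0.00002 : ℝ)) := by
  set x : ℝ := (p : ℝ) with hx
  have hx0 : 0 < x := by linarith
  have hx1' : 1 ≤ x := by linarith
  have hp2 : p ≠ 2 := by
    rintro rfl
    norm_num [hx] at hx3
  set A := ⌊x ^ (0.25 : ℝ)⌋₊ with hA
  set H := ⌈x ^ (0.005 : ℝ)⌉₊ with hH
  have h26 : 1 ≤ x ^ (0.26 : ℝ) := Real.one_le_rpow hx1' (by norm_num)
  have h25 : 1 ≤ x ^ (0.25 : ℝ) := Real.one_le_rpow hx1' (by norm_num)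
  have h005 : 1 ≤ x ^ (0.005 : ℝ) := Real.one_le_rpow hx1' (by norm_num)
  have hAle : (A : ℝ) ≤ x ^ (0.25 : ℝ) := Nat.floor_le (by linarith)
  have hA1 : 1 ≤ A := Nat.le_floor (by simpa using h25)
  have hAge : x ^ (0.25 : ℝ) ≤ 2 * A := by
    have h1 := Nat.lt_floor_add_one (x ^ (0.25 : ℝ))
    have h2 : (1 : ℝ) ≤ A := by exact_mod_cast hA1
    rw [← hA] at h1
    linarith
  have hHge : x ^ (0.005 : ℝ) ≤ H := Nat.le_ceil _
  have hHle : (H : ℝ) ≤ 2 * x ^ (0.005 : ℝ) := by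
    have := Nat.ceil_lt_add_one (a := x ^ (0.005 : ℝ)) (by linarith)
    rw [← hH] at this
    linarith
  have hNle : (N : ℝ) ≤ 4 * x ^ (0.26 : ℝ) := by
    have h1 := Nat.ceil_lt_add_one (a := x ^ (0.26 : ℝ)) (by linarith)
    have h2 : (N : ℝ) < 2 * ⌈x ^ (0.26 : ℝ)⌉₊ := by exact_mod_cast hN2
    linarith
  have hAleN : A ≤ N := by
    have : (A : ℝ) ≤ N := hAle.trans ((Real.rpow_le_rpow_of_exponent_le hx1'
      (by norm_num)).trans hN)
    exact_mod_cast this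
  have hAN : 2 * (A * N) < p := by
    have : 2 * ((A : ℝ) * N) < p := by
      calc 2 * ((A : ℝ) * N) ≤ 2 * (x ^ (0.25 : ℝ) * (4 * x ^ (0.26 : ℝ))) := by gcongr
        _ = 8 * (x ^ (0.25 : ℝ) * x ^ (0.26 : ℝ)) := by ring
        _ = 8 * x ^ (0.51 : ℝ) := by rw [← Real.rpow_add hx0]; norm_num
        _ < x := hx2
    exact_mod_cast this
  have hHp : H < p := by
    have : (H : ℝ) < p := hHle.trans_lt hx4
    exact_mod_cast this
  have hHR : √x ≤ (H : ℝ) ^ 100 := by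
    calc √x = (x ^ (0.005 : ℝ)) ^ 100 := by
          rw [← Real.rpow_natCast, ← Real.rpow_mul hx0.le, Real.sqrt_eq_rpow]
          norm_num
      _ ≤ _ := by gcongr
  have hApos : (0 : ℝ) < A := by exact_mod_cast hA1
  have hHpos : (0 : ℝ) < H := by linarith
  have hNpos : (0 : ℝ) < N := by linarith
  have hAp : A < p := by
    have : 1 ≤ N := hA1.trans hAleN
    nlinarith
  have h1 := shiftedSum_pow_le hp2 (R := 100) (by norm_num) hA1 hAleN hAN hHp hHR s
  have h2 := abs_sum_qchar_le_shiftedSum (H := H) (N := N) hAp s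
  rw [← hK] at h1
  set T := shiftedSum p A H N s with hT
  have hK0 : 0 ≤ K := by rw [hK]; positivity
  have h3 : 2 * K * (1 + Real.log A) ^ 2 * √(p : ℝ) / (A * N) ≤ x ^ (-(0.005 : ℝ)) := by
    rw [div_le_iff₀ (by positivity)]
    have hlog : Real.log A ≤ Real.log x := Real.log_le_log hApos (Nat.cast_le.2 hAp.le)
    have hlog0 : 0 ≤ Real.log A := Real.log_natCast_nonneg A
    calc 2 * K * (1 + Real.log A) ^ 2 * √x ≤ 2 * K * (1 + Real.log x) ^ 2 * √x := by gcongr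
      _ = 4 * K * (1 + Real.log x) ^ 2 * √x / 2 := by ring
      _ ≤ x ^ (0.005 : ℝ) * √x / 2 := by gcongr
      _ = x ^ (-(0.005 : ℝ)) * (x ^ (0.25 : ℝ) / 2 * x ^ (0.26 : ℝ)) := by
          have e : x ^ (0.005 : ℝ) * √x =
              x ^ (-(0.005 : ℝ)) * (x ^ (0.25 : ℝ) * x ^ (0.26 : ℝ)) := by
            rw [Real.sqrt_eq_rpow, ← Real.rpow_add hx0, ← Real.rpow_add hx0,
              ← Real.rpow_add hx0]
            norm_num
          rw [e]; ring
      _ ≤ x ^ (-(0.005 : ℝ)) * (A * N) := by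
          gcongr
          linarith
  have h4 : T ≤ A * N * H * x ^ (-(0.000025 : ℝ)) := by
    have hpow : T ^ (2 * 100) ≤ (A * N * H * x ^ (-(0.000025 : ℝ))) ^ (2 * 100) := by
      have e1 : x ^ (-(0.005 : ℝ)) = (x ^ (-(0.000025 : ℝ))) ^ (2 * 100) := by
        rw [← Real.rpow_natCast, ← Real.rpow_mul hx0.le]
        norm_num
      rw [e1] at h3
      rw [mul_pow]
      have hn : (0 : ℝ) ≤ (A * N * H : ℝ) ^ (2 * 100) := pow_nonneg (by positivity) _
      exact h1.trans (mul_le_mul_of_nonneg_left h3 hn)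
    exact le_of_pow_le_pow_left₀ (by norm_num) (by positivity) hpow
  have h5 : |∑ n ∈ Finset.range N, qchar p (s + n)| ≤ N * x ^ (-(0.000025 : ℝ)) + 2 * (A * H) := by
    have hAH : (0 : ℝ) < A * H := by positivity
    refine le_of_mul_le_mul_left (h2.trans ?_) hAH
    nlinarith
  have h6 : 2 * ((A : ℝ) * H) ≤ N * x ^ (-(0.000025 : ℝ)) := by
    calc 2 * ((A : ℝ) * H) ≤ 2 * (x ^ (0.25 : ℝ) * (2 * x ^ (0.005 : ℝ))) := by gcongr
      _ = 4 * (x ^ (0.25 : ℝ) * x ^ (0.005 : ℝ)) := by ring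
      _ ≤ x ^ (0.004 : ℝ) * (x ^ (0.25 : ℝ) * x ^ (0.005 : ℝ)) := by gcongr
      _ = x ^ (0.259 : ℝ) := by
          rw [← Real.rpow_add hx0, ← Real.rpow_add hx0]; norm_num
      _ ≤ x ^ (0.26 + -0.000025 : ℝ) := Real.rpow_le_rpow_of_exponent_le hx1' (by norm_num)
      _ = x ^ (0.26 : ℝ) * x ^ (-(0.000025 : ℝ)) := Real.rpow_add hx0 _ _
      _ ≤ _ := by gcongr
  calc _ ≤ N * x ^ (-(0.000025 : ℝ)) + N * x ^ (-(0.000025 : ℝ)) := h5.trans (by linarith)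
    _ = N * (2 * x ^ (-(0.000025 : ℝ))) := by ring
    _ ≤ N * (x ^ (0.000005 : ℝ) * x ^ (-(0.000025 : ℝ))) := by gcongr
    _ = N * x ^ (-(0.00002 : ℝ)) := by rw [← Real.rpow_add hx0]; norm_num

/-- A Burgess bound for short sums of the quadratic character. -/
theorem burgess_bound : ∃ p₀ : ℕ, ∀ (p : ℕ) [Fact p.Prime], p₀ ≤ p → ∀ (s : ZMod p) (N : ℕ),
    (p : ℝ) ^ (0.26 : ℝ) ≤ N →
    |∑ n ∈ Finset.range N, qchar p (s + n)| ≤ N * (p : ℝ) ^ (-(0.00002 : ℝ)) := by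
  obtain ⟨x₀, hx₀⟩ := Filter.eventually_atTop.1
    (eventually_burgess_params (((100 : ℕ) : ℝ) ^ (2 * 100) + 18 * (100 : ℕ) + 12))
  refine ⟨⌈x₀⌉₊, fun p _ hp s N hN => ?_⟩
  obtain ⟨h1, h2, h3, h4, h5, h6⟩ := hx₀ p (Nat.ceil_le.1 hp)
  induction N using Nat.strong_induction_on generalizing s with
  | _ N ih =>
    set N₀ := ⌈(p : ℝ) ^ (0.26 : ℝ)⌉₊ with hN₀
    rcases lt_or_ge N (2 * N₀) with hlt | hge
    · exact burgess_short rfl h1 h2 h3 h4 h5 h6 s hN hlt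
    · have hpos : 0 < N₀ := Nat.ceil_pos.2 (by positivity)
      obtain ⟨M, rfl⟩ : ∃ M, N = N₀ + M := ⟨N - N₀, by omega⟩
      have hM := ih M (by omega) (s + N₀)
        ((Nat.le_ceil _).trans (by exact_mod_cast (by omega : N₀ ≤ M)))
      have hb := burgess_short rfl h1 h2 h3 h4 h5 h6 s (N := N₀) (Nat.le_ceil _) (by omega)
      rw [Finset.sum_range_add]
      refine (abs_add_le _ _).trans ?_
      push_cast
      rw [add_mul]
      refine add_le_add hb (le_trans (le_of_eq ?_) hM)
      simp only [add_assoc]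

end Burgess

open Finset in
theorem sum_Ioc_mul_eq_hyperbola {R : Type*} [CommRing R] (f g : ArithmeticFunction R) {N U : ℕ}
    (hU : U ≤ N) :
    ∑ n ∈ Ioc 0 N, (f * g) n = ∑ a ∈ Ioc 0 U, f a * ∑ b ∈ Ioc 0 (N / a), g b +
      ∑ b ∈ Ioc 0 (N / (U + 1)), g b * (∑ a ∈ Ioc 0 (N / b), f a - ∑ a ∈ Ioc 0 U, f a) := by
  rw [ArithmeticFunction.sum_Ioc_mul_eq_sum_sum, ← Finset.sum_Ioc_consecutive _ (Nat.zero_le U) hU]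
  congr 1
  have h1 : ∀ b ∈ Ioc 0 (N / (U + 1)), g b * (∑ a ∈ Ioc 0 (N / b), f a - ∑ a ∈ Ioc 0 U, f a) =
      ∑ a ∈ Ioc U (N / b), f a * g b := by
    intro b hb
    rw [Finset.mem_Ioc] at hb
    have : U + 1 ≤ N / b := by
      rw [Nat.le_div_iff_mul_le hb.1, mul_comm]
      exact (Nat.le_div_iff_mul_le (by omega)).1 hb.2
    rw [← Finset.sum_Ioc_consecutive _ (Nat.zero_le U) (by omega : U ≤ N / b),
      add_sub_cancel_left, mul_comm, Finset.sum_mul]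
  rw [Finset.sum_congr rfl h1]
  simp_rw [Finset.mul_sum]
  refine Finset.sum_comm' fun a b => ?_
  simp only [Finset.mem_Ioc]
  constructor
  · rintro ⟨⟨h1, h2⟩, h3, h4⟩
    have h5 : b * a ≤ N := (Nat.le_div_iff_mul_le (by omega)).1 h4
    refine ⟨⟨h1, (Nat.le_div_iff_mul_le h3).2 (by linarith)⟩, h3, ?_⟩
    rw [Nat.le_div_iff_mul_le (by omega)]
    nlinarith
  · rintro ⟨⟨h1, h2⟩, h3, h4⟩
    have h5 : a * b ≤ N := (Nat.le_div_iff_mul_le h3).1 h2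
    refine ⟨⟨h1, ?_⟩, h3, (Nat.le_div_iff_mul_le (by omega)).2 (by linarith)⟩
    nlinarith

theorem sum_inv_le_one_add_log (N : ℕ) :
    ∑ n ∈ Finset.Ioc 0 N, (1 / n : ℝ) ≤ 1 + Real.log N := by
  have := harmonic_le_one_add_log N
  rw [harmonic_eq_sum_Icc] at this
  push_cast at this
  rw [show Finset.Ioc 0 N = Finset.Icc 1 N from rfl]
  simpa using this

theorem sum_norm_div_mul_le (f g : ArithmeticFunction ℂ) (N : ℕ) :
    ∑ n ∈ Finset.Ioc 0 N, ‖(f * g) n‖ / n ≤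
      (∑ n ∈ Finset.Ioc 0 N, ‖f n‖ / n) * ∑ n ∈ Finset.Ioc 0 N, ‖g n‖ / n := by
  let F : ArithmeticFunction ℝ := ⟨fun n => ‖f n‖ / n, by simp⟩
  let G : ArithmeticFunction ℝ := ⟨fun n => ‖g n‖ / n, by simp⟩
  calc _ ≤ ∑ n ∈ Finset.Ioc 0 N, (F * G) n := by
        refine Finset.sum_le_sum fun n hn => ?_
        rw [ArithmeticFunction.mul_apply, ArithmeticFunction.mul_apply, ]
        calc _ ≤ (∑ x ∈ n.divisorsAntidiagonal, ‖f x.1 * g x.2‖) / n := by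
              gcongr
              exact norm_sum_le _ _
          _ = _ := by
              rw [Finset.sum_div]
              refine Finset.sum_congr rfl fun x hx => ?_
              have h1 := (Nat.mem_divisorsAntidiagonal.1 hx).1
              change _ = ‖f x.1‖ / x.1 * (‖g x.2‖ / x.2)
              rw [← h1, norm_mul]
              push_cast
              rw [div_mul_div_comm]
    _ ≤ _ := by
        rw [ArithmeticFunction.sum_Ioc_mul_eq_sum_sum, Finset.sum_mul]
        refine Finset.sum_le_sum fun a ha => ?_
        change ‖f a‖ / a * _ ≤ _
        gcongr
        exact Finset.sum_le_sum_of_subset_of_nonneg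
          (Finset.Ioc_subset_Ioc_right (Nat.div_le_self _ _))
          fun b _ _ => div_nonneg (norm_nonneg _) (Nat.cast_nonneg _)

theorem sum_norm_div_le_of_norm_le_one {g : ArithmeticFunction ℂ} (hg : ∀ n, ‖g n‖ ≤ 1) (N : ℕ) :
    ∑ n ∈ Finset.Ioc 0 N, ‖g n‖ / n ≤ 1 + Real.log N := by
  refine le_trans (Finset.sum_le_sum fun n _ => ?_) (sum_inv_le_one_add_log N)
  gcongr
  exact hg n

theorem sum_norm_prod_div_le {ι : Type*} (s : Finset ι) (g : ι → ArithmeticFunction ℂ)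
    (hg : ∀ i ∈ s, ∀ n, ‖g i n‖ ≤ 1) (N : ℕ) :
    ∑ n ∈ Finset.Ioc 0 N, ‖(∏ i ∈ s, g i) n‖ / n ≤ (1 + Real.log N) ^ s.card := by
  classical
  have hL : 0 ≤ Real.log N := Real.log_natCast_nonneg N
  induction s using Finset.induction_on with
  | empty =>
    simp only [Finset.prod_empty, Finset.card_empty, pow_zero]
    calc _ ≤ ∑ n ∈ Finset.Ioc 0 N, if n = 1 then (1 : ℝ) else 0 := by
          refine Finset.sum_le_sum fun n _ => ?_
          rw [ArithmeticFunction.one_apply]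
          split_ifs with h <;> simp [h]
      _ ≤ 1 := by
          rw [Finset.sum_ite_eq']
          split_ifs <;> norm_num
  | insert i s hi ih =>
    rw [Finset.prod_insert hi, Finset.card_insert_of_notMem hi]
    refine (sum_norm_div_mul_le _ _ N).trans ?_
    rw [pow_succ, mul_comm]
    exact mul_le_mul (ih fun j hj => hg j (Finset.mem_insert_of_mem hj))
      (sum_norm_div_le_of_norm_le_one (hg i (Finset.mem_insert_self _ _)) N)
      (Finset.sum_nonneg fun _ _ => by positivity) (by positivity)

theorem norm_sum_le_mul_sum_div (f : ℕ → ℂ) (N : ℕ) :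
    ‖∑ n ∈ Finset.Ioc 0 N, f n‖ ≤ N * ∑ n ∈ Finset.Ioc 0 N, ‖f n‖ / n := by
  refine (norm_sum_le _ _).trans ?_
  rw [Finset.mul_sum]
  refine Finset.sum_le_sum fun n hn => ?_
  rw [Finset.mem_Ioc] at hn
  have h0 : (0 : ℝ) < n := by exact_mod_cast hn.1
  have h1 : (n : ℝ) ≤ N := by exact_mod_cast hn.2
  rw [mul_div_assoc', le_div_iff₀ h0, mul_comm]
  gcongr

theorem norm_sum_mul_le {f g : ArithmeticFunction ℂ} {C Z δ B V L : ℝ} {D N : ℕ}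
    (hV : 1 ≤ V) (hVN : V ≤ N) (hZ : 0 < Z) (hδ0 : 0 < δ) (hδ1 : δ ≤ 1)
    (hL : 1 + Real.log N ≤ L) (hB : 0 ≤ B) (hC : 0 ≤ C)
    (hg1 : ∀ n, ‖g n‖ ≤ 1) (hf1 : ∑ n ∈ Finset.Ioc 0 N, ‖f n‖ / n ≤ L ^ D)
    (hg : ∀ n : ℕ, 1 ≤ n → n ≤ N →
      ‖∑ b ∈ Finset.Ioc 0 n, g b‖ ≤ C * Z ^ δ * (n : ℝ) ^ (1 - δ))
    (hf : ∀ n : ℕ, 1 ≤ n → n ≤ N → V ≤ 2 * n → ‖∑ b ∈ Finset.Ioc 0 n, f b‖ ≤ B * n) :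
    ‖∑ n ∈ Finset.Ioc 0 N, (f * g) n‖ ≤
      C * (Z * V / N) ^ δ * N * L ^ D + 2 * B * N * L := by
  have hN0 : (0 : ℝ) < N := by linarith
  have hN1 : 1 ≤ N := by exact_mod_cast hN0
  have hL1 : 1 ≤ L := by
    have := Real.log_natCast_nonneg N
    linarith
  set U := ⌊V⌋₊ with hUdef
  have hU1 : 1 ≤ U := Nat.le_floor (by simpa using hV)
  have hUV : (U : ℝ) ≤ V := Nat.floor_le (by linarith)
  have hVU : V < U + 1 := Nat.lt_floor_add_one V
  have hUN : U ≤ N := by exact_mod_cast hUV.trans hVN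
  rw [sum_Ioc_mul_eq_hyperbola f g hUN]
  refine (norm_add_le _ _).trans (add_le_add ?_ ?_)
  · calc _ ≤ ∑ a ∈ Finset.Ioc 0 U, ‖f a‖ * (C * Z ^ δ * ((V / N) ^ δ * (N / a))) := by
          refine (norm_sum_le _ _).trans (Finset.sum_le_sum fun a ha => ?_)
          rw [Finset.mem_Ioc] at ha
          have ha0 : (0 : ℝ) < a := by exact_mod_cast ha.1
          rw [norm_mul]
          refine mul_le_mul_of_nonneg_left ?_ (norm_nonneg _)
          have h1 : 1 ≤ N / a := (Nat.one_le_div_iff ha.1).2 (ha.2.trans hUN)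
          refine (hg (N / a) h1 (Nat.div_le_self _ _)).trans ?_
          refine mul_le_mul_of_nonneg_left ?_ (by positivity)
          calc ((N / a : ℕ) : ℝ) ^ (1 - δ) ≤ ((N : ℝ) / a) ^ (1 - δ) :=
                Real.rpow_le_rpow (by positivity) Nat.cast_div_le (by linarith)
            _ = ((a : ℝ) / N) ^ δ * (N / a) := by
                rw [sub_eq_add_neg, Real.rpow_add (by positivity), Real.rpow_one,
                  Real.rpow_neg (by positivity), ← Real.inv_rpow (by positivity), inv_div, mul_comm]
            _ ≤ (V / N) ^ δ * (N / a) := by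
                gcongr
                exact le_trans (by exact_mod_cast ha.2) hUV
      _ = C * (Z * V / N) ^ δ * N * ∑ a ∈ Finset.Ioc 0 U, ‖f a‖ / a := by
          rw [Finset.mul_sum]
          refine Finset.sum_congr rfl fun a _ => ?_
          rw [mul_div_assoc Z V, Real.mul_rpow hZ.le (by positivity)]
          ring
      _ ≤ C * (Z * V / N) ^ δ * N * L ^ D := by
          have : 0 ≤ Z * V / N := by positivity
          gcongr
          refine le_trans (Finset.sum_le_sum_of_subset_of_nonneg
            (Finset.Ioc_subset_Ioc_right hUN) fun _ _ _ => by positivity) hf1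
  · have hFU : ‖∑ a ∈ Finset.Ioc 0 U, f a‖ ≤ B * U := hf U hU1 hUN (by
      have : (1 : ℝ) ≤ U := by exact_mod_cast hU1
      linarith)
    calc _ ≤ ∑ b ∈ Finset.Ioc 0 (N / (U + 1)), 2 * B * N * (1 / b : ℝ) := by
          refine (norm_sum_le _ _).trans (Finset.sum_le_sum fun b hb => ?_)
          rw [Finset.mem_Ioc] at hb
          have hb0 : (0 : ℝ) < b := by exact_mod_cast hb.1
          have h1 : U + 1 ≤ N / b := by
            rw [Nat.le_div_iff_mul_le hb.1, mul_comm]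
            exact (Nat.le_div_iff_mul_le (by omega)).1 hb.2
          have h2 : ((N / b : ℕ) : ℝ) ≤ N / b := Nat.cast_div_le
          have h3 : (U : ℝ) + 1 ≤ (N / b : ℕ) := by exact_mod_cast h1
          have h4 := hf (N / b) (by omega) (Nat.div_le_self _ _) (by linarith)
          rw [norm_mul]
          calc _ ≤ 1 * (‖∑ a ∈ Finset.Ioc 0 (N / b), f a‖ + ‖∑ a ∈ Finset.Ioc 0 U, f a‖) :=
                mul_le_mul (hg1 b) (norm_sub_le _ _) (norm_nonneg _) zero_le_one
            _ ≤ B * (N / b) + B * (N / b) := by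
                rw [one_mul]
                refine add_le_add (h4.trans ?_) (hFU.trans ?_)
                · gcongr
                · gcongr
                  linarith
            _ = _ := by ring
      _ = 2 * B * N * ∑ b ∈ Finset.Ioc 0 (N / (U + 1)), (1 / b : ℝ) := by rw [Finset.mul_sum]
      _ ≤ 2 * B * N * L := by
          gcongr
          refine le_trans (Finset.sum_le_sum_of_subset_of_nonneg
            (Finset.Ioc_subset_Ioc_right (Nat.div_le_self _ _)) fun _ _ _ => by positivity) ?_
          exact (sum_inv_le_one_add_log N).trans hL

/-- Partial sums of a Dirichlet convolution of bounded functions, each of which has partial sums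
with a power saving. -/
theorem norm_sum_prod_le {ι : Type*} (s : Finset ι) (g : ι → ArithmeticFunction ℂ)
    {C Z δ : ℝ} {X : ℕ} (hC : 1 ≤ C) (hZ : 1 ≤ Z) (hδ0 : 0 < δ) (hδ1 : δ ≤ 1)
    (hg1 : ∀ i ∈ s, ∀ n, ‖g i n‖ ≤ 1)
    (hg : ∀ i ∈ s, ∀ n : ℕ, 1 ≤ n → n ≤ X →
      ‖∑ b ∈ Finset.Ioc 0 n, g i b‖ ≤ C * Z ^ δ * (n : ℝ) ^ (1 - δ)) (N : ℕ) (hN1 : 1 ≤ N)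
    (hNX : N ≤ X) :
    ‖∑ n ∈ Finset.Ioc 0 N, (∏ i ∈ s, g i) n‖ ≤
      C * 8 ^ s.card * N * (Z ^ s.card / N) ^ (δ / (s.card + 1)) * (1 + Real.log N) ^ s.card := by
  classical
  induction s using Finset.induction_on generalizing N with
  | empty =>
    have h0 : (1 : ℝ) ≤ N := by exact_mod_cast hN1
    have h1 : ∑ n ∈ Finset.Ioc 0 N, (1 : ArithmeticFunction ℂ) n = 1 := by
      simp_rw [ArithmeticFunction.one_apply, Finset.sum_ite_eq']
      rw [if_pos (by simpa using hN1)]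
    simp only [Finset.prod_empty, Finset.card_empty, pow_zero, h1, norm_one, mul_one,
      Nat.cast_zero, zero_add, div_one]
    have h2 : (N : ℝ) * (1 / N) ^ δ = (N : ℝ) ^ (1 - δ) := by
      rw [Real.rpow_sub (by positivity), Real.rpow_one, one_div, Real.inv_rpow (by positivity)]
      rfl
    rw [mul_assoc, h2]
    exact one_le_mul_of_one_le_of_one_le hC (Real.one_le_rpow h0 (by linarith))
  | insert i s hi ih =>
    rw [Finset.prod_insert hi, Finset.card_insert_of_notMem hi, mul_comm (g i)]
    have hs1 : ∀ j ∈ s, ∀ n, ‖g j n‖ ≤ 1 := fun j hj => hg1 j (Finset.mem_insert_of_mem hj)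
    have ih' := ih hs1 fun j hj => hg j (Finset.mem_insert_of_mem hj)
    have hN : (1 : ℝ) ≤ N := by exact_mod_cast hN1
    have hlog := Real.log_natCast_nonneg N
    set k := s.card with hk
    set L := 1 + Real.log N with hL
    have hL1 : 1 ≤ L := by linarith
    have hZk : 1 ≤ Z ^ k := one_le_pow₀ hZ
    have hZk1 : 1 ≤ Z ^ (k + 1) := one_le_pow₀ hZ
    have hZ0 : 0 < Z := by linarith
    push_cast
    rcases lt_or_ge (N : ℝ) (Z ^ (k + 1)) with hcase | hcase
    · have h1 := norm_sum_le_mul_sum_div (fun n => (∏ j ∈ insert i s, g j) n) N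
      have h2 := sum_norm_prod_div_le (insert i s) g hg1 N
      rw [Finset.card_insert_of_notMem hi, ← hk, ← hL] at h2
      rw [Finset.prod_insert hi, mul_comm (g i)] at h1 h2
      refine h1.trans ((mul_le_mul_of_nonneg_left h2 (by linarith)).trans ?_)
      have h3 : 1 ≤ (Z ^ (k + 1) / N) ^ (δ / (k + 1 + 1)) :=
        Real.one_le_rpow ((one_le_div (by linarith)).2 hcase.le) (by positivity)
      have h4 : (1 : ℝ) ≤ C * 8 ^ (k + 1) := one_le_mul_of_one_le_of_one_le hC
        (one_le_pow₀ (by norm_num))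
      have h5 : (1 : ℝ) ≤ C * 8 ^ (k + 1) * (Z ^ (k + 1) / N) ^ (δ / (k + 1 + 1)) :=
        one_le_mul_of_one_le_of_one_le h4 h3
      calc (N : ℝ) * L ^ (k + 1) = 1 * (N * L ^ (k + 1)) := (one_mul _).symm
        _ ≤ C * 8 ^ (k + 1) * (Z ^ (k + 1) / N) ^ (δ / (k + 1 + 1)) * (N * L ^ (k + 1)) :=
          mul_le_mul_of_nonneg_right h5 (by positivity)
        _ = _ := by ring
    · set ρ : ℝ := N / Z ^ (k + 1) with hρ
      have hρ1 : 1 ≤ ρ := (one_le_div (by linarith)).2 hcase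
      have hρ0 : 0 < ρ := by linarith
      set V : ℝ := Z ^ k * ρ ^ ((k + 1 : ℝ) / (k + 2)) with hVdef
      have hk2 : (0 : ℝ) < k + 2 := by positivity
      have hk1 : (0 : ℝ) < k + 1 := by positivity
      have hV1 : 1 ≤ V := one_le_mul_of_one_le_of_one_le hZk
        (Real.one_le_rpow hρ1 (by positivity))
      have hVN : V ≤ N := by
        have h1 : ρ ^ ((k + 1 : ℝ) / (k + 2)) ≤ ρ := by
          conv_rhs => rw [← Real.rpow_one ρ]
          exact Real.rpow_le_rpow_of_exponent_le hρ1 ((div_le_one hk2).2 (by linarith))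
        have h2 : Z ^ (k + 1) * ρ = N := by
          rw [hρ]
          field_simp
        have h3 : Z ^ k ≤ Z ^ (k + 1) := pow_le_pow_right₀ hZ (by omega)
        rw [← h2]
        exact mul_le_mul h3 h1 (by positivity) (by positivity)
      set T : ℝ := (Z ^ (k + 1) / N) ^ (δ / (k + 1 + 1)) with hT
      have hT0 : 0 < T := by positivity
      have hTρ : T = ρ ^ (-(δ / (k + 2))) := by
        rw [hT, ← inv_div, ← hρ, Real.inv_rpow hρ0.le, Real.rpow_neg hρ0.le]
        congr 3
        ring
      have hZV : (Z * V / N) ^ δ = T := by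
        have h1 : Z * V / N = ρ ^ (-(1 / (k + 2 : ℝ))) := by
          have : Z * V / N = ρ ^ ((k + 1 : ℝ) / (k + 2)) / ρ := by
            rw [hVdef]
            have : (N : ℝ) = Z ^ (k + 1) * ρ := by
              rw [hρ]
              field_simp
            rw [this, pow_succ]
            field_simp
          rw [this]
          conv_lhs => rw [← Real.rpow_one ρ, ← Real.rpow_mul hρ0.le, one_mul]
          rw [← Real.rpow_sub hρ0]
          congr 1
          field_simp
          ring
        rw [h1, hTρ, ← Real.rpow_mul hρ0.le]
        congr 1
        ring
      have hZV2 : (Z ^ k / V) ^ (δ / (k + 1)) = T := by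
        have h1 : Z ^ k / V = ρ ^ (-((k + 1 : ℝ) / (k + 2))) := by
          rw [hVdef, Real.rpow_neg hρ0.le]
          field_simp
        rw [h1, hTρ, ← Real.rpow_mul hρ0.le]
        congr 1
        field_simp
      have hδk : δ / (k + 1) ≤ 1 := (div_le_one hk1).2 (by linarith [k.cast_nonneg (α := ℝ)])
      have hf : ∀ n : ℕ, 1 ≤ n → n ≤ N → V ≤ 2 * n →
          ‖∑ b ∈ Finset.Ioc 0 n, (∏ j ∈ s, g j) b‖ ≤ 2 * (C * 8 ^ k * T * L ^ k) * n := by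
        intro n hn1 hnN hVn
        have hn0 : (0 : ℝ) < n := by exact_mod_cast hn1
        have h1 : (Z ^ k / n) ^ (δ / (k + 1)) ≤ 2 * T := by
          calc _ ≤ (2 * (Z ^ k / V)) ^ (δ / (k + 1)) := by
                refine Real.rpow_le_rpow (by positivity) ?_ (by positivity)
                rw [div_le_iff₀ hn0, ← mul_div_assoc, div_mul_eq_mul_div, le_div_iff₀ (by linarith)]
                nlinarith
            _ = 2 ^ (δ / (k + 1)) * T := by
                rw [Real.mul_rpow (by norm_num) (by positivity), hZV2]
            _ ≤ 2 * T := by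
                gcongr
                conv_rhs => rw [← Real.rpow_one 2]
                exact Real.rpow_le_rpow_of_exponent_le (by norm_num) hδk
        have h2 : 1 + Real.log n ≤ L := by
          rw [hL]
          gcongr
        have h3 := Real.log_natCast_nonneg n
        calc _ ≤ _ := ih' n hn1 (hnN.trans hNX)
          _ ≤ C * 8 ^ k * n * (2 * T) * L ^ k := by gcongr
          _ = _ := by ring
      have key := norm_sum_mul_le (f := ∏ j ∈ s, g j) (g := g i) (C := C) (Z := Z) (δ := δ)
        (B := 2 * (C * 8 ^ k * T * L ^ k)) (V := V) (L := L) (D := k) (N := N) hV1 hVN hZ0 hδ0 hδ1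
        le_rfl (by positivity) (by linarith) (hg1 i (Finset.mem_insert_self _ _))
        (sum_norm_prod_div_le s g hs1 N)
        (fun n h1 h2 => hg i (Finset.mem_insert_self _ _) n h1 (h2.trans hNX)) hf
      refine key.trans ?_
      rw [hZV]
      have h8 : (1 : ℝ) ≤ 8 ^ k := one_le_pow₀ (by norm_num)
      have hLk : L ^ k ≤ L ^ (k + 1) := pow_le_pow_right₀ hL1 (by omega)
      have hX : 0 ≤ C * T * N := by positivity
      have h9 : L ^ k ≤ 8 ^ k * L ^ (k + 1) := by
        nlinarith [pow_pos (by linarith : 0 < L) (k + 1)]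
      calc _ = C * T * N * (L ^ k) + 4 * (C * T * N) * (8 ^ k * L ^ (k + 1)) := by ring
        _ ≤ C * T * N * (8 ^ k * L ^ (k + 1)) + 4 * (C * T * N) * (8 ^ k * L ^ (k + 1)) := by
          gcongr
        _ ≤ 8 * (C * T * N) * (8 ^ k * L ^ (k + 1)) := by
          have : 0 ≤ C * T * N * (8 ^ k * L ^ (k + 1)) := by positivity
          linarith
        _ = _ := by ring

open ArithmeticFunction in
theorem pmul_mul_pmul_of_map_mul {R : Type*} [CommRing R] {f : ArithmeticFunction R}
    (hf : ∀ a b, f (a * b) = f a * f b) (g h : ArithmeticFunction R) :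
    pmul f g * pmul f h = pmul f (g * h) := by
  ext n
  simp only [mul_apply, pmul_apply, Finset.mul_sum]
  refine Finset.sum_congr rfl fun x hx => ?_
  rw [← (Nat.mem_divisorsAntidiagonal.1 hx).1, hf]
  ring

open ArithmeticFunction in
theorem pmul_one_of_map_one {R : Type*} [CommRing R] {f : ArithmeticFunction R}
    (hf : f 1 = 1) : pmul f 1 = 1 := by
  ext n
  rw [pmul_apply, one_apply]
  split_ifs with h
  · rw [h, hf, mul_one]
  · rw [mul_zero]

open ArithmeticFunction in
theorem pmul_prod_of_map_mul {R ι : Type*} [CommRing R] {f : ArithmeticFunction R}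
    (hf : ∀ a b, f (a * b) = f a * f b) (hf1 : f 1 = 1) (s : Finset ι)
    (g : ι → ArithmeticFunction R) :
    ∏ i ∈ s, pmul f (g i) = pmul f (∏ i ∈ s, g i) := by
  classical
  induction s using Finset.induction_on with
  | empty => simp [pmul_one_of_map_one hf1]
  | insert i s hi ih =>
    rw [Finset.prod_insert hi, Finset.prod_insert hi, ih, pmul_mul_pmul_of_map_mul hf]

theorem mul_apply_prime {R : Type*} [CommRing R] (f g : ArithmeticFunction R) {p : ℕ}
    (hp : p.Prime) : (f * g) p = f 1 * g p + f p * g 1 := by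
  rw [ArithmeticFunction.mul_apply,
    Nat.sum_divisorsAntidiagonal (fun x y => f x * g y), hp.divisors,
    Finset.sum_insert (by simpa using hp.one_lt.ne), Finset.sum_singleton, Nat.div_one,
    Nat.div_self hp.pos]

theorem prod_apply_prime {R ι : Type*} [CommRing R] (s : Finset ι) (g : ι → ArithmeticFunction R)
    (hg : ∀ i ∈ s, g i 1 = 1) {p : ℕ} (hp : p.Prime) :
    (∏ i ∈ s, g i) 1 = 1 ∧ (∏ i ∈ s, g i) p = ∑ i ∈ s, g i p := by
  classical
  induction s using Finset.induction_on with
  | empty => simp [hp.one_lt.ne']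
  | insert i s hi ih =>
    obtain ⟨h1, h2⟩ := ih fun j hj => hg j (Finset.mem_insert_of_mem hj)
    have h3 := hg i (Finset.mem_insert_self _ _)
    rw [Finset.prod_insert hi, Finset.sum_insert hi, mul_apply_prime _ _ hp,
      ArithmeticFunction.mul_apply_one, h1, h2, h3]
    simp [add_comm]

theorem norm_mul_apply_prime_pow_le {f g : ArithmeticFunction ℂ} {p A B : ℕ} (hp : p.Prime)
    (hf : ∀ k : ℕ, ‖f (p ^ k)‖ ≤ (k + 1 : ℝ) ^ A) (hg : ∀ k : ℕ, ‖g (p ^ k)‖ ≤ (k + 1 : ℝ) ^ B)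
    (k : ℕ) : ‖(f * g) (p ^ k)‖ ≤ (k + 1 : ℝ) ^ (A + B + 1) := by
  rw [ArithmeticFunction.mul_apply, Nat.sum_divisorsAntidiagonal (fun x y => f x * g y),
    Nat.sum_divisors_prime_pow hp]
  refine (norm_sum_le _ _).trans ?_
  calc _ ≤ ∑ x ∈ Finset.range (k + 1), (k + 1 : ℝ) ^ (A + B) := by
        refine Finset.sum_le_sum fun x hx => ?_
        have h := Finset.mem_range.1 hx
        rw [Nat.pow_div (by omega) hp.pos, norm_mul, pow_add]
        have h1 : (x : ℝ) ≤ k := by exact_mod_cast (by omega : x ≤ k)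
        have h2 : ((k - x : ℕ) : ℝ) ≤ k := by exact_mod_cast (by omega : k - x ≤ k)
        refine mul_le_mul ((hf _).trans ?_) ((hg _).trans ?_) (norm_nonneg _) (by positivity)
        · gcongr
        · gcongr
    _ = _ := by
        rw [Finset.sum_const, Finset.card_range, nsmul_eq_mul, pow_succ]
        push_cast
        ring

theorem norm_prod_apply_prime_pow_le {ι : Type*} (s : Finset ι) (g : ι → ArithmeticFunction ℂ)
    {p : ℕ} (hp : p.Prime) (hg : ∀ i ∈ s, ∀ n, ‖g i n‖ ≤ 1) (k : ℕ) :
    ‖(∏ i ∈ s, g i) (p ^ k)‖ ≤ (k + 1 : ℝ) ^ s.card := by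
  classical
  induction s using Finset.induction_on generalizing k with
  | empty =>
    simp only [Finset.prod_empty, Finset.card_empty, pow_zero, ArithmeticFunction.one_apply]
    split_ifs <;> simp
  | insert i s hi ih =>
    rw [Finset.prod_insert hi, Finset.card_insert_of_notMem hi]
    have := norm_mul_apply_prime_pow_le (f := g i) (g := ∏ j ∈ s, g j) (A := 0) (B := s.card) hp
      (fun k => by simpa using hg i (Finset.mem_insert_self _ _) _)
      (fun k => ih (fun j hj => hg j (Finset.mem_insert_of_mem hj)) k) k
    simpa using this

/-- A multiplicative function vanishing at the primes and of polynomial growth along prime powers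
has an absolutely convergent Dirichlet series at `3/4`. -/
theorem exists_sum_norm_mul_rpow_le {t : ArithmeticFunction ℂ} (ht : t.IsMultiplicative) (D : ℕ)
    (ht0 : ∀ p : ℕ, p.Prime → t p = 0)
    (htD : ∀ p : ℕ, p.Prime → ∀ k : ℕ, ‖t (p ^ k)‖ ≤ (k + 1 : ℝ) ^ D) :
    ∃ T : ℝ, 0 ≤ T ∧ ∀ N : ℕ, ∑ n ∈ Finset.Ioc 0 N, ‖t n‖ * (n : ℝ) ^ (-(3 / 4) : ℝ) ≤ T := by
  set f : ℕ → ℝ := fun n => ‖t n‖ * (n : ℝ) ^ (-(3 / 4) : ℝ) with hf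
  have hf0 : ∀ n, 0 ≤ f n := fun n => by positivity
  have hf1 : f 1 = 1 := by simp [hf, ht.map_one]
  have hmul : ∀ {a b : ℕ}, Nat.Coprime a b → f (a * b) = f a * f b := by
    intro a b hab
    simp only [hf]
    rw [ht.map_mul_of_coprime hab, norm_mul, Nat.cast_mul,
      Real.mul_rpow (Nat.cast_nonneg _) (Nat.cast_nonneg _)]
    ring
  set r : ℝ := (2 : ℝ) ^ (-(3 / 4) : ℝ) with hr
  have hr0 : 0 < r := by positivity
  have hr1 : r < 1 := Real.rpow_lt_one_of_one_lt_of_neg (by norm_num) (by norm_num)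
  have hsumm : Summable fun k : ℕ => ((k + 3 : ℕ) : ℝ) ^ D * r ^ (k + 3) :=
    (summable_nat_add_iff (f := fun k : ℕ => (k : ℝ) ^ D * r ^ k) 3).2
      (summable_pow_mul_geometric_of_norm_lt_one D (by rwa [Real.norm_of_nonneg hr0.le]))
  set K : ℝ := (∑' k : ℕ, ((k + 3 : ℕ) : ℝ) ^ D * r ^ (k + 3)) / r ^ 3 with hK
  have hK0 : 0 ≤ K := by
    rw [hK]
    exact div_nonneg (tsum_nonneg fun k => by positivity) (by positivity)
  have hbound : ∀ p : ℕ, p.Prime → ∀ k : ℕ, f (p ^ (k + 2)) ≤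
      (p : ℝ) ^ (-(3 / 2) : ℝ) * (((k + 3 : ℕ) : ℝ) ^ D * r ^ (k + 3) / r ^ 3) := by
    intro p hp k
    have hp0 : (0 : ℝ) < p := by exact_mod_cast hp.pos
    have hp2 : (2 : ℝ) ≤ p := by exact_mod_cast hp.two_le
    have h1 : ((p ^ (k + 2) : ℕ) : ℝ) ^ (-(3 / 4) : ℝ) ≤ (p : ℝ) ^ (-(3 / 2) : ℝ) * r ^ k := by
      push_cast
      rw [← Real.rpow_natCast, ← Real.rpow_mul hp0.le]
      push_cast
      rw [show ((k : ℝ) + 2) * (-(3 / 4)) = -(3 / 2) + -(3 / 4) * k by ring,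
        Real.rpow_add hp0, Real.rpow_mul hp0.le, Real.rpow_natCast]
      gcongr
      exact Real.rpow_le_rpow_of_nonpos (by norm_num) hp2 (by norm_num)
    calc f (p ^ (k + 2)) ≤ ((k + 2 : ℕ) + 1 : ℝ) ^ D * ((p : ℝ) ^ (-(3 / 2) : ℝ) * r ^ k) :=
          mul_le_mul (htD p hp _) h1 (by positivity) (by positivity)
      _ = _ := by
          rw [pow_add r k 3, mul_div_assoc, mul_div_assoc, div_self (by positivity)]
          push_cast
          ring
  have hsum : ∀ {p : ℕ}, p.Prime → Summable fun n : ℕ => ‖f (p ^ n)‖ := by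
    intro p hp
    rw [← summable_nat_add_iff 2]
    refine Summable.of_nonneg_of_le (fun _ => norm_nonneg _) (fun k => ?_)
      ((hsumm.div_const (r ^ 3)).mul_left ((p : ℝ) ^ (-(3 / 2) : ℝ)))
    rw [Real.norm_of_nonneg (hf0 _)]
    exact hbound p hp k
  have hlocal : ∀ p : ℕ, p.Prime → ∑' n : ℕ, f (p ^ n) ≤ 1 + K * (p : ℝ) ^ (-(3 / 2) : ℝ) := by
    intro p hp
    have hs : Summable fun n : ℕ => f (p ^ n) := (hsum hp).of_norm
    rw [← hs.sum_add_tsum_nat_add 2, Finset.sum_range_succ, Finset.sum_range_one, pow_zero, pow_one,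
      hf1]
    have h0 : f p = 0 := by simp [hf, ht0 p hp]
    rw [h0, add_zero]
    gcongr
    rw [hK, ← tsum_div_const, mul_comm, ← tsum_mul_left]
    exact Summable.tsum_le_tsum (hbound p hp) ((summable_nat_add_iff 2).2 hs)
      ((hsumm.div_const (r ^ 3)).mul_left _)
  have hS : Summable fun n : ℕ => (n : ℝ) ^ (-(3 / 2) : ℝ) :=
    Real.summable_nat_rpow.2 (by norm_num)
  refine ⟨Real.exp (K * ∑' n : ℕ, (n : ℝ) ^ (-(3 / 2) : ℝ)), (Real.exp_pos _).le, fun N => ?_⟩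
  obtain ⟨hA, hB⟩ := EulerProduct.summable_and_hasSum_factoredNumbers_prod_filter_prime_tsum
    hf1 hmul hsum (Finset.range (N + 1))
  calc ∑ n ∈ Finset.Ioc 0 N, f n
      ≤ ∑' n : Nat.factoredNumbers (Finset.range (N + 1)), f n := by
        have hmem : ∀ n ∈ Finset.Ioc 0 N, n ∈ Nat.factoredNumbers (Finset.range (N + 1)) := by
          intro n hn
          rw [Finset.mem_Ioc] at hn
          rw [Nat.mem_factoredNumbers]
          refine ⟨by omega, fun p hp => ?_⟩
          have := Nat.le_of_mem_primeFactorsList hp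
          simp only [Finset.mem_range]
          omega
        rw [← Finset.sum_attach]
        have := hB.summable.sum_le_tsum
          ((Finset.Ioc 0 N).attach.map ⟨fun n => (⟨n.1, hmem n.1 n.2⟩ :
            Nat.factoredNumbers (Finset.range (N + 1))),
            fun a b h => Subtype.ext (congrArg (fun x => x.1) h)⟩) (fun n _ => hf0 n)
        rwa [Finset.sum_map] at this
    _ = ∏ p ∈ Finset.range (N + 1) with p.Prime, ∑' n : ℕ, f (p ^ n) := hB.tsum_eq
    _ ≤ ∏ p ∈ Finset.range (N + 1) with p.Prime, Real.exp (K * (p : ℝ) ^ (-(3 / 2) : ℝ)) := by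
        refine Finset.prod_le_prod (fun p _ => tsum_nonneg fun _ => hf0 _) fun p hp => ?_
        refine (hlocal p (Finset.mem_filter.1 hp).2).trans ?_
        rw [add_comm]
        exact Real.add_one_le_exp _
    _ = Real.exp (K * ∑ p ∈ Finset.range (N + 1) with p.Prime, (p : ℝ) ^ (-(3 / 2) : ℝ)) := by
        rw [← Real.exp_sum, Finset.mul_sum]
    _ ≤ _ := by
        gcongr
        exact hS.sum_le_tsum _ fun _ _ => by positivity

/-- Multiplying by an absolutely summable factor preserves a power saving. -/
theorem norm_sum_mul_le_of_summable {t g : ArithmeticFunction ℂ} {T A δ : ℝ} {X : ℕ}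
    (hδ : δ ≤ 1 / 4) (hA : 0 ≤ A)
    (ht : ∀ N : ℕ, ∑ n ∈ Finset.Ioc 0 N, ‖t n‖ * (n : ℝ) ^ (-(3 / 4) : ℝ) ≤ T)
    (hg : ∀ n : ℕ, 1 ≤ n → n ≤ X → ‖∑ b ∈ Finset.Ioc 0 n, g b‖ ≤ A * (n : ℝ) ^ (1 - δ))
    {N : ℕ} (hNX : N ≤ X) :
    ‖∑ n ∈ Finset.Ioc 0 N, (t * g) n‖ ≤ A * T * (N : ℝ) ^ (1 - δ) := by
  rw [ArithmeticFunction.sum_Ioc_mul_eq_sum_sum]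
  refine (norm_sum_le _ _).trans ?_
  calc _ ≤ ∑ a ∈ Finset.Ioc 0 N, A * (N : ℝ) ^ (1 - δ) * (‖t a‖ * (a : ℝ) ^ (-(3 / 4) : ℝ)) := by
        refine Finset.sum_le_sum fun a ha => ?_
        rw [Finset.mem_Ioc] at ha
        have ha1 : (1 : ℝ) ≤ a := by exact_mod_cast ha.1
        have h1 : 1 ≤ N / a := (Nat.one_le_div_iff ha.1).2 ha.2
        have h2 := hg _ h1 ((Nat.div_le_self _ _).trans hNX)
        have h3 : ((N / a : ℕ) : ℝ) ^ (1 - δ) ≤ (N : ℝ) ^ (1 - δ) * (a : ℝ) ^ (-(3 / 4) : ℝ) := by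
          calc _ ≤ ((N : ℝ) / a) ^ (1 - δ) :=
                Real.rpow_le_rpow (by positivity) Nat.cast_div_le (by linarith)
            _ = (N : ℝ) ^ (1 - δ) * (a : ℝ) ^ (-(1 - δ)) := by
                rw [Real.div_rpow (by positivity) (by positivity), Real.rpow_neg (by positivity)]
                rfl
            _ ≤ _ := by
                gcongr
                linarith
        rw [norm_mul]
        calc _ ≤ ‖t a‖ * (A * ((N : ℝ) ^ (1 - δ) * (a : ℝ) ^ (-(3 / 4) : ℝ))) := by
              gcongr
              exact h2.trans (by gcongr)
          _ = _ := by ring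
    _ = A * (N : ℝ) ^ (1 - δ) *
        ∑ a ∈ Finset.Ioc 0 N, ‖t a‖ * (a : ℝ) ^ (-(3 / 4) : ℝ) := by rw [Finset.mul_sum]
    _ ≤ A * (N : ℝ) ^ (1 - δ) * T := by
        gcongr
        exact ht N
    _ = _ := by ring

open Classical in
/-- The indicator function of the positive integers coprime to `W` all of whose prime factors are
congruent to `1` modulo `m`. -/
noncomputable def goodInd (R : Type*) [CommRing R] (m W : ℕ) : ArithmeticFunction R :=
  ⟨fun n => if n ≠ 0 ∧ n.Coprime W ∧ ∀ p : ℕ, p.Prime → p ∣ n → p ≡ 1 [MOD m] then 1 else 0,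
    by simp⟩

open Classical in
theorem goodInd_apply (R : Type*) [CommRing R] (m W n : ℕ) : goodInd R m W n =
    if n ≠ 0 ∧ n.Coprime W ∧ ∀ p : ℕ, p.Prime → p ∣ n → p ≡ 1 [MOD m] then 1 else 0 := rfl

theorem goodInd_map_mul (R : Type*) [CommRing R] (m W a b : ℕ) :
    goodInd R m W (a * b) = goodInd R m W a * goodInd R m W b := by
  classical
  simp only [goodInd_apply, ite_zero_mul_ite_zero, mul_one]
  refine if_congr ?_ rfl rfl
  rw [mul_ne_zero_iff, Nat.coprime_mul_iff_left]
  constructor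
  · rintro ⟨⟨h1, h2⟩, ⟨h3, h4⟩, h5⟩
    exact ⟨⟨h1, h3, fun p hp hd => h5 p hp (hd.mul_right _)⟩,
      h2, h4, fun p hp hd => h5 p hp (hd.mul_left _)⟩
  · rintro ⟨⟨h1, h3, h5⟩, h2, h4, h6⟩
    exact ⟨⟨h1, h2⟩, ⟨h3, h4⟩, fun p hp hd => (hp.dvd_mul.1 hd).elim (h5 p hp) (h6 p hp)⟩

theorem goodInd_one (R : Type*) [CommRing R] (m W : ℕ) : goodInd R m W 1 = 1 := by
  rw [goodInd_apply, if_pos]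
  refine ⟨one_ne_zero, Nat.coprime_one_left _, fun p hp h => ?_⟩
  exact absurd (Nat.dvd_one.1 h) hp.one_lt.ne'

theorem isMultiplicative_of_map_mul {R : Type*} [CommRing R] {f : ArithmeticFunction R}
    (hf : ∀ a b, f (a * b) = f a * f b) (hf1 : f 1 = 1) : f.IsMultiplicative :=
  ⟨hf1, fun _ => hf _ _⟩

theorem goodInd_prime (R : Type*) [CommRing R] (m : ℕ) {W p : ℕ} (hp : p.Prime) :
    goodInd R m W p = if p.Coprime W ∧ p ≡ 1 [MOD m] then 1 else 0 := by
  classical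
  rw [goodInd_apply]
  refine if_congr ?_ rfl rfl
  constructor
  · rintro ⟨-, h, h'⟩
    exact ⟨h, h' p hp dvd_rfl⟩
  · rintro ⟨h, h'⟩
    exact ⟨hp.ne_zero, h, fun q hq hd => by rwa [(Nat.prime_dvd_prime_iff_eq hq hp).1 hd]⟩

/-- A Dirichlet character restricted to the integers coprime to `W`. -/
noncomputable def copChar {m : ℕ} (W : ℕ) (χ : DirichletCharacter ℂ m) : ArithmeticFunction ℂ :=
  ⟨fun n => if n ≠ 0 ∧ n.Coprime W then χ (n : ZMod m) else 0, by simp⟩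

theorem copChar_apply {m : ℕ} (W : ℕ) (χ : DirichletCharacter ℂ m) (n : ℕ) :
    copChar W χ n = if n ≠ 0 ∧ n.Coprime W then χ (n : ZMod m) else 0 := rfl

theorem copChar_map_mul {m : ℕ} (W : ℕ) (χ : DirichletCharacter ℂ m) (a b : ℕ) :
    copChar W χ (a * b) = copChar W χ a * copChar W χ b := by
  simp only [copChar_apply, ite_zero_mul_ite_zero, Nat.cast_mul, map_mul]
  refine if_congr ?_ rfl rfl
  rw [mul_ne_zero_iff, Nat.coprime_mul_iff_left]
  tauto

theorem copChar_one {m : ℕ} (W : ℕ) (χ : DirichletCharacter ℂ m) : copChar W χ 1 = 1 := by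
  simp [copChar_apply]

theorem norm_copChar_le_one {m : ℕ} (W : ℕ) (χ : DirichletCharacter ℂ m) (n : ℕ) :
    ‖copChar W χ n‖ ≤ 1 := by
  rw [copChar_apply]
  split_ifs
  · exact χ.norm_le_one _
  · simp

theorem norm_goodInd_le_one (m W n : ℕ) : ‖goodInd ℂ m W n‖ ≤ 1 := by
  rw [goodInd_apply]
  split_ifs <;> simp

theorem goodInd_mem (m W n : ℕ) : goodInd ℝ m W n = 0 ∨ goodInd ℝ m W n = 1 := by
  rw [goodInd_apply]
  split_ifs <;> simp

theorem ofReal_goodInd_pow (m W k n : ℕ) :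
    (((goodInd ℝ m W ^ k) n : ℝ) : ℂ) = (goodInd ℂ m W ^ k) n := by
  induction k generalizing n with
  | zero =>
    simp only [pow_zero, ArithmeticFunction.one_apply]
    split_ifs <;> simp
  | succ k ih =>
    simp only [pow_succ, ArithmeticFunction.mul_apply, Complex.ofReal_sum, Complex.ofReal_mul, ih]
    refine Finset.sum_congr rfl fun x _ => ?_
    congr 1
    rw [goodInd_apply, goodInd_apply]
    split_ifs <;> simp

open ArithmeticFunction in
theorem pmul_moebius_mul_self {f : ArithmeticFunction ℂ}
    (hf : ∀ a b, f (a * b) = f a * f b) (hf1 : f 1 = 1) :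
    pmul f (moebius : ArithmeticFunction ℂ) * f = 1 := by
  have h : f = pmul f (zeta : ArithmeticFunction ℂ) := (pmul_zeta f).symm
  conv_lhs => rw [h, ← h]
  nth_rewrite 2 [h]
  rw [pmul_mul_pmul_of_map_mul hf, coe_moebius_mul_coe_zeta, pmul_one_of_map_one hf1]

open ArithmeticFunction in
/-- The `φ(m)`-th power of the indicator of the integers composed of primes `1` modulo `m` is the
product of all Dirichlet characters modulo `m`, up to an absolutely convergent factor. -/
theorem exists_goodInd_pow_eq (m W : ℕ) [NeZero m] :
    ∃ (t : ArithmeticFunction ℂ) (T : ℝ), 0 ≤ T ∧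
      (∀ N : ℕ, ∑ n ∈ Finset.Ioc 0 N, ‖t n‖ * (n : ℝ) ^ (-(3 / 4) : ℝ) ≤ T) ∧
      goodInd ℂ m W ^ m.totient = t * ∏ χ : DirichletCharacter ℂ m, copChar W χ := by
  set g : DirichletCharacter ℂ m → ArithmeticFunction ℂ := fun χ =>
    pmul (copChar W χ) (moebius : ArithmeticFunction ℂ) with hg
  have hg1 : ∀ χ, g χ 1 = 1 := fun χ => by simp [hg, copChar_one]
  have hgn : ∀ χ n, ‖g χ n‖ ≤ 1 := by
    intro χ n
    simp only [hg, pmul_apply, norm_mul]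
    refine mul_le_one₀ (norm_copChar_le_one _ _ _) (norm_nonneg _) ?_
    have : |moebius n| ≤ 1 := abs_moebius_le_one
    rw [intCoe_apply, Complex.norm_intCast]
    exact_mod_cast this
  set t := (∏ _i ∈ Finset.range m.totient, goodInd ℂ m W) * ∏ χ, g χ with ht
  have htm : t.IsMultiplicative := by
    refine IsMultiplicative.mul ?_ ?_
    · exact isMultiplicative_finsetProd _ _ fun _ _ =>
        isMultiplicative_of_map_mul (goodInd_map_mul _ _ _) (goodInd_one _ _ _)
    · refine isMultiplicative_finsetProd _ _ fun χ _ => ?_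
      exact (isMultiplicative_of_map_mul (copChar_map_mul _ _) (copChar_one _ _)).pmul
        isMultiplicative_moebius.intCast
  have hprime : ∀ p : ℕ, p.Prime → t p = 0 := by
    intro p hp
    obtain ⟨h1, h2⟩ := prod_apply_prime (Finset.range m.totient) (fun _ => goodInd ℂ m W)
      (fun _ _ => goodInd_one _ _ _) hp
    obtain ⟨h3, h4⟩ := prod_apply_prime Finset.univ g (fun χ _ => hg1 χ) hp
    rw [ht, mul_apply_prime _ _ hp, h1, h2, h3, h4, one_mul, mul_one, Finset.sum_const,
      Finset.card_range, goodInd_prime _ _ hp, nsmul_eq_mul]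
    simp only [hg, pmul_apply, copChar_apply, intCoe_apply, moebius_apply_prime hp]
    by_cases hc : p.Coprime W
    · have h5 : ∀ χ : DirichletCharacter ℂ m,
          (if p ≠ 0 ∧ p.Coprime W then χ (p : ZMod m) else 0) = χ (p : ZMod m) :=
        fun χ => if_pos ⟨hp.ne_zero, hc⟩
      have h6 : ((p : ZMod m) = 1) ↔ (p.Coprime W ∧ p ≡ 1 [MOD m]) := by
        rw [and_iff_right hc, ← ZMod.natCast_eq_natCast_iff, Nat.cast_one]
      simp only [h5]
      rw [← Finset.sum_mul, DirichletCharacter.sum_characters_eq, if_congr h6 rfl rfl]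
      split_ifs <;> simp
    · have h5 : ∀ χ : DirichletCharacter ℂ m,
          (if p ≠ 0 ∧ p.Coprime W then χ (p : ZMod m) else 0) = 0 :=
        fun χ => if_neg fun h => hc h.2
      rw [if_neg fun h => hc h.1]
      simp only [h5]
      simp
  obtain ⟨T, hT0, hT⟩ := exists_sum_norm_mul_rpow_le htm _ hprime fun p hp k =>
    norm_mul_apply_prime_pow_le hp
      (norm_prod_apply_prime_pow_le _ _ hp fun _ _ => norm_goodInd_le_one m W)
      (norm_prod_apply_prime_pow_le _ _ hp fun χ _ => hgn χ) k
  refine ⟨t, T, hT0, hT, ?_⟩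
  rw [ht, mul_assoc, ← Finset.prod_mul_distrib, Finset.prod_const, Finset.card_range,
    Finset.prod_congr rfl fun χ _ => pmul_moebius_mul_self (copChar_map_mul W χ) (copChar_one W χ),
    Finset.prod_const_one, mul_one]

theorem mul_rpow_le_rpow_add_one_sub {δ : ℝ} (h0 : 0 ≤ δ) (h1 : δ ≤ 1) (n : ℕ) :
    (n : ℝ) ^ δ ≤ ((n : ℝ) + 1) ^ δ * (1 - δ / (n + 1)) := by
  have hn : (0 : ℝ) < (n : ℝ) + 1 := by positivity
  have h := rpow_one_add_le_one_add_mul_self (s := -(1 / ((n : ℝ) + 1)))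
    (neg_le_neg ((div_le_one hn).2 (by linarith [n.cast_nonneg (α := ℝ)]))) h0 h1
  have h2 : (n : ℝ) = ((n : ℝ) + 1) * (1 + -(1 / ((n : ℝ) + 1))) := by
    field_simp
    ring
  have h3 : 0 ≤ 1 + -(1 / ((n : ℝ) + 1)) := by
    have : 1 / ((n : ℝ) + 1) ≤ 1 := (div_le_one hn).2 (by linarith [n.cast_nonneg (α := ℝ)])
    linarith
  conv_lhs => rw [h2]
  rw [Real.mul_rpow hn.le h3]
  refine mul_le_mul_of_nonneg_left (h.trans_eq ?_) (by positivity)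
  ring

theorem sum_rpow_sub_one_le {δ : ℝ} (h0 : 0 < δ) (h1 : δ ≤ 1) (M : ℕ) :
    ∑ b ∈ Finset.Ioc 0 M, (b : ℝ) ^ (δ - 1) ≤ (M : ℝ) ^ δ / δ := by
  induction M with
  | zero => simp [Real.zero_rpow h0.ne']
  | succ M ih =>
    rw [Finset.sum_Ioc_succ_top (Nat.zero_le M)]
    have h := mul_rpow_le_rpow_add_one_sub h0.le h1 M
    have hM : (0 : ℝ) < (M : ℝ) + 1 := by positivity
    push_cast
    rw [le_div_iff₀ h0] at ih ⊢
    rw [Real.rpow_sub hM, Real.rpow_one]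
    have : ((M : ℝ) + 1) ^ δ * (1 - δ / (M + 1)) =
      ((M : ℝ) + 1) ^ δ - ((M : ℝ) + 1) ^ δ / (M + 1) * δ := by ring
    linarith

theorem rpow_neg_sub_rpow_neg_ge {δ : ℝ} (h0 : 0 ≤ δ) (h1 : δ ≤ 1) {n : ℕ} (hn : 1 ≤ n) :
    δ * ((n : ℝ) + 1) ^ (-δ) / (n + 1) ≤ (n : ℝ) ^ (-δ) - ((n : ℝ) + 1) ^ (-δ) := by
  have hn0 : (0 : ℝ) < n := by exact_mod_cast hn
  have hn1 : (0 : ℝ) < (n : ℝ) + 1 := by positivity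
  have h := mul_rpow_le_rpow_add_one_sub h0 h1 n
  rw [Real.rpow_neg hn0.le, Real.rpow_neg hn1.le]
  set x := (n : ℝ) ^ δ with hx
  set y := ((n : ℝ) + 1) ^ δ with hy
  have hx0 : 0 < x := by positivity
  have hy0 : 0 < y := by positivity
  set e := δ / ((n : ℝ) + 1) with he
  have he0 : 0 ≤ e := by positivity
  have h2 : y⁻¹ * (1 + e) ≤ x⁻¹ := by
    rw [inv_mul_le_iff₀ hy0, ← div_eq_mul_inv, le_div_iff₀ hx0]
    nlinarith [mul_le_mul_of_nonneg_left h (by linarith : 0 ≤ 1 + e),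
      mul_nonneg hy0.le (sq_nonneg e)]
  have h3 : δ * y⁻¹ / ((n : ℝ) + 1) = y⁻¹ * e := by
    rw [he]
    ring
  rw [h3]
  linarith

theorem exists_one_add_log_pow_le (k : ℕ) {ε : ℝ} (hε : 0 < ε) :
    ∃ K : ℝ, 0 < K ∧ ∀ N : ℕ, 1 ≤ N → (1 + Real.log N) ^ k ≤ K * (N : ℝ) ^ ε := by
  have hk : (0 : ℝ) < k + 1 := by positivity
  set e := ε / (k + 1) with he
  have he0 : 0 < e := by positivity
  refine ⟨(1 + 1 / e) ^ k, by positivity, fun N hN => ?_⟩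
  have hN1 : (1 : ℝ) ≤ N := by exact_mod_cast hN
  have h0 := Real.log_natCast_nonneg N
  have h1 : 1 + Real.log N ≤ (1 + 1 / e) * (N : ℝ) ^ e := by
    have h2 := Real.log_le_rpow_div (by linarith : (0 : ℝ) ≤ N) he0
    have h3 : 1 ≤ (N : ℝ) ^ e := Real.one_le_rpow hN1 he0.le
    calc _ ≤ (N : ℝ) ^ e + (N : ℝ) ^ e / e := add_le_add h3 h2
      _ = _ := by ring
  calc _ ≤ ((1 + 1 / e) * (N : ℝ) ^ e) ^ k := by gcongr
    _ = (1 + 1 / e) ^ k * (N : ℝ) ^ (e * k) := by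
      rw [mul_pow, ← Real.rpow_natCast ((N : ℝ) ^ e), ← Real.rpow_mul (by linarith)]
    _ ≤ _ := by
      gcongr
      rw [he, div_mul_eq_mul_div, div_le_iff₀ hk]
      nlinarith

/-- Abel summation: a power saving in the partial sums of `h` gives convergence of
`∑ h(n) / n` with a power saving. -/
theorem exists_norm_sum_div_sub_le {h : ℕ → ℂ} {A δ : ℝ} (hδ0 : 0 < δ) (hδ1 : δ ≤ 1)
    (hA : 0 ≤ A)
    (hh : ∀ n : ℕ, 1 ≤ n → ‖∑ b ∈ Finset.Ioc 0 n, h b‖ ≤ A * (n : ℝ) ^ (1 - δ)) :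
    ∃ κ : ℂ, ∀ N : ℕ, 1 ≤ N →
      ‖∑ a ∈ Finset.Ioc 0 N, h a / a - κ‖ ≤ (2 * A / δ + A) * (N : ℝ) ^ (-δ) := by
  set H : ℕ → ℂ := fun n => ∑ b ∈ Finset.Ioc 0 n, h b with hH
  set G : ℕ → ℂ := fun n => ∑ a ∈ Finset.Ioc 0 n, h a / a - H n / n with hG
  have hHn : ∀ n : ℕ, 1 ≤ n → ‖H n / n‖ ≤ A * (n : ℝ) ^ (-δ) := by
    intro n hn
    have hn0 : (0 : ℝ) < n := by exact_mod_cast hn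
    rw [norm_div, Complex.norm_natCast, div_le_iff₀ hn0]
    refine (hh n hn).trans_eq ?_
    rw [sub_eq_neg_add, Real.rpow_add hn0, Real.rpow_one, mul_assoc]
  have hstep : ∀ n : ℕ, 1 ≤ n → ‖G (n + 1) - G n‖ ≤
      2 * A / δ * ((n : ℝ) ^ (-δ) - ((n + 1 : ℕ) : ℝ) ^ (-δ)) := by
    intro n hn
    have hn0 : (0 : ℝ) < n := by exact_mod_cast hn
    have hn1 : (0 : ℝ) < (n : ℝ) + 1 := by positivity
    have e1 : G (n + 1) - G n = H n / n / (n + 1) := by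
      have hnc : (n : ℂ) ≠ 0 := by exact_mod_cast hn0.ne'
      have hnc1 : (n : ℂ) + 1 ≠ 0 := by exact_mod_cast hn1.ne'
      simp only [hG, hH, Finset.sum_Ioc_succ_top (Nat.zero_le n)]
      push_cast
      field_simp
      ring
    have h1 := rpow_neg_sub_rpow_neg_ge hδ0.le hδ1 hn
    rw [e1, norm_div]
    have h2 : ‖(n : ℂ) + 1‖ = (n : ℝ) + 1 := by
      rw [← Nat.cast_add_one, Complex.norm_natCast, Nat.cast_add_one]
    rw [h2, div_le_iff₀ hn1]
    have h3 : (n : ℝ) ^ (-δ) ≤ 2 * ((n : ℝ) + 1) ^ (-δ) := by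
      have h4 : ((n : ℝ) + 1) ^ δ ≤ 2 * (n : ℝ) ^ δ := by
        calc ((n : ℝ) + 1) ^ δ ≤ (2 * n) ^ δ := by
              have : (1 : ℝ) ≤ n := by exact_mod_cast hn
              gcongr
              linarith
          _ = 2 ^ δ * (n : ℝ) ^ δ := Real.mul_rpow (by norm_num) hn0.le
          _ ≤ _ := by
              gcongr
              conv_rhs => rw [← Real.rpow_one 2]
              exact Real.rpow_le_rpow_of_exponent_le (by norm_num) hδ1
      rw [Real.rpow_neg hn0.le, Real.rpow_neg hn1.le, ← div_eq_mul_inv,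
        inv_le_comm₀ (by positivity) (by positivity), inv_div, div_le_iff₀ (by norm_num)]
      linarith
    calc _ ≤ A * (n : ℝ) ^ (-δ) := hHn n hn
      _ ≤ A * (2 * ((n : ℝ) + 1) ^ (-δ)) := by gcongr
      _ = 2 * A / δ * (δ * ((n : ℝ) + 1) ^ (-δ) / (n + 1)) * (n + 1) := by field_simp
      _ ≤ _ := by
        push_cast
        gcongr
  have htel : ∀ N M : ℕ, 1 ≤ N → N ≤ M → ‖G M - G N‖ ≤
      2 * A / δ * ((N : ℝ) ^ (-δ) - (M : ℝ) ^ (-δ)) := by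
    intro N M hN hM
    induction M, hM using Nat.le_induction with
    | base => simp
    | succ M hM ih =>
      calc _ = ‖(G (M + 1) - G M) + (G M - G N)‖ := by ring_nf
        _ ≤ _ := norm_add_le _ _
        _ ≤ _ := add_le_add (hstep M (hN.trans hM)) ih
        _ = _ := by ring
  have htel' : ∀ N M : ℕ, 1 ≤ N → N ≤ M → ‖G M - G N‖ ≤ 2 * A / δ * (N : ℝ) ^ (-δ) := by
    intro N M hN hM
    refine (htel N M hN hM).trans ?_
    gcongr
    have : (0 : ℝ) ≤ (M : ℝ) ^ (-δ) := by positivity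
    linarith
  have hcau : CauchySeq fun n => G (n + 1) := by
    refine cauchySeq_of_le_tendsto_0' (fun n => 2 * A / δ * ((n + 1 : ℕ) : ℝ) ^ (-δ)) ?_ ?_
    · intro n k hnk
      rw [dist_comm, dist_eq_norm]
      exact htel' (n + 1) (k + 1) (by omega) (by omega)
    · have h1 : Filter.Tendsto (fun n : ℕ => ((n + 1 : ℕ) : ℝ) ^ (-δ)) Filter.atTop (nhds 0) :=
        ((tendsto_rpow_neg_atTop hδ0).comp tendsto_natCast_atTop_atTop).comp
          (Filter.tendsto_add_atTop_nat 1)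
      simpa using h1.const_mul (2 * A / δ)
  obtain ⟨κ, hκ⟩ := cauchySeq_tendsto_of_complete hcau
  refine ⟨κ, fun N hN => ?_⟩
  have h1 : ‖κ - G N‖ ≤ 2 * A / δ * (N : ℝ) ^ (-δ) := by
    refine le_of_tendsto (hκ.sub_const (G N)).norm ?_
    filter_upwards [Filter.eventually_ge_atTop N] with n hn
    exact htel' N (n + 1) hN (by omega)
  calc _ = ‖H N / N - (κ - G N)‖ := by
        simp only [hG]
        congr 1
        ring
    _ ≤ _ := norm_sub_le _ _
    _ ≤ _ := add_le_add (hHn N hN) h1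
    _ = _ := by ring

theorem sum_periodic_sub_le {g : ℕ → ℂ} {W : ℕ} (hW : 0 < W) (hg : ∀ n, g (n + W) = g n)
    (hg1 : ∀ n, ‖g n‖ ≤ 1) (n : ℕ) :
    ‖∑ i ∈ Finset.range n, g i - (∑ i ∈ Finset.range W, g i) / W * n‖ ≤ 2 * W := by
  have hWc : (W : ℂ) ≠ 0 := by exact_mod_cast hW.ne'
  have hb : ∀ n : ℕ, ‖∑ i ∈ Finset.range n, g i‖ ≤ n := fun n => by
    refine (norm_sum_le _ _).trans ((Finset.sum_le_sum fun i _ => hg1 i).trans ?_)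
    simp
  induction n using Nat.strong_induction_on with
  | _ n ih =>
    rcases lt_or_ge n W with h | h
    · have h1 : (n : ℝ) ≤ W := by exact_mod_cast h.le
      refine (norm_sub_le _ _).trans ?_
      rw [norm_mul, norm_div, Complex.norm_natCast, Complex.norm_natCast]
      have h2 : ‖∑ i ∈ Finset.range W, g i‖ / W ≤ 1 :=
        (div_le_one (by exact_mod_cast hW)).2 (hb W)
      have h3 := hb n
      have h4 : ‖∑ i ∈ Finset.range W, g i‖ / W * n ≤ 1 * W :=
        mul_le_mul h2 h1 (Nat.cast_nonneg _) zero_le_one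
      linarith
    · obtain ⟨k, rfl⟩ := Nat.exists_eq_add_of_le h
      have := ih k (by omega)
      rw [Finset.sum_range_add]
      have h5 : ∀ i, g (W + i) = g i := fun i => by rw [add_comm, hg]
      simp only [h5]
      convert this using 2
      push_cast
      field_simp
      ring

/-- If `h` has small partial sums and `u` has a mean value, then `h * u` has a mean value. -/
theorem exists_norm_sum_mul_sub_le {h u : ArithmeticFunction ℂ} {A B D δ : ℝ} {α : ℂ}
    (hδ0 : 0 < δ) (hδ1 : δ ≤ 1 / 4) (hA : 0 ≤ A) (hB : 0 ≤ B) (hD : 0 ≤ D)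
    (hh : ∀ n : ℕ, 1 ≤ n → ‖∑ b ∈ Finset.Ioc 0 n, h b‖ ≤ A * (n : ℝ) ^ (1 - δ))
    (hhB : ∀ n : ℕ, 1 ≤ n → ∑ b ∈ Finset.Ioc 0 n, ‖h b‖ / b ≤ B * (n : ℝ) ^ (1 / 4 : ℝ))
    (hu1 : ∀ n, ‖u n‖ ≤ 1) (hu : ∀ n : ℕ, ‖∑ b ∈ Finset.Ioc 0 n, u b - α * n‖ ≤ D) :
    ∃ (κ : ℂ) (C : ℝ), 0 ≤ C ∧ ∀ N : ℕ, 1 ≤ N →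
      ‖∑ n ∈ Finset.Ioc 0 N, (h * u) n - κ * N‖ ≤ C * (N : ℝ) ^ (1 - δ / 2) := by
  obtain ⟨κ, hκ⟩ := exists_norm_sum_div_sub_le hδ0 (by linarith) hA hh
  refine ⟨α * κ, (D + ‖α‖) * B + ‖α‖ * ((2 * A / δ + A) * 2) + 2 * A / δ, by positivity,
    fun N hN => ?_⟩
  have hN1 : (1 : ℝ) ≤ N := by exact_mod_cast hN
  have hN0 : (0 : ℝ) < N := by linarith
  set U := Nat.sqrt N with hU
  have hU1 : 1 ≤ U := Nat.le_sqrt.2 (by omega)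
  have hUN : U ≤ N := Nat.sqrt_le_self N
  have hU1r : (1 : ℝ) ≤ U := by exact_mod_cast hU1
  have hU0 : (0 : ℝ) < U := by linarith
  have hUle : (U : ℝ) ≤ (N : ℝ) ^ (1 / 2 : ℝ) := by
    rw [← Real.sqrt_eq_rpow]
    exact Real.nat_sqrt_le_real_sqrt
  have hUge : (N : ℝ) ^ (1 / 2 : ℝ) ≤ 2 * U := by
    rw [← Real.sqrt_eq_rpow]
    have := Real.real_sqrt_le_nat_sqrt_succ (a := N)
    rw [← hU] at this
    linarith
  have hM : N / (U + 1) ≤ U := by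
    have := Nat.lt_succ_sqrt N
    rw [← Nat.lt_succ_iff, Nat.div_lt_iff_lt_mul (by omega)]
    exact this
  rw [sum_Ioc_mul_eq_hyperbola h u hUN]
  have e : ∑ a ∈ Finset.Ioc 0 U, h a * ∑ b ∈ Finset.Ioc 0 (N / a), u b =
      ∑ a ∈ Finset.Ioc 0 U, h a * (∑ b ∈ Finset.Ioc 0 (N / a), u b - α * (N / a)) +
        α * N * ∑ a ∈ Finset.Ioc 0 U, h a / a := by
    rw [Finset.mul_sum, ← Finset.sum_add_distrib]
    refine Finset.sum_congr rfl fun a _ => ?_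
    ring
  have e1 : ‖∑ a ∈ Finset.Ioc 0 U, h a * (∑ b ∈ Finset.Ioc 0 (N / a), u b - α * (N / a))‖ ≤
      (D + ‖α‖) * B * (N : ℝ) ^ (1 - δ / 2) := by
    calc _ ≤ ∑ a ∈ Finset.Ioc 0 U, (D + ‖α‖) * U * (‖h a‖ / a) := by
          refine (norm_sum_le _ _).trans (Finset.sum_le_sum fun a ha => ?_)
          rw [Finset.mem_Ioc] at ha
          have ha0 : (0 : ℝ) < a := by exact_mod_cast ha.1
          have haU : (a : ℝ) ≤ U := by exact_mod_cast ha.2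
          have h1 : ‖∑ b ∈ Finset.Ioc 0 (N / a), u b - α * (N / a)‖ ≤ D + ‖α‖ := by
            have h2 : ‖((N / a : ℕ) : ℂ) - N / a‖ ≤ 1 := by
              have h3 : (((N / a : ℕ) : ℝ) - (N : ℝ) / a : ℝ) = (((N / a : ℕ) : ℂ) - N / a) := by
                push_cast
                ring
              rw [← h3, Complex.norm_real, Real.norm_eq_abs, abs_le]
              have h4 : ((N / a : ℕ) : ℝ) ≤ N / a := Nat.cast_div_le
              have h5 : (N : ℝ) / a < (N / a : ℕ) + 1 := by
                rw [div_lt_iff₀ ha0]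
                exact_mod_cast Nat.lt_mul_of_div_lt (Nat.lt_succ_self (N / a)) ha.1
              constructor <;> linarith
            calc _ = ‖(∑ b ∈ Finset.Ioc 0 (N / a), u b - α * (N / a : ℕ)) +
                  α * (((N / a : ℕ) : ℂ) - N / a)‖ := by ring_nf
              _ ≤ _ := norm_add_le _ _
              _ ≤ D + ‖α‖ * 1 := by
                rw [norm_mul]
                exact add_le_add (hu _) (by gcongr)
              _ = _ := by rw [mul_one]
          rw [norm_mul]
          calc _ ≤ ‖h a‖ * (D + ‖α‖) := by gcongr
            _ = (D + ‖α‖) * a * (‖h a‖ / a) := by field_simp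
            _ ≤ _ := by gcongr
      _ = (D + ‖α‖) * U * ∑ a ∈ Finset.Ioc 0 U, ‖h a‖ / a := by rw [Finset.mul_sum]
      _ ≤ (D + ‖α‖) * U * (B * (U : ℝ) ^ (1 / 4 : ℝ)) := by
          gcongr
          exact hhB U hU1
      _ = (D + ‖α‖) * B * (U : ℝ) ^ (5 / 4 : ℝ) := by
          rw [show (5 / 4 : ℝ) = 1 + 1 / 4 by norm_num, Real.rpow_add hU0, Real.rpow_one]
          ring
      _ ≤ (D + ‖α‖) * B * ((N : ℝ) ^ (1 / 2 : ℝ)) ^ (5 / 4 : ℝ) := by gcongr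
      _ ≤ _ := by
          rw [← Real.rpow_mul hN0.le]
          gcongr
          linarith
  have e2 : ‖∑ a ∈ Finset.Ioc 0 U, h a / a - κ‖ ≤
      (2 * A / δ + A) * 2 * (N : ℝ) ^ (-(δ / 2)) := by
    refine (hκ U hU1).trans ?_
    rw [mul_assoc]
    gcongr
    rw [Real.rpow_neg hU0.le, Real.rpow_neg hN0.le, ← div_eq_mul_inv,
      inv_le_comm₀ (by positivity) (by positivity), inv_div, div_le_iff₀ (by norm_num)]
    calc (N : ℝ) ^ (δ / 2) = ((N : ℝ) ^ (1 / 2 : ℝ)) ^ δ := by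
          rw [← Real.rpow_mul hN0.le]
          congr 1
          ring
      _ ≤ (2 * U) ^ δ := by gcongr
      _ = 2 ^ δ * (U : ℝ) ^ δ := Real.mul_rpow (by norm_num) hU0.le
      _ ≤ 2 * (U : ℝ) ^ δ := by
          gcongr
          conv_rhs => rw [← Real.rpow_one 2]
          exact Real.rpow_le_rpow_of_exponent_le (by norm_num) (by linarith)
      _ = _ := mul_comm _ _
  have e3 : ‖∑ b ∈ Finset.Ioc 0 (N / (U + 1)),
      u b * (∑ a ∈ Finset.Ioc 0 (N / b), h a - ∑ a ∈ Finset.Ioc 0 U, h a)‖ ≤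
      2 * A / δ * (N : ℝ) ^ (1 - δ / 2) := by
    calc _ ≤ ∑ b ∈ Finset.Ioc 0 (N / (U + 1)), 2 * A * (N : ℝ) ^ (1 - δ) * (b : ℝ) ^ (δ - 1) := by
          refine (norm_sum_le _ _).trans (Finset.sum_le_sum fun b hb => ?_)
          rw [Finset.mem_Ioc] at hb
          have hb0 : (0 : ℝ) < b := by exact_mod_cast hb.1
          have h1 : U + 1 ≤ N / b := by
            rw [Nat.le_div_iff_mul_le hb.1, mul_comm]
            exact (Nat.le_div_iff_mul_le (by omega)).1 hb.2
          have h2 : ((N / b : ℕ) : ℝ) ≤ N / b := Nat.cast_div_le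
          have h3 : (U : ℝ) ≤ (N / b : ℕ) := by exact_mod_cast (by omega : U ≤ N / b)
          have h4 : ((N : ℝ) / b) ^ (1 - δ) = (N : ℝ) ^ (1 - δ) * (b : ℝ) ^ (δ - 1) := by
            rw [Real.div_rpow hN0.le hb0.le, show δ - 1 = -(1 - δ) by ring, Real.rpow_neg hb0.le]
            rfl
          have h5 : ∀ n : ℕ, 1 ≤ n → (n : ℝ) ≤ N / b → ‖∑ a ∈ Finset.Ioc 0 n, h a‖ ≤
              A * ((N : ℝ) ^ (1 - δ) * (b : ℝ) ^ (δ - 1)) := by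
            intro n hn1 hn2
            rw [← h4]
            refine (hh n hn1).trans ?_
            gcongr
            linarith
          rw [norm_mul]
          calc _ ≤ 1 * (‖∑ a ∈ Finset.Ioc 0 (N / b), h a‖ + ‖∑ a ∈ Finset.Ioc 0 U, h a‖) :=
                mul_le_mul (hu1 b) (norm_sub_le _ _) (norm_nonneg _) zero_le_one
            _ ≤ _ := by
                have := h5 (N / b) (by omega) h2
                have := h5 U hU1 (h3.trans h2)
                linarith
      _ = 2 * A * (N : ℝ) ^ (1 - δ) *
          ∑ b ∈ Finset.Ioc 0 (N / (U + 1)), (b : ℝ) ^ (δ - 1) := by rw [Finset.mul_sum]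
      _ ≤ 2 * A * (N : ℝ) ^ (1 - δ) * ((N : ℝ) ^ (δ / 2) / δ) := by
          gcongr
          refine (sum_rpow_sub_one_le hδ0 (by linarith) _).trans ?_
          gcongr
          calc ((N / (U + 1) : ℕ) : ℝ) ^ δ ≤ ((N : ℝ) ^ (1 / 2 : ℝ)) ^ δ := by
                gcongr
                exact le_trans (by exact_mod_cast hM) hUle
            _ = _ := by
                rw [← Real.rpow_mul hN0.le]
                congr 1
                ring
      _ = _ := by
          rw [show 1 - δ / 2 = (1 - δ) + δ / 2 by ring, Real.rpow_add hN0]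
          ring
  rw [e]
  set S1 := ∑ a ∈ Finset.Ioc 0 U, h a * (∑ b ∈ Finset.Ioc 0 (N / a), u b - α * (N / a))
  set S3 := ∑ b ∈ Finset.Ioc 0 (N / (U + 1)),
      u b * (∑ a ∈ Finset.Ioc 0 (N / b), h a - ∑ a ∈ Finset.Ioc 0 U, h a)
  set S2 := ∑ a ∈ Finset.Ioc 0 U, h a / a
  have e4 : ‖α * N * (S2 - κ)‖ ≤ ‖α‖ * ((2 * A / δ + A) * 2) * (N : ℝ) ^ (1 - δ / 2) := by
    rw [norm_mul, norm_mul, Complex.norm_natCast]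
    calc _ ≤ ‖α‖ * N * ((2 * A / δ + A) * 2 * (N : ℝ) ^ (-(δ / 2))) := by gcongr
      _ = _ := by
        rw [sub_eq_add_neg, Real.rpow_add hN0, Real.rpow_one]
        ring
  calc ‖S1 + α * N * S2 + S3 - α * κ * N‖ = ‖S1 + α * N * (S2 - κ) + S3‖ := by ring_nf
    _ ≤ _ := norm_add₃_le
    _ ≤ _ := add_le_add (add_le_add e1 e4) e3
    _ = _ := by ring

theorem copChar_eq_changeLevel {m W : ℕ} [NeZero W] (h : m ∣ W) (χ : DirichletCharacter ℂ m)
    {n : ℕ} (hn : n ≠ 0) : copChar W χ n = DirichletCharacter.changeLevel h χ (n : ZMod W) := by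
  rw [copChar_apply]
  by_cases hc : n.Coprime W
  · rw [if_pos ⟨hn, hc⟩]
    have hu : IsUnit (n : ZMod W) := (ZMod.isUnit_iff_coprime n W).2 hc
    rw [← hu.unit_spec, DirichletCharacter.changeLevel_eq_cast_of_dvd, hu.unit_spec,
      ZMod.cast_natCast h]
  · rw [if_neg fun h => hc h.2]
    exact ((DirichletCharacter.changeLevel h χ).map_nonunit
      fun hu => hc ((ZMod.isUnit_iff_coprime n W).1 hu)).symm

theorem sum_copChar_sub_le {m W : ℕ} [NeZero W] (h : m ∣ W) (χ : DirichletCharacter ℂ m) (n : ℕ) :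
    ‖∑ b ∈ Finset.Ioc 0 n, copChar W χ b -
      (∑ a : ZMod W, DirichletCharacter.changeLevel h χ a) / W * n‖ ≤ 2 * W := by
  have hW : 0 < W := Nat.pos_of_ne_zero (NeZero.ne W)
  set ψ := DirichletCharacter.changeLevel h χ with hψ
  have h1 : ∀ n, ∑ b ∈ Finset.Ioc 0 n, copChar W χ b =
      ∑ i ∈ Finset.range n, ψ ((i + 1 : ℕ) : ZMod W) := by
    intro n
    rw [← Finset.sum_congr rfl fun i _ => copChar_eq_changeLevel h χ (Nat.succ_ne_zero i)]
    induction n with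
    | zero => simp
    | succ n ih => rw [Finset.sum_Ioc_succ_top (Nat.zero_le n), Finset.sum_range_succ, ih]
  have h2 : ∑ i ∈ Finset.range W, ψ ((i + 1 : ℕ) : ZMod W) = ∑ a : ZMod W, ψ a := by
    rw [← Equiv.sum_comp (Equiv.addRight (1 : ZMod W))]
    refine Finset.sum_bij' (fun i _ => (i : ZMod W)) (fun a _ => a.val)
      (fun _ _ => Finset.mem_univ _)
      (fun a _ => Finset.mem_range.2 (ZMod.val_lt a)) (fun i hi => ?_) (fun a _ => ?_) fun i _ => ?_
    · exact ZMod.val_cast_of_lt (Finset.mem_range.1 hi)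
    · exact ZMod.natCast_zmod_val a
    · simp
  rw [h1, ← h2]
  refine sum_periodic_sub_le hW (fun n => ?_) (fun n => ψ.norm_le_one _) n
  push_cast
  simp

theorem norm_sum_copChar_le {m W : ℕ} [NeZero W] (h : m ∣ W) {χ : DirichletCharacter ℂ m}
    (hχ : χ ≠ 1) (n : ℕ) : ‖∑ b ∈ Finset.Ioc 0 n, copChar W χ b‖ ≤ 2 * W := by
  have h1 := sum_copChar_sub_le h χ n
  have h2 : ∑ a : ZMod W, DirichletCharacter.changeLevel h χ a = 0 := by
    refine MulChar.sum_eq_zero_of_ne_one fun h0 => hχ ?_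
    exact DirichletCharacter.changeLevel_injective h (h0.trans (map_one _).symm)
  simpa [h2] using h1

/-- The Dirichlet convolution power of the indicator of the integers composed of primes `1`
modulo `m` has a mean value, with a power saving. -/
theorem exists_norm_sum_goodInd_pow_sub_le (m W : ℕ) [NeZero m] [NeZero W] (h : m ∣ W) :
    ∃ (κ : ℂ) (C δ : ℝ), 0 ≤ C ∧ 0 < δ ∧ δ ≤ 1 / 4 ∧ ∀ N : ℕ, 1 ≤ N →
      ‖∑ n ∈ Finset.Ioc 0 N, (goodInd ℂ m W ^ m.totient) n - κ * N‖ ≤ C * (N : ℝ) ^ (1 - δ) := by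
  classical
  obtain ⟨t, T, hT0, hT, ht⟩ := exists_goodInd_pow_eq m W
  have hW1 : 1 ≤ W := Nat.one_le_iff_ne_zero.2 (NeZero.ne W)
  have hW1r : (1 : ℝ) ≤ W := by exact_mod_cast hW1
  set s : Finset (DirichletCharacter ℂ m) := Finset.univ.erase 1 with hs
  set k := s.card with hk
  have hk0 : (0 : ℝ) < k + 1 := by positivity
  set P := ∏ χ ∈ s, copChar W χ with hP
  set δ : ℝ := 1 / (4 * (k + 1)) with hδ
  have hδ0 : 0 < δ := by positivity
  have hδ1 : δ ≤ 1 / 4 := by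
    rw [hδ, div_le_div_iff₀ (by positivity) (by norm_num)]
    linarith [k.cast_nonneg (α := ℝ)]
  obtain ⟨K, hK0, hK⟩ := exists_one_add_log_pow_le k hδ0
  have hG : ∀ n : ℕ, 1 ≤ n → ‖∑ b ∈ Finset.Ioc 0 n, P b‖ ≤
      (2 * W * 8 ^ k * K) * (n : ℝ) ^ (1 - δ) := by
    intro n hn
    have hn1 : (1 : ℝ) ≤ n := by exact_mod_cast hn
    have hn0 : (0 : ℝ) < n := by linarith
    have h1 := norm_sum_prod_le s (copChar W) (C := 2 * W) (Z := 1) (δ := 1) (X := n)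
      (by linarith) le_rfl one_pos le_rfl (fun χ _ => norm_copChar_le_one W χ)
      (fun χ hχ b _ _ => by
        have := norm_sum_copChar_le h (Finset.ne_of_mem_erase hχ) b
        simpa using this) n hn le_rfl
    refine h1.trans ?_
    rw [← hk, one_pow]
    calc _ ≤ 2 * W * 8 ^ k * n * (1 / n : ℝ) ^ (1 / (k + 1 : ℝ)) * (K * (n : ℝ) ^ δ) := by
          gcongr
          exact hK n hn
      _ = 2 * W * 8 ^ k * K * (n : ℝ) ^ (1 - 1 / (k + 1 : ℝ) + δ) := by
          rw [Real.rpow_add hn0, Real.rpow_sub hn0, Real.rpow_one, one_div (n : ℝ),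
            Real.inv_rpow hn0.le]
          ring
      _ ≤ _ := by
          gcongr
          have : 1 / (k + 1 : ℝ) = 4 * δ := by
            rw [hδ]
            field_simp
          linarith
  have hH : ∀ n : ℕ, 1 ≤ n → ‖∑ b ∈ Finset.Ioc 0 n, (t * P) b‖ ≤
      (2 * W * 8 ^ k * K * T) * (n : ℝ) ^ (1 - δ) := fun n hn =>
    norm_sum_mul_le_of_summable (X := n) hδ1 (by positivity) hT (fun b hb _ => hG b hb) le_rfl
  obtain ⟨K', hK'0, hK'⟩ := exists_one_add_log_pow_le k (by norm_num : (0 : ℝ) < 1 / 4)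
  have hHB : ∀ n : ℕ, 1 ≤ n → ∑ b ∈ Finset.Ioc 0 n, ‖(t * P) b‖ / b ≤
      (T * K') * (n : ℝ) ^ (1 / 4 : ℝ) := by
    intro n hn
    refine (sum_norm_div_mul_le t P n).trans ?_
    rw [mul_assoc]
    refine mul_le_mul ?_ ((sum_norm_prod_div_le s (copChar W)
      (fun χ _ => norm_copChar_le_one W χ) n).trans (hK' n hn))
      (Finset.sum_nonneg fun _ _ => by positivity) hT0
    refine le_trans (Finset.sum_le_sum fun b hb => ?_) (hT n)
    have hb1 : (1 : ℝ) ≤ b := by exact_mod_cast (Finset.mem_Ioc.1 hb).1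
    rw [div_eq_mul_inv, ← Real.rpow_neg_one]
    gcongr
    norm_num
  obtain ⟨κ, C, hC, hκ⟩ := exists_norm_sum_mul_sub_le (h := t * P) (u := copChar W 1)
    hδ0 hδ1 (by positivity) (by positivity) (by positivity) hH hHB (norm_copChar_le_one W 1)
    (sum_copChar_sub_le h (1 : DirichletCharacter ℂ m))
  refine ⟨κ, C, δ / 2, hC, by positivity, by linarith, fun N hN => ?_⟩
  rw [ht, ← Finset.prod_erase_mul _ _ (Finset.mem_univ (1 : DirichletCharacter ℂ m)), ← mul_assoc]
  exact hκ N hN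

theorem goodInd_nonneg (m W n : ℕ) : 0 ≤ goodInd ℝ m W n := by
  rcases goodInd_mem m W n with h | h <;> simp [h]

theorem goodInd_pow_nonneg (m W k n : ℕ) : 0 ≤ (goodInd ℝ m W ^ k) n := by
  induction k generalizing n with
  | zero =>
    rw [pow_zero, ArithmeticFunction.one_apply]
    split_ifs <;> simp
  | succ k ih =>
    rw [pow_succ, ArithmeticFunction.mul_apply]
    exact Finset.sum_nonneg fun x _ => mul_nonneg (ih _) (goodInd_nonneg _ _ _)

theorem goodInd_pow_prime (R : Type*) [CommRing R] (m W k : ℕ) {p : ℕ} (hp : p.Prime) :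
    (goodInd R m W ^ k) p = k * goodInd R m W p := by
  have h := (prod_apply_prime (Finset.range k) (fun _ => goodInd R m W)
    (fun _ _ => goodInd_one _ _ _) hp).2
  simpa using h

theorem exists_abs_sum_goodInd_pow_sub_le (m W : ℕ) [NeZero m] [NeZero W] (h : m ∣ W) :
    ∃ κ C δ : ℝ, 0 < κ ∧ 0 ≤ C ∧ 0 < δ ∧ δ ≤ 1 / 4 ∧ ∀ N : ℕ, 1 ≤ N →
      |∑ n ∈ Finset.Ioc 0 N, (goodInd ℝ m W ^ m.totient) n - κ * N| ≤ C * (N : ℝ) ^ (1 - δ) := by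
  obtain ⟨κ, C, δ, hC, hδ0, hδ1, hκ⟩ := exists_norm_sum_goodInd_pow_sub_le m W h
  set r := goodInd ℝ m W ^ m.totient with hr
  have hr0 : ∀ n, 0 ≤ r n := goodInd_pow_nonneg _ _ _
  have main : ∀ N : ℕ, 1 ≤ N →
      |∑ n ∈ Finset.Ioc 0 N, r n - κ.re * N| ≤ C * (N : ℝ) ^ (1 - δ) := by
    intro N hN
    have hre : (∑ n ∈ Finset.Ioc 0 N, (goodInd ℂ m W ^ m.totient) n - κ * N).re =
        ∑ n ∈ Finset.Ioc 0 N, r n - κ.re * N := by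
      simp_rw [← ofReal_goodInd_pow]
      rw [← Complex.ofReal_sum, Complex.sub_re, Complex.ofReal_re, Complex.mul_re,
        Complex.natCast_re, Complex.natCast_im, mul_zero, sub_zero]
    rw [← hre]
    exact (Complex.abs_re_le_norm _).trans (hκ N hN)
  refine ⟨κ.re, C, δ, ?_, hC, hδ0, hδ1, main⟩
  by_contra hneg
  push Not at hneg
  have hR : ∀ N : ℕ, 1 ≤ N → ∑ n ∈ Finset.Ioc 0 N, r n ≤ C * (N : ℝ) ^ (1 - δ) := by
    intro N hN
    have h1 := (abs_le.1 (main N hN)).2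
    have h2 : κ.re * N ≤ 0 := mul_nonpos_of_nonpos_of_nonneg hneg (Nat.cast_nonneg _)
    linarith
  set e := δ / 2 with he
  have he0 : 0 < e := by positivity
  have hh : ∀ n : ℕ, 1 ≤ n → ‖∑ b ∈ Finset.Ioc 0 n, ((r b * (b : ℝ) ^ e : ℝ) : ℂ)‖ ≤
      C * (n : ℝ) ^ (1 - e) := by
    intro n hn
    have hn0 : (0 : ℝ) < n := by exact_mod_cast hn
    rw [← Complex.ofReal_sum, Complex.norm_real, Real.norm_of_nonneg
      (Finset.sum_nonneg fun b _ => mul_nonneg (hr0 b) (by positivity))]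
    calc _ ≤ ∑ b ∈ Finset.Ioc 0 n, r b * (n : ℝ) ^ e := by
          refine Finset.sum_le_sum fun b hb => mul_le_mul_of_nonneg_left ?_ (hr0 b)
          have : (b : ℝ) ≤ n := by exact_mod_cast (Finset.mem_Ioc.1 hb).2
          gcongr
      _ = (∑ b ∈ Finset.Ioc 0 n, r b) * (n : ℝ) ^ e := by rw [Finset.sum_mul]
      _ ≤ C * (n : ℝ) ^ (1 - δ) * (n : ℝ) ^ e := by
          gcongr
          exact hR n hn
      _ = _ := by
          rw [mul_assoc, ← Real.rpow_add hn0]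
          congr 2
          rw [he]
          ring
  obtain ⟨κ', hκ'⟩ := exists_norm_sum_div_sub_le he0 (by linarith) hC hh
  have hB : ∀ N : ℕ, 1 ≤ N → ∑ a ∈ Finset.Ioc 0 N, r a * (a : ℝ) ^ e / a ≤
      2 * C / e + C + ‖κ'‖ := by
    intro N hN
    have h1 := hκ' N hN
    have h2 : (N : ℝ) ^ (-e) ≤ 1 :=
      Real.rpow_le_one_of_one_le_of_nonpos (by exact_mod_cast hN) (by linarith)
    have h3 : (∑ a ∈ Finset.Ioc 0 N, ((r a * (a : ℝ) ^ e : ℝ) : ℂ) / a) =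
        ((∑ a ∈ Finset.Ioc 0 N, r a * (a : ℝ) ^ e / a : ℝ) : ℂ) := by
      push_cast
      rfl
    rw [h3] at h1
    have h4 := norm_le_norm_add_norm_sub' ((∑ a ∈ Finset.Ioc 0 N, r a * (a : ℝ) ^ e / a : ℝ) : ℂ) κ'
    rw [Complex.norm_real] at h4
    have h5 := Real.le_norm_self (∑ a ∈ Finset.Ioc 0 N, r a * (a : ℝ) ^ e / a)
    have h6 : (2 * C / e + C) * (N : ℝ) ^ (-e) ≤ (2 * C / e + C) * 1 := by gcongr
    linarith
  refine ArithmeticFunction.vonMangoldt.not_summable_residueClass_prime_div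
    (q := m) (a := 1) isUnit_one ?_
  set f : ℕ → ℝ := fun n => (if n.Prime then
    ArithmeticFunction.vonMangoldt.residueClass (1 : ZMod m) n else 0) / n with hf
  have hf0 : ∀ n, 0 ≤ f n := by
    intro n
    simp only [hf]
    split_ifs
    · exact div_nonneg (Set.indicator_nonneg
        (fun _ _ => ArithmeticFunction.vonMangoldt_nonneg) _) (Nat.cast_nonneg _)
    · simp
  have hφ : (1 : ℝ) ≤ m.totient := by
    exact_mod_cast Nat.totient_pos.2 (Nat.pos_of_ne_zero (NeZero.ne m))
  have hfle : ∀ n,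
      f n ≤ 1 / e * (r n * (n : ℝ) ^ e / n) + if n ∈ W.primeFactors then f n else 0 := by
    intro n
    have h0 : 0 ≤ 1 / e * (r n * (n : ℝ) ^ e / n) :=
      mul_nonneg (by positivity) (div_nonneg (mul_nonneg (hr0 n) (by positivity)) (by positivity))
    have h1 : (0 : ℝ) ≤ if n ∈ W.primeFactors then f n else 0 := by
      split_ifs
      exacts [hf0 n, le_rfl]
    by_cases hn : n.Prime
    swap
    · have : f n = 0 := by simp [hf, hn]
      linarith
    by_cases hmod : (n : ZMod m) = 1
    swap
    · have : f n = 0 := by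
        simp [hf, ArithmeticFunction.vonMangoldt.residueClass, hmod]
      linarith
    by_cases hW : n ∣ W
    · rw [if_pos (Nat.mem_primeFactors.2 ⟨hn, hW, NeZero.ne W⟩)]
      linarith
    have hgood : goodInd ℝ m W n = 1 := by
      rw [goodInd_prime _ _ hn, if_pos]
      refine ⟨(Nat.Prime.coprime_iff_not_dvd hn).2 hW, ?_⟩
      rw [← ZMod.natCast_eq_natCast_iff, hmod, Nat.cast_one]
    have hrn : r n = m.totient := by
      rw [hr, goodInd_pow_prime _ _ _ _ hn, hgood, mul_one]
    have hfn : f n = Real.log n / n := by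
      simp [hf, hn, ArithmeticFunction.vonMangoldt.residueClass, hmod,
        ArithmeticFunction.vonMangoldt_apply_prime hn]
    have h2 := Real.log_le_rpow_div (Nat.cast_nonneg (α := ℝ) n) he0
    rw [hfn, hrn]
    have h3 : Real.log n / n ≤ 1 / e * (m.totient * (n : ℝ) ^ e / n) := by
      rw [mul_div_assoc', ]
      refine div_le_div_of_nonneg_right (h2.trans ?_) (Nat.cast_nonneg _)
      rw [div_eq_mul_one_div, mul_comm]
      gcongr
      exact le_mul_of_one_le_left (by positivity) hφ
    rw [hfn] at h1
    linarith
  refine summable_of_sum_range_le (c := 1 / e * (2 * C / e + C + ‖κ'‖) +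
    ∑ n ∈ W.primeFactors, f n) hf0 fun N => ?_
  calc ∑ n ∈ Finset.range N, f n ≤ ∑ n ∈ Finset.range (N + 2), f n :=
        Finset.sum_le_sum_of_subset_of_nonneg (Finset.range_mono (by omega)) fun _ _ _ => hf0 _
    _ ≤ ∑ n ∈ Finset.range (N + 2), (1 / e * (r n * (n : ℝ) ^ e / n) +
        if n ∈ W.primeFactors then f n else 0) := Finset.sum_le_sum fun n _ => hfle n
    _ = 1 / e * ∑ n ∈ Finset.range (N + 2), (r n * (n : ℝ) ^ e / n) +
        ∑ n ∈ Finset.range (N + 2), if n ∈ W.primeFactors then f n else 0 := by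
      rw [Finset.sum_add_distrib, Finset.mul_sum]
    _ ≤ _ := by
      gcongr
      · have : Finset.range (N + 2) = insert 0 (Finset.Ioc 0 (N + 1)) := by
          ext x
          simp
          omega
        rw [this, Finset.sum_insert (by simp)]
        simpa using hB (N + 1) (by omega)
      · rw [← Finset.sum_filter]
        refine Finset.sum_le_sum_of_subset_of_nonneg ?_ fun _ _ _ => hf0 _
        intro x hx
        exact (Finset.mem_filter.1 hx).2

open ArithmeticFunction in
theorem pmul_log_mul (f g : ArithmeticFunction ℝ) :
    (f * g).pmul log = f.pmul log * g + f * g.pmul log := by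
  ext n
  simp only [pmul_apply, ArithmeticFunction.add_apply, mul_apply, log_apply, Finset.sum_mul,
    ← Finset.sum_add_distrib]
  refine Finset.sum_congr rfl fun x hx => ?_
  have hx' := Nat.mem_divisorsAntidiagonal.1 hx
  have h1 : (x.1 : ℝ) ≠ 0 := by
    rintro h
    rw [Nat.cast_eq_zero] at h
    exact hx'.2 (by rw [← hx'.1, h, zero_mul])
  have h2 : (x.2 : ℝ) ≠ 0 := by
    rintro h
    rw [Nat.cast_eq_zero] at h
    exact hx'.2 (by rw [← hx'.1, h, mul_zero])
  rw [← hx'.1, Nat.cast_mul, Real.log_mul h1 h2]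
  ring

theorem nsmul_apply_eq_mul (k : ℕ) (f : ArithmeticFunction ℝ) (n : ℕ) :
    (k • f) n = k * f n := by
  induction k with
  | zero => simp
  | succ k ih => rw [succ_nsmul, ArithmeticFunction.add_apply, ih, Nat.cast_succ, add_one_mul]

open ArithmeticFunction in
theorem goodInd_pow_pmul_log (m W k : ℕ) :
    (goodInd ℝ m W ^ k).pmul log =
      k • (goodInd ℝ m W ^ k * (goodInd ℝ m W).pmul vonMangoldt) := by
  set s := goodInd ℝ m W with hs
  have hD : s.pmul log = s.pmul vonMangoldt * s := by
    have h1 : s.pmul (zeta : ArithmeticFunction ℝ) = s := pmul_zeta s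
    conv_rhs => rw [← h1]
    rw [← vonMangoldt_mul_zeta, ← pmul_mul_pmul_of_map_mul (goodInd_map_mul ℝ m W), h1]
  induction k with
  | zero =>
    ext n
    rw [pow_zero, zero_smul, pmul_apply, one_apply]
    split_ifs with h <;> simp [h]
  | succ k ih =>
    rw [pow_succ, pmul_log_mul, ih, hD, succ_nsmul, smul_mul_assoc]
    congr 1
    · congr 1
      ring
    · ring

open ArithmeticFunction Finset in
theorem exists_sum_vonMangoldt_mul_rpow_le {δ : ℝ} (hδ0 : 0 < δ) :
    ∃ K : ℝ, 0 ≤ K ∧ ∀ N : ℕ,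
      ∑ d ∈ Ioc 0 N, vonMangoldt d * ((N / d : ℕ) : ℝ) ^ (1 - δ) ≤ K * N := by
  have hsum : Summable fun k : ℕ => (k : ℝ) ^ (-(1 + δ)) :=
    Real.summable_nat_rpow.2 (by linarith)
  have hψ : ∀ N : ℕ, ∑ d ∈ Ioc 0 N, vonMangoldt d ≤ (Real.log 4 + 4) * N := by
    intro N
    have := Chebyshev.psi_le_const_mul_self (x := N) (Nat.cast_nonneg _)
    simpa [Chebyshev.psi] using this
  have hl : 0 ≤ Real.log 4 + 4 := by positivity
  refine ⟨(Real.log 4 + 4) * ∑' k : ℕ, (k : ℝ) ^ (-(1 + δ)),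
    mul_nonneg hl (tsum_nonneg fun k => by positivity), fun N => ?_⟩
  let e : ArithmeticFunction ℝ := ⟨fun k => if k = 0 then 0 else (k : ℝ) ^ (-δ), by simp⟩
  have he : ∀ k : ℕ, k ≠ 0 → e k = (k : ℝ) ^ (-δ) := fun k hk => if_neg hk
  calc ∑ d ∈ Ioc 0 N, vonMangoldt d * ((N / d : ℕ) : ℝ) ^ (1 - δ)
      ≤ ∑ d ∈ Ioc 0 N, vonMangoldt d * ∑ k ∈ Ioc 0 (N / d), e k := by
        refine Finset.sum_le_sum fun d hd => mul_le_mul_of_nonneg_left ?_ vonMangoldt_nonneg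
        have hd' := mem_Ioc.1 hd
        have hpos : 0 < N / d := Nat.div_pos hd'.2 hd'.1
        have hpos' : (0 : ℝ) < (N / d : ℕ) := by exact_mod_cast hpos
        calc (((N / d : ℕ) : ℝ)) ^ (1 - δ) =
              ∑ _k ∈ Ioc 0 (N / d), ((N / d : ℕ) : ℝ) ^ (-δ) := by
              rw [sum_const, Nat.card_Ioc, nsmul_eq_mul, Nat.sub_zero, sub_eq_add_neg,
                Real.rpow_add hpos', Real.rpow_one]
          _ ≤ _ := by
              refine Finset.sum_le_sum fun k hk => ?_
              have hk' := mem_Ioc.1 hk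
              rw [he k (by omega)]
              refine Real.rpow_le_rpow_of_nonpos (by exact_mod_cast hk'.1)
                (by exact_mod_cast hk'.2) (by linarith)
    _ = ∑ n ∈ Ioc 0 N, (vonMangoldt * e) n := (sum_Ioc_mul_eq_sum_sum _ _ _).symm
    _ = ∑ n ∈ Ioc 0 N, (e * vonMangoldt) n := by rw [mul_comm]
    _ = ∑ k ∈ Ioc 0 N, e k * ∑ d ∈ Ioc 0 (N / k), vonMangoldt d := sum_Ioc_mul_eq_sum_sum _ _ _
    _ ≤ ∑ k ∈ Ioc 0 N, (Real.log 4 + 4) * N * (k : ℝ) ^ (-(1 + δ)) := by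
        refine Finset.sum_le_sum fun k hk => ?_
        have hk' := mem_Ioc.1 hk
        have hk0 : (0 : ℝ) < k := by exact_mod_cast hk'.1
        rw [he k (by omega)]
        calc _ ≤ (k : ℝ) ^ (-δ) * ((Real.log 4 + 4) * (N / k : ℝ)) := by
              gcongr
              refine (hψ _).trans ?_
              gcongr
              exact Nat.cast_div_le
          _ = _ := by
              rw [neg_add, Real.rpow_add hk0, Real.rpow_neg_one]
              ring
    _ = (Real.log 4 + 4) * N * ∑ k ∈ Ioc 0 N, (k : ℝ) ^ (-(1 + δ)) := by rw [mul_sum]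
    _ ≤ (Real.log 4 + 4) * N * ∑' k : ℕ, (k : ℝ) ^ (-(1 + δ)) := by
        gcongr
        exact hsum.sum_le_tsum _ fun k _ => by positivity
    _ = _ := by ring

open ArithmeticFunction Finset in
theorem exists_goodInd_mertens (m W : ℕ) [NeZero m] [NeZero W] (h : m ∣ W) :
    ∃ C : ℝ, 0 ≤ C ∧ ∀ N : ℕ, 1 ≤ N →
      |m.totient * ∑ d ∈ Ioc 0 N, goodInd ℝ m W d * vonMangoldt d / d - Real.log N| ≤ C := by
  obtain ⟨κ, C, δ, hκ, hC, hδ0, hδ1, hR⟩ := exists_abs_sum_goodInd_pow_sub_le m W h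
  obtain ⟨K, hK0, hK⟩ := exists_sum_vonMangoldt_mul_rpow_le hδ0
  set r := goodInd ℝ m W ^ m.totient with hr
  set L := (goodInd ℝ m W).pmul vonMangoldt with hL
  have hr0 : ∀ n, 0 ≤ r n := goodInd_pow_nonneg _ _ _
  have hL0 : ∀ n, 0 ≤ L n := fun n => mul_nonneg (goodInd_nonneg _ _ _) vonMangoldt_nonneg
  have hLΛ : ∀ n, L n ≤ vonMangoldt n := fun n => by
    refine mul_le_of_le_one_left vonMangoldt_nonneg ?_
    rcases goodInd_mem m W n with h | h <;> norm_num [h]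
  set R : ℕ → ℝ := fun N => ∑ n ∈ Ioc 0 N, r n with hRdef
  have hRle : ∀ N : ℕ, R N ≤ (κ + C) * N := by
    intro N
    rcases Nat.eq_zero_or_pos N with rfl | hN
    · simp [hRdef]
    have h1 := (abs_le.1 (hR N hN)).2
    have hN' : (1 : ℝ) ≤ N := by exact_mod_cast hN
    have h2 : (N : ℝ) ^ (1 - δ) ≤ N := by
      conv_rhs => rw [← Real.rpow_one (N : ℝ)]
      exact Real.rpow_le_rpow_of_exponent_le hN' (by linarith)
    have h3 := mul_le_mul_of_nonneg_left h2 hC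
    simp only [hRdef]
    linarith
  have hU0 : ∀ N : ℕ, 0 ≤ ∑ n ∈ Ioc 0 N, r n * (Real.log N - Real.log n) := by
    intro N
    refine Finset.sum_nonneg fun n hn => mul_nonneg (hr0 n) (sub_nonneg.2 ?_)
    have hn' := mem_Ioc.1 hn
    exact Real.log_le_log (by exact_mod_cast hn'.1) (by exact_mod_cast hn'.2)
  have hU : ∀ N : ℕ, ∑ n ∈ Ioc 0 N, r n * (Real.log N - Real.log n) ≤ (κ + C) * N := by
    intro N
    induction N with
    | zero => simp
    | succ N ih =>
      rw [Finset.sum_Ioc_succ_top (Nat.zero_le _), sub_self, mul_zero, add_zero]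
      rcases Nat.eq_zero_or_pos N with rfl | hN
      · simp
        positivity
      have hN' : (0 : ℝ) < N := by exact_mod_cast hN
      have h1 : Real.log ((N + 1 : ℕ) : ℝ) - Real.log N ≤ 1 / N := by
        rw [← Real.log_div (by positivity) hN'.ne']
        refine (Real.log_le_sub_one_of_pos (by positivity)).trans (le_of_eq ?_)
        push_cast
        field_simp
        ring
      have h2 : ∑ n ∈ Ioc 0 N, r n * (Real.log ((N + 1 : ℕ) : ℝ) - Real.log n) =
          ∑ n ∈ Ioc 0 N, r n * (Real.log N - Real.log n) +
            R N * (Real.log ((N + 1 : ℕ) : ℝ) - Real.log N) := by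
        simp only [hRdef]
        rw [Finset.sum_mul, ← Finset.sum_add_distrib]
        exact Finset.sum_congr rfl fun n _ => by ring
      have h3 : R N * (Real.log ((N + 1 : ℕ) : ℝ) - Real.log N) ≤ κ + C := by
        have hRN : 0 ≤ R N := Finset.sum_nonneg fun n _ => hr0 n
        calc _ ≤ R N * (1 / N) := by gcongr
          _ ≤ (κ + C) * N * (1 / N) := by gcongr; exact hRle N
          _ = _ := by field_simp
      rw [h2, Nat.cast_succ N, mul_add_one]
      rw [Nat.cast_succ] at h3
      linarith
  have hT : ∀ N : ℕ, ∑ n ∈ Ioc 0 N, r n * Real.log n =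
      m.totient * ∑ d ∈ Ioc 0 N, L d * R (N / d) := by
    intro N
    have h1 := goodInd_pow_pmul_log m W m.totient
    rw [← hr, ← hL, mul_comm r L] at h1
    rw [← sum_Ioc_mul_eq_sum_sum L r N, Finset.mul_sum]
    refine Finset.sum_congr rfl fun n _ => ?_
    have h2 := congrArg (fun f => f n) h1
    rw [nsmul_apply_eq_mul] at h2
    rw [← h2, pmul_apply, log_apply]
  have h2 : ∀ N : ℕ, |∑ d ∈ Ioc 0 N, L d * R (N / d) - κ * N * ∑ d ∈ Ioc 0 N, L d / d| ≤
      (C * K + κ * (Real.log 4 + 4)) * N := by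
    intro N
    have hψ : ∑ d ∈ Ioc 0 N, vonMangoldt d ≤ (Real.log 4 + 4) * N := by
      have := Chebyshev.psi_le_const_mul_self (x := N) (Nat.cast_nonneg _)
      simpa [Chebyshev.psi] using this
    rw [Finset.mul_sum, ← Finset.sum_sub_distrib]
    refine (abs_sum_le_sum_abs _ _).trans ?_
    calc _ ≤ ∑ d ∈ Ioc 0 N, (C * (vonMangoldt d * ((N / d : ℕ) : ℝ) ^ (1 - δ)) +
          κ * vonMangoldt d) := by
          refine Finset.sum_le_sum fun d hd => ?_
          have hd' := mem_Ioc.1 hd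
          have hd0 : (0 : ℝ) < d := by exact_mod_cast hd'.1
          have hpos : 0 < N / d := Nat.div_pos hd'.2 hd'.1
          have e1 := hR (N / d) hpos
          have e2 : ((N / d : ℕ) : ℝ) ≤ N / d := Nat.cast_div_le
          have e3 : (N / d : ℝ) ≤ (N / d : ℕ) + 1 := by
            rw [div_le_iff₀ hd0]
            have := Nat.lt_div_mul_add (a := N) hd'.1
            have h' : (N : ℝ) ≤ (N / d : ℕ) * d + d := by exact_mod_cast this.le
            linarith
          have e4 : |R (N / d) - κ * (N / d)| ≤ C * ((N / d : ℕ) : ℝ) ^ (1 - δ) + κ := by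
            have : R (N / d) - κ * (N / d) = (R (N / d) - κ * (N / d : ℕ)) +
              κ * ((N / d : ℕ) - N / d) := by ring
            rw [this]
            refine (abs_add_le _ _).trans (add_le_add e1 ?_)
            rw [abs_mul, abs_of_pos hκ]
            refine mul_le_of_le_one_right hκ.le (abs_le.2 ⟨?_, ?_⟩) <;> linarith
          have e5 : L d * R (N / d) - κ * N * (L d / d) = L d * (R (N / d) - κ * (N / d)) := by
            ring
          rw [e5, abs_mul, abs_of_nonneg (hL0 d)]
          have e6 : 0 ≤ C * ((N / d : ℕ) : ℝ) ^ (1 - δ) + κ := by positivity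
          calc _ ≤ vonMangoldt d * (C * ((N / d : ℕ) : ℝ) ^ (1 - δ) + κ) :=
                mul_le_mul (hLΛ d) e4 (abs_nonneg _) vonMangoldt_nonneg
            _ = _ := by ring
      _ = C * ∑ d ∈ Ioc 0 N, vonMangoldt d * ((N / d : ℕ) : ℝ) ^ (1 - δ) +
          κ * ∑ d ∈ Ioc 0 N, vonMangoldt d := by
          rw [Finset.sum_add_distrib, ← Finset.mul_sum, ← Finset.mul_sum]
      _ ≤ C * (K * N) + κ * ((Real.log 4 + 4) * N) := by
          gcongr
          exact hK N
      _ = _ := by ring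
  set B := (C * K + κ * (Real.log 4 + 4)) with hB
  have hB0 : 0 ≤ B := by positivity
  refine ⟨(m.totient * B + (κ + C) + C / δ) / κ, by positivity, fun N hN => ?_⟩
  have hN' : (1 : ℝ) ≤ N := by exact_mod_cast hN
  have hN0 : (0 : ℝ) < N := by linarith
  have a1 := abs_le.1 (h2 N)
  have a2 := hT N
  have a3 := hU N
  have a4 := hU0 N
  have a5 : ∑ n ∈ Ioc 0 N, r n * (Real.log N - Real.log n) =
      R N * Real.log N - ∑ n ∈ Ioc 0 N, r n * Real.log n := by
    simp only [hRdef]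
    rw [Finset.sum_mul, ← Finset.sum_sub_distrib]
    exact Finset.sum_congr rfl fun n _ => by ring
  have hlog : 0 ≤ Real.log N := Real.log_nonneg hN'
  have a6 : |R N * Real.log N - κ * N * Real.log N| ≤ C / δ * N := by
    rw [← sub_mul, abs_mul, abs_of_nonneg hlog]
    calc _ ≤ C * (N : ℝ) ^ (1 - δ) * ((N : ℝ) ^ δ / δ) := by
          have := Real.log_le_rpow_div hN0.le hδ0
          have := hR N hN
          gcongr
      _ = C / δ * ((N : ℝ) ^ (1 - δ) * (N : ℝ) ^ δ) := by ring
      _ = _ := by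
        rw [← Real.rpow_add hN0, sub_add_cancel, Real.rpow_one]
  have a6' := abs_le.1 a6
  have hφ : (0 : ℝ) ≤ m.totient := Nat.cast_nonneg _
  set S := ∑ d ∈ Ioc 0 N, L d / d with hS
  set V := ∑ d ∈ Ioc 0 N, L d * R (N / d) with hV
  have b1 := mul_le_mul_of_nonneg_left a1.1 hφ
  have b2 := mul_le_mul_of_nonneg_left a1.2 hφ
  have key : |κ * N * (m.totient * S - Real.log N)| ≤ (m.totient * B + (κ + C) + C / δ) * N := by
    rw [abs_le]
    constructor <;> nlinarith
  change |m.totient * S - Real.log N| ≤ _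
  rw [abs_mul, abs_of_pos (mul_pos hκ hN0)] at key
  rw [le_div_iff₀ hκ]
  refine le_of_mul_le_mul_right ?_ hN0
  linarith

open ArithmeticFunction Finset in
theorem exists_sum_prime_div_block_le (m W : ℕ) [NeZero m] [NeZero W] (h : m ∣ W) :
    ∃ C : ℝ, 0 ≤ C ∧ ∀ (A B : ℕ) (u v : ℝ), 1 ≤ A → A ≤ B → 0 < u → u ≤ Real.log (A + 1) →
      Real.log B ≤ v →
      m.totient * ∑ l ∈ Ioc A B, (if l.Prime then goodInd ℝ m W l / l else 0) ≤
        (v - u + C) / u := by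
  obtain ⟨C, hC0, hC⟩ := exists_goodInd_mertens m W h
  refine ⟨2 * C + 1, by positivity, fun A B u v hA hAB hu huA hBv => ?_⟩
  have hA' : (1 : ℝ) ≤ A := by exact_mod_cast hA
  have h1 := (abs_le.1 (hC A hA)).1
  have h2 := (abs_le.1 (hC B (hA.trans hAB))).2
  have h3 : ∑ d ∈ Ioc 0 B, goodInd ℝ m W d * vonMangoldt d / d =
      ∑ d ∈ Ioc 0 A, goodInd ℝ m W d * vonMangoldt d / d +
      ∑ d ∈ Ioc A B, goodInd ℝ m W d * vonMangoldt d / d :=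
    (sum_Ioc_consecutive _ (Nat.zero_le _) hAB).symm
  have h4 : Real.log (A + 1) ≤ Real.log A + 1 := by
    rw [← sub_le_iff_le_add', ← Real.log_div (by positivity) (by positivity)]
    refine (Real.log_le_sub_one_of_pos (by positivity)).trans ?_
    rw [sub_le_iff_le_add, div_le_iff₀ (by positivity)]
    linarith
  have hφ : (0 : ℝ) ≤ m.totient := Nat.cast_nonneg _
  have h5 : (∑ l ∈ Ioc A B, (if l.Prime then goodInd ℝ m W l / l else 0)) * u ≤
      ∑ d ∈ Ioc A B, goodInd ℝ m W d * vonMangoldt d / d := by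
    rw [Finset.sum_mul]
    refine Finset.sum_le_sum fun l hl => ?_
    have hl' := mem_Ioc.1 hl
    have hg := goodInd_nonneg m W l
    split_ifs with hp
    · rw [vonMangoldt_apply_prime hp, div_mul_eq_mul_div]
      have : u ≤ Real.log l := huA.trans (Real.log_le_log (by positivity)
        (by exact_mod_cast hl'.1))
      gcongr
    · rw [zero_mul]
      have := vonMangoldt_nonneg (n := l)
      positivity
  rw [le_div_iff₀ hu]
  have h6 := mul_le_mul_of_nonneg_left h5 hφ
  rw [h3] at h2
  linarith

open ArithmeticFunction Finset in
theorem exists_sum_prime_div_le (m W : ℕ) [NeZero m] [NeZero W] (h : m ∣ W) :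
    ∃ p₀ : ℕ, ∀ p : ℕ, p₀ ≤ p →
      m.totient * ∑ l ∈ Ioc (p - 1) ⌊(p : ℝ) ^ (1.57 : ℝ)⌋₊,
        (if l.Prime then goodInd ℝ m W l / l else 0) ≤ 0.49 := by
  obtain ⟨C, hC0, hC⟩ := exists_sum_prime_div_block_le m W h
  have hlog : ∀ᶠ p : ℕ in Filter.atTop, 2000 * (C + 1) ≤ Real.log p :=
    (Real.tendsto_log_atTop.comp tendsto_natCast_atTop_atTop).eventually_ge_atTop _
  obtain ⟨p₀, hp₀⟩ := Filter.eventually_atTop.1 hlog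
  refine ⟨max p₀ 2, fun p hp => ?_⟩
  have hL := hp₀ p (le_of_max_le_left hp)
  have hp2 : 2 ≤ p := le_of_max_le_right hp
  have hp1 : (1 : ℝ) ≤ p := by exact_mod_cast (by omega : 1 ≤ p)
  set L := Real.log p with hLdef
  have hL0 : 0 < L := by linarith
  have hb : ∀ θ : ℝ, 1 ≤ θ → 1 ≤ ⌊(p : ℝ) ^ θ⌋₊ ∧ θ * L ≤ Real.log (⌊(p : ℝ) ^ θ⌋₊ + 1) ∧
      Real.log ⌊(p : ℝ) ^ θ⌋₊ ≤ θ * L := by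
    intro θ hθ
    have e0 : 1 ≤ (p : ℝ) ^ θ := Real.one_le_rpow hp1 (by linarith)
    have e1 : 1 ≤ ⌊(p : ℝ) ^ θ⌋₊ := Nat.one_le_floor_iff _ |>.2 e0
    refine ⟨e1, ?_, ?_⟩
    · rw [hLdef, ← Real.log_rpow (by linarith)]
      exact Real.log_le_log (by linarith) (Nat.lt_floor_add_one _).le
    · rw [hLdef, ← Real.log_rpow (by linarith)]
      exact Real.log_le_log (by exact_mod_cast e1) (Nat.floor_le (by linarith))
  have hmono : ∀ a b : ℝ, a ≤ b → ⌊(p : ℝ) ^ a⌋₊ ≤ ⌊(p : ℝ) ^ b⌋₊ := fun a b hab =>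
    Nat.floor_le_floor (Real.rpow_le_rpow_of_exponent_le hp1 hab)
  obtain ⟨a1, a2, a3⟩ := hb 1.19 (by norm_num)
  obtain ⟨b1, b2, b3⟩ := hb 1.38 (by norm_num)
  obtain ⟨c1, c2, c3⟩ := hb 1.57 (by norm_num)
  have hab := hmono 1.19 1.38 (by norm_num)
  have hbc := hmono 1.38 1.57 (by norm_num)
  have hpa : p - 1 ≤ ⌊(p : ℝ) ^ (1.19 : ℝ)⌋₊ := by
    have := hmono 1 1.19 (by norm_num)
    rw [Real.rpow_one, Nat.floor_natCast] at this
    omega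
  have s1 := hC (p - 1) _ L (1.19 * L) (by omega) hpa hL0 (by
    have : ((p - 1 : ℕ) : ℝ) + 1 = p := by
      rw [Nat.cast_sub (by omega)]; simp
    rw [this]) a3
  have s2 := hC _ _ (1.19 * L) (1.38 * L) a1 hab (by positivity) a2 b3
  have s3 := hC _ _ (1.38 * L) (1.57 * L) b1 hbc (by positivity) b2 c3
  rw [← sum_Ioc_consecutive _ hpa (hab.trans hbc), ← sum_Ioc_consecutive _ hab hbc, mul_add,
    mul_add]
  have t1 : (1.19 * L - L + C) / L ≤ 0.1905 := by
    rw [div_le_iff₀ hL0]; linarith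
  have t2 : (1.38 * L - 1.19 * L + C) / (1.19 * L) ≤ 0.1605 := by
    rw [div_le_iff₀ (by positivity)]; linarith
  have t3 : (1.57 * L - 1.38 * L + C) / (1.38 * L) ≤ 0.1385 := by
    rw [div_le_iff₀ (by positivity)]; linarith
  linarith

theorem goodInd_pow_isMultiplicative (m W k : ℕ) : (goodInd ℝ m W ^ k).IsMultiplicative := by
  have h := isMultiplicative_of_map_mul (goodInd_map_mul ℝ m W) (goodInd_one ℝ m W)
  induction k with
  | zero => rw [pow_zero]; exact ArithmeticFunction.isMultiplicative_one
  | succ k ih => rw [pow_succ]; exact ih.mul h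

theorem goodInd_eq_one_of_pow_ne_zero {m W k n : ℕ} (hn : n ≠ 1) (hk : (goodInd ℝ m W ^ k) n ≠ 0) :
    goodInd ℝ m W n = 1 := by
  set s := goodInd ℝ m W with hs
  have hss : s.pmul s = s := by
    ext n
    rw [ArithmeticFunction.pmul_apply]
    rcases goodInd_mem m W n with h | h <;> simp [hs, h]
  have key : ∀ j, s.pmul (s ^ (j + 1)) = s ^ (j + 1) := by
    intro j
    induction j with
    | zero => rw [zero_add, pow_one, hss]
    | succ j ih =>
      rw [pow_succ, ← pmul_mul_pmul_of_map_mul (goodInd_map_mul ℝ m W), ih, hss]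
  rcases goodInd_mem m W n with h | h
  · exfalso
    rcases k with _ | k
    · rw [pow_zero, ArithmeticFunction.one_apply_ne hn] at hk
      exact hk rfl
    · rw [← key k, ArithmeticFunction.pmul_apply, hs, h, zero_mul] at hk
      exact hk rfl
  · exact h

theorem exists_prime_dvd_map_ne_one {f : ℕ → ℝ} (hf1 : f 1 = 1)
    (hf : ∀ a b, f (a * b) = f a * f b) {n : ℕ} (hn : n ≠ 0) (h : f n ≠ 1) :
    ∃ l, l.Prime ∧ l ∣ n ∧ f l ≠ 1 := by
  induction n using Nat.recOnMul with
  | zero => exact absurd rfl hn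
  | one => exact absurd hf1 h
  | prime p hp => exact ⟨p, hp, dvd_rfl, h⟩
  | mul a b ha hb =>
    by_cases h1 : f a = 1
    · have h2 : f b ≠ 1 := fun h2 => h (by rw [hf, h1, h2, one_mul])
      obtain ⟨l, hl, hd, hne⟩ := hb (right_ne_zero_of_mul hn) h2
      exact ⟨l, hl, hd.mul_left _, hne⟩
    · obtain ⟨l, hl, hd, hne⟩ := ha (left_ne_zero_of_mul hn) h1
      exact ⟨l, hl, hd.mul_right _, hne⟩

open Finset in
theorem sum_goodInd_pow_mul_one_sub_le (m W : ℕ) {f : ℕ → ℝ} (hf1 : f 1 = 1)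
    (hf : ∀ a b, f (a * b) = f a * f b) (habs : ∀ n, |f n| ≤ 1) {p N : ℕ} (hN : N < p ^ 2)
    (hp : ∀ l < p, l.Prime → goodInd ℝ m W l = 1 → f l = 1) :
    ∑ n ∈ Ioc 0 N, (goodInd ℝ m W ^ m.totient) n * (1 - f n) ≤
      2 * ∑ l ∈ Ioc (p - 1) N, if l.Prime then m.totient * goodInd ℝ m W l *
        ∑ n ∈ Ioc 0 (N / l), (goodInd ℝ m W ^ m.totient) n else 0 := by
  set r := goodInd ℝ m W ^ m.totient with hr
  have hr0 : ∀ n, 0 ≤ r n := goodInd_pow_nonneg _ _ _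
  have hmul : r.IsMultiplicative := goodInd_pow_isMultiplicative m W m.totient
  have step1 : ∀ n ∈ Ioc 0 N, r n * (1 - f n) ≤
      2 * ∑ l ∈ Ioc (p - 1) N, if l.Prime ∧ goodInd ℝ m W l = 1 ∧ l ∣ n then r n else 0 := by
    intro n hn
    have hn' := mem_Ioc.1 hn
    have hnn : 0 ≤ ∑ l ∈ Ioc (p - 1) N,
        if l.Prime ∧ goodInd ℝ m W l = 1 ∧ l ∣ n then r n else 0 :=
      Finset.sum_nonneg fun l _ => by split_ifs; exacts [hr0 n, le_rfl]
    by_cases h1 : f n = 1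
    · rw [h1, sub_self, mul_zero]
      positivity
    by_cases h2 : r n = 0
    · rw [h2, zero_mul]
      rw [h2] at hnn
      linarith
    have hn1 : n ≠ 1 := by rintro rfl; exact h1 hf1
    obtain ⟨l, hl, ⟨k, rfl⟩, hne⟩ := exists_prime_dvd_map_ne_one hf1 hf (by omega : n ≠ 0) h1
    have hg := goodInd_eq_one_of_pow_ne_zero hn1 h2
    rw [goodInd_map_mul] at hg
    have hgl : goodInd ℝ m W l = 1 := by
      rcases goodInd_mem m W l with h | h
      · rw [h, zero_mul] at hg
        exact absurd hg zero_ne_one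
      · exact h
    have hpl : p ≤ l := by
      by_contra hlt
      exact hne (hp l (by omega) hl hgl)
    have hlN : l ≤ N := (Nat.le_of_dvd hn'.1 (dvd_mul_right _ _)).trans hn'.2
    have hmem : l ∈ Ioc (p - 1) N := mem_Ioc.2 ⟨by have := hl.pos; omega, hlN⟩
    have h3 := single_le_sum (f := fun l' => if l'.Prime ∧ goodInd ℝ m W l' = 1 ∧ l' ∣ l * k
      then r (l * k) else 0) (fun i _ => by split_ifs; exacts [hr0 _, le_rfl]) hmem
    simp only [if_pos (show l.Prime ∧ goodInd ℝ m W l = 1 ∧ l ∣ l * k from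
      ⟨hl, hgl, dvd_mul_right _ _⟩)] at h3
    have h4 := (abs_le.1 (habs (l * k))).1
    have h5 := hr0 (l * k)
    nlinarith
  refine (Finset.sum_le_sum step1).trans ?_
  rw [← Finset.mul_sum, Finset.sum_comm]
  refine mul_le_mul_of_nonneg_left (Finset.sum_le_sum fun l hl => ?_) (by norm_num)
  have hl' := mem_Ioc.1 hl
  split_ifs with hlp
  swap
  · refine (Finset.sum_eq_zero fun n _ => if_neg fun h => hlp h.1).le
  rcases goodInd_mem m W l with hg | hg
  · rw [hg, mul_zero, zero_mul]
    refine (Finset.sum_eq_zero fun n _ => if_neg fun h => ?_).le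
    exact zero_ne_one h.2.1
  have hNl : N / l < l := by
    rw [Nat.div_lt_iff_lt_mul hlp.pos]
    refine hN.trans_le ?_
    rw [sq]
    exact Nat.mul_le_mul (by omega) (by omega)
  rw [← Finset.sum_filter, Finset.mul_sum]
  have himg : (Ioc 0 N).filter (fun n => l.Prime ∧ goodInd ℝ m W l = 1 ∧ l ∣ n) =
      (Ioc 0 (N / l)).image (l * ·) := by
    ext n
    simp only [mem_filter, mem_Ioc, mem_image]
    constructor
    · rintro ⟨⟨h1, h2⟩, -, -, k, rfl⟩
      refine ⟨k, ⟨Nat.pos_of_mul_pos_left h1, ?_⟩, rfl⟩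
      rwa [Nat.le_div_iff_mul_le hlp.pos, mul_comm]
    · rintro ⟨k, ⟨h1, h2⟩, rfl⟩
      refine ⟨⟨Nat.mul_pos hlp.pos h1, ?_⟩, hlp, hg, dvd_mul_right _ _⟩
      rwa [Nat.le_div_iff_mul_le hlp.pos, mul_comm] at h2
  rw [himg, Finset.sum_image fun a _ b _ h => Nat.eq_of_mul_eq_mul_left hlp.pos h]
  refine Finset.sum_le_sum fun k hk => le_of_eq ?_
  have hk' := mem_Ioc.1 hk
  have hcop : l.Coprime k := (Nat.Prime.coprime_iff_not_dvd hlp).2 fun hd =>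
    absurd (Nat.le_of_dvd hk'.1 hd) (by omega)
  rw [hmul.map_mul_of_coprime hcop, hr, goodInd_pow_prime _ _ _ _ hlp]

open Finset ArithmeticFunction in
theorem exists_le_sum_goodInd_pow_mul (m W : ℕ) [NeZero m] [NeZero W] (h : m ∣ W) :
    ∃ η : ℝ, 0 < η ∧ ∃ p₀ : ℕ, ∀ (f : ℕ → ℝ), f 1 = 1 → (∀ a b, f (a * b) = f a * f b) →
      (∀ n, |f n| ≤ 1) → ∀ p : ℕ, p₀ ≤ p →
      (∀ l < p, l.Prime → goodInd ℝ m W l = 1 → f l = 1) →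
      η * ⌊(p : ℝ) ^ (1.57 : ℝ)⌋₊ ≤
        ∑ n ∈ Ioc 0 ⌊(p : ℝ) ^ (1.57 : ℝ)⌋₊, (goodInd ℝ m W ^ m.totient) n * f n := by
  obtain ⟨κ, C, δ, hκ, hC, hδ0, hδ1, hR⟩ := exists_abs_sum_goodInd_pow_sub_le m W h
  obtain ⟨K, hK0, hK⟩ := exists_sum_vonMangoldt_mul_rpow_le hδ0
  obtain ⟨p₁, hp₁⟩ := exists_sum_prime_div_le m W h
  have hev : ∀ᶠ p : ℕ in Filter.atTop, 1 ≤ Real.log p ∧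
      800 * (m.totient * C * K) / κ ≤ Real.log p ∧ 200 * C / κ ≤ (p : ℝ) ^ δ := by
    have t1 := Real.tendsto_log_atTop.comp (tendsto_natCast_atTop_atTop (R := ℝ))
    have t2 := (tendsto_rpow_atTop hδ0).comp (tendsto_natCast_atTop_atTop (R := ℝ))
    filter_upwards [t1.eventually_ge_atTop 1,
      t1.eventually_ge_atTop (800 * (m.totient * C * K) / κ),
      t2.eventually_ge_atTop (200 * C / κ)] with p h1 h2 h3
    exact ⟨h1, h2, h3⟩
  obtain ⟨p₂, hp₂⟩ := Filter.eventually_atTop.1 hev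
  refine ⟨κ / 100, by positivity, max (max p₁ p₂) 2, fun f hf1 hf habs p hp hgood => ?_⟩
  have hpp1 : p₁ ≤ p := le_of_max_le_left (le_of_max_le_left hp)
  have hpp2 : p₂ ≤ p := le_of_max_le_right (le_of_max_le_left hp)
  have hp2 : 2 ≤ p := le_of_max_le_right hp
  obtain ⟨hL1, hL2, hpδ⟩ := hp₂ p hpp2
  have hp1 : (1 : ℝ) < p := by exact_mod_cast hp2
  have hS := hp₁ p hpp1
  set N := ⌊(p : ℝ) ^ (1.57 : ℝ)⌋₊ with hNdef
  have hNp : p ≤ N := by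
    refine Nat.le_floor ?_
    conv_lhs => rw [← Real.rpow_one (p : ℝ)]
    exact Real.rpow_le_rpow_of_exponent_le hp1.le (by norm_num)
  have hNp2 : N < p ^ 2 := by
    rw [hNdef, Nat.floor_lt (by positivity)]
    push_cast
    rw [← Real.rpow_two]
    exact Real.rpow_lt_rpow_of_exponent_lt hp1 (by norm_num)
  have hN1 : 1 ≤ N := by omega
  have hN0 : (0 : ℝ) < N := by exact_mod_cast hN1
  have key := sum_goodInd_pow_mul_one_sub_le m W hf1 hf habs hNp2 hgood
  set r := goodInd ℝ m W ^ m.totient with hr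
  have hRN := (abs_le.1 (hR N hN1)).1
  have hCN : C * (N : ℝ) ^ (1 - δ) ≤ κ / 200 * N := by
    have e1 : 200 * C / κ ≤ (N : ℝ) ^ δ := hpδ.trans (by gcongr)
    rw [Real.rpow_sub hN0, Real.rpow_one]
    have e2 : 0 < (N : ℝ) ^ δ := by positivity
    rw [div_le_iff₀ hκ] at e1
    rw [mul_div_assoc', div_le_iff₀ e2]
    nlinarith
  have hR' : ∀ l ∈ Ioc (p - 1) N, (if l.Prime then m.totient * goodInd ℝ m W l *
        ∑ n ∈ Ioc 0 (N / l), r n else 0) ≤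
      κ * N * (m.totient * (if l.Prime then goodInd ℝ m W l / l else 0)) +
      m.totient * C / Real.log p * (vonMangoldt l * ((N / l : ℕ) : ℝ) ^ (1 - δ)) := by
    intro l hl
    have hl' := mem_Ioc.1 hl
    have hl0 : 0 < l := by omega
    have hΛ := vonMangoldt_nonneg (n := l)
    split_ifs with hlp
    swap
    · rw [mul_zero, mul_zero, zero_add]
      positivity
    have hpos : 0 < N / l := Nat.div_pos hl'.2 hl0
    have e1 := (abs_le.1 (hR (N / l) hpos)).2
    have e2 : ((N / l : ℕ) : ℝ) ≤ N / l := Nat.cast_div_le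
    have hg0 := goodInd_nonneg m W l
    have hg1 : goodInd ℝ m W l ≤ 1 := by
      rcases goodInd_mem m W l with h | h <;> norm_num [h]
    have e3 : Real.log p ≤ Real.log l := Real.log_le_log (by positivity)
      (by exact_mod_cast (by omega : p ≤ l))
    rw [vonMangoldt_apply_prime hlp]
    have e4 : ∑ n ∈ Ioc 0 (N / l), r n ≤ κ * (N / l) + C * ((N / l : ℕ) : ℝ) ^ (1 - δ) := by
      have := mul_le_mul_of_nonneg_left e2 hκ.le
      linarith
    calc _ ≤ m.totient * goodInd ℝ m W l *
          (κ * (N / l) + C * ((N / l : ℕ) : ℝ) ^ (1 - δ)) := by gcongr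
      _ = κ * N * (m.totient * (goodInd ℝ m W l / l)) +
          m.totient * C * (goodInd ℝ m W l * ((N / l : ℕ) : ℝ) ^ (1 - δ)) := by ring
      _ ≤ κ * N * (m.totient * (goodInd ℝ m W l / l)) +
          m.totient * C * (Real.log l / Real.log p * ((N / l : ℕ) : ℝ) ^ (1 - δ)) := by
          have : goodInd ℝ m W l ≤ Real.log l / Real.log p :=
            hg1.trans ((one_le_div (by linarith)).2 e3)
          gcongr
      _ = _ := by ring
  have hsum := Finset.sum_le_sum hR'
  rw [Finset.sum_add_distrib, ← Finset.mul_sum, ← Finset.mul_sum, ← Finset.mul_sum] at hsum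
  have hsub : ∑ l ∈ Ioc (p - 1) N, vonMangoldt l * ((N / l : ℕ) : ℝ) ^ (1 - δ) ≤ K * N :=
    (Finset.sum_le_sum_of_subset_of_nonneg (Ioc_subset_Ioc_left (Nat.zero_le _))
      fun l _ _ => mul_nonneg vonMangoldt_nonneg (by positivity)).trans (hK N)
  have hB : m.totient * C / Real.log p *
      ∑ l ∈ Ioc (p - 1) N, vonMangoldt l * ((N / l : ℕ) : ℝ) ^ (1 - δ) ≤ κ / 800 * N := by
    calc _ ≤ m.totient * C / Real.log p * (K * N) := by gcongr
      _ = m.totient * C * K / Real.log p * N := by ring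
      _ ≤ _ := by
        refine mul_le_mul_of_nonneg_right ?_ hN0.le
        rw [div_le_iff₀ (by linarith)]
        rw [div_le_iff₀ hκ] at hL2
        linarith
  have hA := mul_le_mul_of_nonneg_left hS (by positivity : 0 ≤ κ * N)
  have hsplit : ∑ n ∈ Ioc 0 N, r n * (1 - f n) =
      ∑ n ∈ Ioc 0 N, r n - ∑ n ∈ Ioc 0 N, r n * f n := by
    rw [← Finset.sum_sub_distrib]
    exact Finset.sum_congr rfl fun n _ => by ring
  rw [hsplit] at key
  have hκN : 0 < κ * N := by positivity
  have k1 := key.trans (mul_le_mul_of_nonneg_left hsum (by norm_num))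
  have k2 := hRN.trans' (neg_le_neg hCN)
  have k3 : κ * N * (0.49 : ℝ) = 49 / 100 * (κ * N) := by ring
  rw [k3] at hA
  have k4 : κ / 100 * N = 1 / 100 * (κ * N) := by ring
  have k5 : κ / 200 * N = 1 / 200 * (κ * N) := by ring
  have k6 : κ / 800 * N = 1 / 800 * (κ * N) := by ring
  rw [k4]
  rw [k5] at k2
  rw [k6] at hB
  generalize κ * (N : ℝ) = x at *
  linarith

theorem qchar_zero (p : ℕ) [Fact p.Prime] : qchar p 0 = 0 := by
  simp [qchar]

theorem sum_range_mul_add (f : ℕ → ℂ) (W K : ℕ) :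
    ∑ i ∈ Finset.range (W * K), f i =
      ∑ b ∈ Finset.range W, ∑ k ∈ Finset.range K, f (b + W * k) := by
  induction K with
  | zero => simp
  | succ K ih =>
    rw [Nat.mul_succ, Finset.sum_range_add, ih, ← Finset.sum_add_distrib]
    refine Finset.sum_congr rfl fun b _ => ?_
    rw [Finset.sum_range_succ, add_comm (W * K)]

open Finset in
/-- A character sum twisted by a periodic function. -/
theorem exists_norm_sum_periodic_mul_qchar_le (W : ℕ) [NeZero W] :
    ∃ p₀ : ℕ, ∀ (p : ℕ) [Fact p.Prime], p₀ ≤ p → ∀ g : ℕ → ℂ, (∀ n, g (n + W) = g n) →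
      (∀ n, ‖g n‖ ≤ 1) → ∀ n : ℕ, 1 ≤ n → n ≤ p ^ 2 →
      ‖∑ b ∈ Ioc 0 n, g b * (qchar p b : ℂ)‖ ≤
        5 * W * ((p : ℝ) ^ (0.26 : ℝ)) ^ (0.00001 : ℝ) * (n : ℝ) ^ (1 - 0.00001 : ℝ) := by
  obtain ⟨p₁, hp₁⟩ := burgess_bound
  refine ⟨max p₁ (W + 1), fun p _ hp g hg hg1 n hn hnp => ?_⟩
  have hpp1 : p₁ ≤ p := le_of_max_le_left hp
  have hpW : W < p := le_of_max_le_right hp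
  have hp0 : (0 : ℝ) < p := by exact_mod_cast (by omega : 0 < p)
  have hp1 : (1 : ℝ) ≤ p := by exact_mod_cast (by omega : 1 ≤ p)
  have hn0 : (0 : ℝ) < n := by exact_mod_cast hn
  have hn1 : (1 : ℝ) ≤ n := by exact_mod_cast hn
  have hW1 : (1 : ℝ) ≤ W := by exact_mod_cast NeZero.one_le
  set Z := (p : ℝ) ^ (0.26 : ℝ) with hZ
  have hZ1 : 1 ≤ Z := Real.one_le_rpow hp1 (by norm_num)
  have hW0 : (W : ZMod p) ≠ 0 := natCast_ne_zero_of_lt (NeZero.pos W) hpW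
  set f : ℕ → ℂ := fun b => g b * (qchar p b : ℂ) with hf
  have hf1 : ∀ b, ‖f b‖ ≤ 1 := fun b => by
    simp only [hf]
    rw [norm_mul, Complex.norm_real, Real.norm_eq_abs]
    exact mul_le_one₀ (hg1 b) (abs_nonneg _) (abs_qchar_le_one _)
  have hf0 : f 0 = 0 := by simp [hf, qchar_zero]
  have hrange : ∑ b ∈ Ioc 0 n, f b = ∑ b ∈ range (n + 1), f b := by
    have : range (n + 1) = insert 0 (Ioc 0 n) := by
      ext x
      simp only [mem_range, mem_insert, mem_Ioc]
      omega
    rw [this, sum_insert (by simp), hf0, zero_add]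
  have hA0 : 1 ≤ Z ^ (0.00001 : ℝ) := Real.one_le_rpow hZ1 (by norm_num)
  have hB0 : 1 ≤ (n : ℝ) ^ (1 - 0.00001 : ℝ) := Real.one_le_rpow hn1 (by norm_num)
  rw [hrange]
  by_cases hZn : (n : ℝ) < Z
  · calc _ ≤ ∑ b ∈ range (n + 1), ‖f b‖ := norm_sum_le _ _
      _ ≤ ∑ b ∈ range (n + 1), (1 : ℝ) := Finset.sum_le_sum fun b _ => hf1 b
      _ = (n : ℝ) + 1 := by simp
      _ ≤ 5 * W * (n : ℝ) := by nlinarith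
      _ = 5 * W * ((n : ℝ) ^ (0.00001 : ℝ) * (n : ℝ) ^ (1 - 0.00001 : ℝ)) := by
          rw [← Real.rpow_add hn0]
          norm_num
      _ ≤ 5 * W * (Z ^ (0.00001 : ℝ) * (n : ℝ) ^ (1 - 0.00001 : ℝ)) := by gcongr
      _ = _ := by ring
  push Not at hZn
  set K := (n + 1) / W with hK
  have hKW : n + 1 = W * K + (n + 1) % W := (Nat.div_add_mod _ _).symm
  have hKn : (K : ℝ) ≤ 2 * n := by
    have : K ≤ n + 1 := Nat.div_le_self _ _
    have : (K : ℝ) ≤ n + 1 := by exact_mod_cast this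
    linarith
  have hgper : ∀ b k, g (b + W * k) = g b := by
    intro b k
    induction k with
    | zero => simp
    | succ k ih => rw [Nat.mul_succ, ← add_assoc, hg, ih]
  have hclass : ∀ b, ‖∑ k ∈ range K, f (b + W * k)‖ ≤ Z + K * (p : ℝ) ^ (-(0.00002 : ℝ)) := by
    intro b
    have e1 : ∑ k ∈ range K, f (b + W * k) =
        g b * qchar p W * ((∑ k ∈ range K, qchar p ((b : ZMod p) / W + k) : ℝ) : ℂ) := by
      rw [Complex.ofReal_sum, mul_sum]
      refine sum_congr rfl fun k _ => ?_
      simp only [hf]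
      have : ((b + W * k : ℕ) : ZMod p) = W * ((b : ZMod p) / W + k) := by
        push_cast
        field_simp
      rw [hgper, this, qchar_mul]
      push_cast
      ring
    have e2 : ‖g b * (qchar p W : ℂ)‖ ≤ 1 := by
      rw [norm_mul, Complex.norm_real, Real.norm_eq_abs]
      exact mul_le_one₀ (hg1 b) (abs_nonneg _) (abs_qchar_le_one _)
    rw [e1, norm_mul, Complex.norm_real, Real.norm_eq_abs]
    refine (mul_le_of_le_one_left (abs_nonneg _) e2).trans ?_
    by_cases hKZ : Z ≤ K
    · exact (hp₁ p hpp1 _ K hKZ).trans (le_add_of_nonneg_left (by linarith))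
    · push Not at hKZ
      calc _ ≤ ∑ k ∈ range K, |qchar p ((b : ZMod p) / W + k)| := abs_sum_le_sum_abs _ _
        _ ≤ ∑ k ∈ range K, (1 : ℝ) := Finset.sum_le_sum fun k _ => abs_qchar_le_one _
        _ = K := by simp
        _ ≤ _ := hKZ.le.trans (le_add_of_nonneg_right (by positivity))
  have hZle : Z ≤ Z ^ (0.00001 : ℝ) * (n : ℝ) ^ (1 - 0.00001 : ℝ) := by
    calc Z = Z ^ (0.00001 : ℝ) * Z ^ (1 - 0.00001 : ℝ) := by
          rw [← Real.rpow_add (by linarith)]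
          norm_num
      _ ≤ _ := by
        gcongr
  have hple : n * (p : ℝ) ^ (-(0.00002 : ℝ)) ≤
      Z ^ (0.00001 : ℝ) * (n : ℝ) ^ (1 - 0.00001 : ℝ) := by
    have e1 : (n : ℝ) ^ (0.00001 : ℝ) ≤ (p : ℝ) ^ (0.00002 : ℝ) := by
      calc (n : ℝ) ^ (0.00001 : ℝ) ≤ ((p : ℝ) ^ (2 : ℝ)) ^ (0.00001 : ℝ) := by
            gcongr
            rw [Real.rpow_two]
            exact_mod_cast hnp
        _ = _ := by
          rw [← Real.rpow_mul hp0.le]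
          norm_num
    calc n * (p : ℝ) ^ (-(0.00002 : ℝ)) =
          (n : ℝ) ^ (1 - 0.00001 : ℝ) * (n : ℝ) ^ (0.00001 : ℝ) *
            (p : ℝ) ^ (-(0.00002 : ℝ)) := by
          rw [← Real.rpow_add hn0]
          norm_num
      _ ≤ (n : ℝ) ^ (1 - 0.00001 : ℝ) * (p : ℝ) ^ (0.00002 : ℝ) *
            (p : ℝ) ^ (-(0.00002 : ℝ)) := by gcongr
      _ = (n : ℝ) ^ (1 - 0.00001 : ℝ) := by
          rw [mul_assoc, ← Real.rpow_add hp0]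
          norm_num
      _ ≤ _ := le_mul_of_one_le_left (by linarith) hA0
  set Y := Z ^ (0.00001 : ℝ) * (n : ℝ) ^ (1 - 0.00001 : ℝ) with hY
  have hY1 : 1 ≤ Y := one_le_mul_of_one_le_of_one_le hA0 hB0
  rw [hKW, sum_range_add, sum_range_mul_add]
  calc _ ≤ ‖∑ b ∈ range W, ∑ k ∈ range K, f (b + W * k)‖ +
        ‖∑ i ∈ range ((n + 1) % W), f (W * K + i)‖ := norm_add_le _ _
    _ ≤ ∑ b ∈ range W, (Z + K * (p : ℝ) ^ (-(0.00002 : ℝ))) +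
        ∑ i ∈ range ((n + 1) % W), (1 : ℝ) := by
        refine add_le_add ((norm_sum_le _ _).trans (Finset.sum_le_sum fun b _ => hclass b))
          ((norm_sum_le _ _).trans (Finset.sum_le_sum fun i _ => hf1 _))
    _ = W * (Z + K * (p : ℝ) ^ (-(0.00002 : ℝ))) + ((n + 1) % W : ℕ) := by simp [mul_add]
    _ ≤ W * (Y + 2 * Y) + W * Y := by
        have h1 : K * (p : ℝ) ^ (-(0.00002 : ℝ)) ≤ 2 * Y := by
          calc _ ≤ 2 * n * (p : ℝ) ^ (-(0.00002 : ℝ)) := by gcongr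
            _ = 2 * (n * (p : ℝ) ^ (-(0.00002 : ℝ))) := by ring
            _ ≤ _ := by linarith
        have h2 : (((n + 1) % W : ℕ) : ℝ) ≤ W * Y := by
          have : (((n + 1) % W : ℕ) : ℝ) ≤ W := by
            exact_mod_cast (Nat.mod_lt _ (NeZero.pos W)).le
          nlinarith
        gcongr
    _ ≤ 5 * W * Y := by nlinarith
    _ = _ := by rw [hY]; ring

open Finset ArithmeticFunction in
theorem exists_norm_sum_goodInd_pow_mul_le (m W : ℕ) [NeZero m] [NeZero W] (h : m ∣ W)
    (hφ : m.totient ≤ 6) {η : ℝ} (hη : 0 < η) :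
    ∃ p₀ : ℕ, ∀ (p : ℕ) [Fact p.Prime], p₀ ≤ p → ∀ (f : ℕ → ℝ) (g : ℕ → ℂ), f 1 = 1 →
      (∀ a b, f (a * b) = f a * f b) → (∀ n, |f n| ≤ 1) → (∀ n, g (n + W) = g n) →
      (∀ n, ‖g n‖ ≤ 1) → (∀ n : ℕ, n.Coprime W → (f n : ℂ) = g n * (qchar p n : ℂ)) →
      ‖∑ n ∈ Ioc 0 ⌊(p : ℝ) ^ (1.57 : ℝ)⌋₊, (goodInd ℂ m W ^ m.totient) n * (f n : ℂ)‖ ≤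
        η * ⌊(p : ℝ) ^ (1.57 : ℝ)⌋₊ := by
  obtain ⟨t, T, hT0, hT, ht⟩ := exists_goodInd_pow_eq m W
  obtain ⟨p₁, hp₁⟩ := exists_norm_sum_periodic_mul_qchar_le W
  have hcard : (univ : Finset (DirichletCharacter ℂ m)).card = m.totient := by
    rw [card_univ, ← Nat.card_eq_fintype_card,
      DirichletCharacter.card_eq_totient_of_hasEnoughRootsOfUnity]
  set k := m.totient with hk
  set δ : ℝ := 0.00001 with hδ
  set δ₁ : ℝ := δ / (k + 1) with hδ₁
  have hk0 : (0 : ℝ) ≤ k := Nat.cast_nonneg _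
  have hδ0 : 0 < δ := by norm_num [hδ]
  have hδ₁0 : 0 < δ₁ := by positivity
  have hδ₁δ : δ₁ ≤ δ := div_le_self hδ0.le (by linarith)
  have hδ1 : δ ≤ 1 / 4 := by norm_num [hδ]
  clear_value δ₁ δ
  obtain ⟨K, hK0, hK⟩ := exists_one_add_log_pow_le k (show 0 < 0.001 * δ₁ by positivity)
  have hev : ∀ᶠ p : ℕ in Filter.atTop,
      2 * (5 * W * 8 ^ k * K * T) / η ≤ (p : ℝ) ^ (0.008 * δ₁) :=
    ((tendsto_rpow_atTop (by positivity)).comp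
      (tendsto_natCast_atTop_atTop (R := ℝ))).eventually_ge_atTop _
  obtain ⟨p₂, hp₂⟩ := Filter.eventually_atTop.1 hev
  refine ⟨max (max p₁ p₂) 2, fun p _ hp f g hf1 hf habs hg hg1 hfg => ?_⟩
  have hpp1 : p₁ ≤ p := le_of_max_le_left (le_of_max_le_left hp)
  have hpp2 : p₂ ≤ p := le_of_max_le_right (le_of_max_le_left hp)
  have hp2 : 2 ≤ p := le_of_max_le_right hp
  have hpL := hp₂ p hpp2
  have hp1 : (1 : ℝ) < p := by exact_mod_cast hp2
  have hp0 : (0 : ℝ) < p := by linarith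
  have hW1 : (1 : ℝ) ≤ W := by exact_mod_cast NeZero.one_le
  set N := ⌊(p : ℝ) ^ (1.57 : ℝ)⌋₊ with hNdef
  have hP1 : 1 ≤ (p : ℝ) ^ (1.57 : ℝ) := Real.one_le_rpow hp1.le (by norm_num)
  have hN1 : 1 ≤ N := Nat.one_le_floor_iff _ |>.2 hP1
  have hN1' : (1 : ℝ) ≤ N := by exact_mod_cast hN1
  have hN0 : (0 : ℝ) < N := by linarith
  have hNle : (N : ℝ) ≤ (p : ℝ) ^ (1.57 : ℝ) := Nat.floor_le (by positivity)
  have hNge : (p : ℝ) ^ (1.57 : ℝ) ≤ 2 * N := by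
    have := Nat.lt_floor_add_one ((p : ℝ) ^ (1.57 : ℝ))
    rw [← hNdef] at this
    linarith
  have hNp2 : N ≤ p ^ 2 := by
    have : (N : ℝ) ≤ (p ^ 2 : ℕ) := by
      push_cast
      rw [← Real.rpow_two]
      exact hNle.trans (Real.rpow_le_rpow_of_exponent_le hp1.le (by norm_num))
    exact_mod_cast this
  set Z := (p : ℝ) ^ (0.26 : ℝ) with hZ
  have hZ1 : 1 ≤ Z := Real.one_le_rpow hp1.le (by norm_num)
  let F : ArithmeticFunction ℂ := ⟨fun n => if n = 0 then 0 else (f n : ℂ), by simp⟩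
  have hFn : ∀ n, n ≠ 0 → F n = f n := fun n hn => if_neg hn
  have hF1 : F 1 = 1 := by rw [hFn 1 one_ne_zero, hf1, Complex.ofReal_one]
  have hF : ∀ a b, F (a * b) = F a * F b := by
    intro a b
    rcases eq_or_ne a 0 with rfl | ha
    · simp
    rcases eq_or_ne b 0 with rfl | hb
    · simp
    rw [hFn _ (mul_ne_zero ha hb), hFn _ ha, hFn _ hb, hf, Complex.ofReal_mul]
  have hFle : ∀ n, ‖F n‖ ≤ 1 := by
    intro n
    rcases eq_or_ne n 0 with rfl | hn
    · simp
    · rw [hFn _ hn, Complex.norm_real, Real.norm_eq_abs]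
      exact habs n
  have hprod : F.pmul (goodInd ℂ m W ^ k) =
      F.pmul t * ∏ χ : DirichletCharacter ℂ m, F.pmul (copChar W χ) := by
    rw [pmul_prod_of_map_mul hF hF1, pmul_mul_pmul_of_map_mul hF, ← ht]
  have hsum : ∑ n ∈ Ioc 0 N, (goodInd ℂ m W ^ k) n * (f n : ℂ) =
      ∑ n ∈ Ioc 0 N, (F.pmul t * ∏ χ : DirichletCharacter ℂ m, F.pmul (copChar W χ)) n := by
    rw [← hprod]
    refine Finset.sum_congr rfl fun n hn => ?_
    have hn' := mem_Ioc.1 hn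
    rw [pmul_apply, hFn _ (by omega), mul_comm]
  have hchar1 : ∀ χ ∈ (univ : Finset (DirichletCharacter ℂ m)), ∀ n,
      ‖F.pmul (copChar W χ) n‖ ≤ 1 := by
    intro χ _ n
    rw [pmul_apply, norm_mul]
    exact mul_le_one₀ (hFle n) (norm_nonneg _) (norm_copChar_le_one W χ n)
  have hchar : ∀ χ ∈ (univ : Finset (DirichletCharacter ℂ m)), ∀ n, 1 ≤ n → n ≤ N →
      ‖∑ b ∈ Ioc 0 n, F.pmul (copChar W χ) b‖ ≤ 5 * W * Z ^ δ * (n : ℝ) ^ (1 - δ) := by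
    intro χ _ n hn hnN
    have key := hp₁ p hpp1 (fun b => if b.Coprime W then χ (b : ZMod m) * g b else 0) ?_ ?_ n hn
      (hnN.trans hNp2)
    · convert key using 2
      refine Finset.sum_congr rfl fun b hb => ?_
      have hb' := mem_Ioc.1 hb
      have hb0 : b ≠ 0 := by omega
      rw [pmul_apply, hFn _ hb0, copChar_apply]
      by_cases hc : b.Coprime W
      · rw [if_pos hc, if_pos ⟨hb0, hc⟩, hfg b hc]
        ring
      · rw [if_neg hc, if_neg fun h => hc h.2, mul_zero, zero_mul]
    · intro b
      have e1 : (b + W).Coprime W ↔ b.Coprime W := Nat.coprime_add_self_left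
      have e2 : ((b + W : ℕ) : ZMod m) = b := by
        rw [Nat.cast_add, (ZMod.natCast_eq_zero_iff W m).2 h, add_zero]
      simp only [e2, hg]
      exact if_congr e1 rfl rfl
    · intro b
      split_ifs
      · rw [norm_mul]
        exact mul_le_one₀ (DirichletCharacter.norm_le_one χ _) (norm_nonneg _) (hg1 b)
      · simp
  set A := 5 * W * 8 ^ k * (Z ^ k) ^ δ₁ * (1 + Real.log N) ^ k with hA
  have hlogN : 0 ≤ Real.log N := Real.log_nonneg hN1'
  have hA0 : 0 ≤ A := by positivity
  have hbound : ∀ n : ℕ, 1 ≤ n → n ≤ N →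
      ‖∑ b ∈ Ioc 0 n, (∏ χ : DirichletCharacter ℂ m, F.pmul (copChar W χ)) b‖ ≤
        A * (n : ℝ) ^ (1 - δ₁) := by
    intro n hn hnN
    have hn0 : (0 : ℝ) < n := by exact_mod_cast hn
    have hn1 : (1 : ℝ) ≤ n := by exact_mod_cast hn
    have := norm_sum_prod_le univ (fun χ => F.pmul (copChar W χ)) (C := 5 * W) (Z := Z)
      (δ := δ) (X := N) (by linarith) hZ1 hδ0 (by linarith) hchar1 hchar n hn hnN
    rw [hcard] at this
    refine this.trans ?_
    have e1 : (n : ℝ) ^ (1 - δ₁) = n / (n : ℝ) ^ δ₁ := by rw [Real.rpow_sub hn0, Real.rpow_one]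
    have e2 : (Z ^ k / n) ^ δ₁ = (Z ^ k) ^ δ₁ / (n : ℝ) ^ δ₁ :=
      Real.div_rpow (by positivity) hn0.le _
    have e3 : Real.log n ≤ Real.log N := Real.log_le_log hn0 (by exact_mod_cast hnN)
    have e4 : 0 ≤ Real.log n := Real.log_nonneg hn1
    calc _ = 5 * W * 8 ^ k * (Z ^ k) ^ δ₁ * (1 + Real.log n) ^ k * (n / (n : ℝ) ^ δ₁) := by
          rw [← hδ₁, e2]
          ring
      _ ≤ 5 * W * 8 ^ k * (Z ^ k) ^ δ₁ * (1 + Real.log N) ^ k * (n / (n : ℝ) ^ δ₁) := by gcongr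
      _ = _ := by rw [hA, e1]
  have hFt : ∀ N : ℕ, ∑ n ∈ Ioc 0 N, ‖F.pmul t n‖ * (n : ℝ) ^ (-(3 / 4) : ℝ) ≤ T := by
    intro N
    refine (Finset.sum_le_sum fun n _ => ?_).trans (hT N)
    rw [pmul_apply, norm_mul]
    exact mul_le_mul_of_nonneg_right (mul_le_of_le_one_left (norm_nonneg _) (hFle n))
      (by positivity)
  have hfinal := norm_sum_mul_le_of_summable (by linarith) hA0 hFt hbound le_rfl
  rw [hsum]
  refine hfinal.trans ?_
  have hZk : (Z ^ k) ^ δ₁ ≤ (p : ℝ) ^ (1.56 * δ₁) := by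
    rw [Real.rpow_mul hp0.le]
    gcongr
    rw [hZ, ← Real.rpow_natCast, ← Real.rpow_mul hp0.le]
    refine Real.rpow_le_rpow_of_exponent_le hp1.le ?_
    have : (k : ℝ) ≤ 6 := by exact_mod_cast hφ
    linarith
  have hlog : (1 + Real.log N) ^ k ≤ K * (p : ℝ) ^ (0.002 * δ₁) := by
    refine (hK N hN1).trans ?_
    gcongr
    calc (N : ℝ) ^ (0.001 * δ₁) ≤ ((p : ℝ) ^ (2 : ℝ)) ^ (0.001 * δ₁) := by
          gcongr
          rw [Real.rpow_two]
          exact_mod_cast hNp2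
      _ = _ := by
          rw [← Real.rpow_mul hp0.le]
          congr 1
          ring
  have hNδ : (p : ℝ) ^ (1.57 * δ₁) ≤ 2 * (N : ℝ) ^ δ₁ := by
    calc (p : ℝ) ^ (1.57 * δ₁) = ((p : ℝ) ^ (1.57 : ℝ)) ^ δ₁ := Real.rpow_mul hp0.le _ _
      _ ≤ (2 * N) ^ δ₁ := by gcongr
      _ = 2 ^ δ₁ * (N : ℝ) ^ δ₁ := Real.mul_rpow (by norm_num) hN0.le
      _ ≤ _ := by
        gcongr
        conv_rhs => rw [← Real.rpow_one 2]
        exact Real.rpow_le_rpow_of_exponent_le (by norm_num) (by linarith)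
  have hAT : A * T ≤ η * (N : ℝ) ^ δ₁ := by
    calc A * T ≤ 5 * W * 8 ^ k * (p : ℝ) ^ (1.56 * δ₁) * (K * (p : ℝ) ^ (0.002 * δ₁)) * T := by
          rw [hA]
          gcongr
      _ = 5 * W * 8 ^ k * K * T * ((p : ℝ) ^ (1.56 * δ₁) * (p : ℝ) ^ (0.002 * δ₁)) := by ring
      _ ≤ η * (p : ℝ) ^ (0.008 * δ₁) / 2 *
          ((p : ℝ) ^ (1.56 * δ₁) * (p : ℝ) ^ (0.002 * δ₁)) := by
          rw [div_le_iff₀ hη] at hpL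
          gcongr
          linarith
      _ = η * (p : ℝ) ^ (1.57 * δ₁) / 2 := by
          have : 1.57 * δ₁ = 0.008 * δ₁ + (1.56 * δ₁ + 0.002 * δ₁) := by ring
          rw [this, Real.rpow_add hp0, Real.rpow_add hp0]
          ring
      _ ≤ _ := by nlinarith
  calc A * T * (N : ℝ) ^ (1 - δ₁) ≤ η * (N : ℝ) ^ δ₁ * (N : ℝ) ^ (1 - δ₁) := by gcongr
    _ = η * N := by
      rw [mul_assoc, ← Real.rpow_add hN0, add_sub_cancel, Real.rpow_one]

theorem abs_jacobiSym_le_one (a : ℤ) (n : ℕ) : |(jacobiSym a n : ℝ)| ≤ 1 := by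
  rcases jacobiSym.trichotomy a n with h | h | h <;> rw [h] <;> norm_num

open Finset in
/-- For large `p`, some prime `l ≡ 1 (mod m)` below `p` does not have `p * Q` as a square. -/
theorem exists_prime_lt_jacobiSym_eq_neg_one (m : ℕ) (hm : m ≠ 0) (hφ : m.totient ≤ 6) (Q : ℤ)
    (hQ : Q ≠ 0) :
    ∃ p₀ : ℕ, ∀ p : ℕ, p.Prime → p₀ ≤ p → ∃ l : ℕ, l.Prime ∧ l < p ∧ l ≡ 1 [MOD m] ∧
      l.Coprime (8 * m * Q.natAbs) ∧ jacobiSym (p * Q) l = -1 := by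
  set W := 8 * m * Q.natAbs with hW
  have hQ' : Q.natAbs ≠ 0 := Int.natAbs_ne_zero.2 hQ
  have hW0 : W ≠ 0 := mul_ne_zero (mul_ne_zero (by norm_num) hm) hQ'
  have : NeZero m := ⟨hm⟩
  have : NeZero W := ⟨hW0⟩
  have hmW : m ∣ W := Dvd.intro_left (8 * Q.natAbs) (by rw [hW]; ring)
  have h4W : 4 ∣ W := Dvd.intro (2 * m * Q.natAbs) (by rw [hW]; ring)
  have h4QW : 4 * Q.natAbs ∣ W := Dvd.intro (2 * m) (by rw [hW]; ring)
  obtain ⟨η, hη, p₁, hp₁⟩ := exists_le_sum_goodInd_pow_mul m W hmW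
  obtain ⟨p₂, hp₂⟩ := exists_norm_sum_goodInd_pow_mul_le m W hmW hφ (half_pos hη)
  refine ⟨max (max p₁ p₂) 3, fun p hp hpp => ?_⟩
  have : Fact p.Prime := ⟨hp⟩
  have hpp1 : p₁ ≤ p := le_of_max_le_left (le_of_max_le_left hpp)
  have hpp2 : p₂ ≤ p := le_of_max_le_right (le_of_max_le_left hpp)
  have hp3 : 3 ≤ p := le_of_max_le_right hpp
  have hpodd : Odd p := hp.odd_of_ne_two (by omega)
  by_contra hcon
  set f : ℕ → ℝ := fun n => if n = 0 then 0 else (jacobiSym (p * Q) n : ℝ) with hf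
  set g : ℕ → ℂ := fun n => ((qrSign n p * jacobiSym Q (n % (4 * Q.natAbs)) : ℤ) : ℂ) with hg
  have hfn : ∀ n, n ≠ 0 → f n = (jacobiSym (p * Q) n : ℝ) := fun n hn => if_neg hn
  have hf1 : f 1 = 1 := by rw [hfn 1 one_ne_zero, jacobiSym.one_right, Int.cast_one]
  have hfmul : ∀ a b, f (a * b) = f a * f b := by
    intro a b
    rcases eq_or_ne a 0 with rfl | ha
    · simp [hf]
    rcases eq_or_ne b 0 with rfl | hb
    · simp [hf]
    have : NeZero a := ⟨ha⟩
    have : NeZero b := ⟨hb⟩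
    rw [hfn _ (mul_ne_zero ha hb), hfn _ ha, hfn _ hb, jacobiSym.mul_right, Int.cast_mul]
  have hfabs : ∀ n, |f n| ≤ 1 := by
    intro n
    simp only [hf]
    split_ifs
    · simp
    · exact abs_jacobiSym_le_one _ _
  have hgper : ∀ n, g (n + W) = g n := by
    intro n
    have e1 : qrSign (n + W) p = qrSign n p := by
      rw [qrSign, qrSign, Nat.cast_add, (ZMod.natCast_eq_zero_iff W 4).2 h4W, add_zero]
    have e2 : (n + W) % (4 * Q.natAbs) = n % (4 * Q.natAbs) := by
      obtain ⟨k, hk⟩ := h4QW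
      rw [hk, Nat.add_mul_mod_self_left]
    simp only [hg, e1, e2]
  have hg1 : ∀ n, ‖g n‖ ≤ 1 := by
    intro n
    simp only [hg, qrSign]
    rw [Complex.norm_intCast, Int.cast_mul, abs_mul]
    exact mul_le_one₀ (abs_jacobiSym_le_one _ _) (abs_nonneg _) (abs_jacobiSym_le_one _ _)
  have hodd : ∀ n : ℕ, n.Coprime W → Odd n := by
    intro n hn
    have h2 : 2 ∣ W := (by norm_num : 2 ∣ 4).trans h4W
    exact Nat.coprime_two_right.1 (Nat.Coprime.coprime_dvd_right h2 hn)
  have hfg : ∀ n : ℕ, n.Coprime W → (f n : ℂ) = g n * (qchar p n : ℂ) := by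
    intro n hn
    have hno := hodd n hn
    have hn0 : n ≠ 0 := by
      rintro rfl
      exact absurd hno (by decide)
    have e1 : jacobiSym (p * Q) n =
        qrSign n p * jacobiSym Q (n % (4 * Q.natAbs)) * jacobiSym n p := by
      rw [jacobiSym.mul_left, jacobiSym.quadratic_reciprocity' hpodd hno,
        jacobiSym.mod_right Q hno]
      ring
    have e2 : (qchar p n : ℝ) = (jacobiSym n p : ℝ) := by
      rw [qchar, ← jacobiSym.legendreSym.to_jacobiSym, legendreSym]
      simp
    rw [hfn _ hn0, e1, e2]
    simp only [hg]
    push_cast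
    ring
  have hgood : ∀ l < p, l.Prime → goodInd ℝ m W l = 1 → f l = 1 := by
    intro l hlp hl hgl
    rw [goodInd_prime _ _ hl] at hgl
    have hc : l.Coprime W ∧ l ≡ 1 [MOD m] := by
      by_contra h
      rw [if_neg h] at hgl
      exact zero_ne_one hgl
    rw [hfn _ hl.ne_zero]
    rcases jacobiSym.trichotomy (p * Q) l with h | h | h
    · exfalso
      have : NeZero l := ⟨hl.ne_zero⟩
      rw [jacobiSym.eq_zero_iff_not_coprime] at h
      apply h
      have h1 : l.Coprime p := (Nat.coprime_primes hl hp).2 hlp.ne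
      have h2 : l.Coprime Q.natAbs :=
        Nat.Coprime.coprime_dvd_right (Dvd.intro_left (8 * m) rfl) hc.1
      rw [Int.gcd_comm, ← Int.isCoprime_iff_gcd_eq_one]
      exact IsCoprime.mul_right (Nat.isCoprime_iff_coprime.2 h1)
        (Int.isCoprime_iff_gcd_eq_one.2 (by simpa [Int.gcd] using h2))
    · rw [h, Int.cast_one]
    · exact absurd ⟨l, hl, hlp, hc.2, hc.1, h⟩ hcon
  have h1 := hp₁ f hf1 hfmul hfabs p hpp1 hgood
  have h2 := hp₂ p hpp2 f g hf1 hfmul hfabs hgper hg1 hfg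
  have hp1 : (1 : ℝ) ≤ p := by exact_mod_cast (by omega : 1 ≤ p)
  have hN1 : 1 ≤ ⌊(p : ℝ) ^ (1.57 : ℝ)⌋₊ :=
    (Nat.one_le_floor_iff _).2 (Real.one_le_rpow hp1 (by norm_num))
  set N := ⌊(p : ℝ) ^ (1.57 : ℝ)⌋₊ with hN
  have h3 : ∑ n ∈ Ioc 0 N, (goodInd ℂ m W ^ m.totient) n * (f n : ℂ) =
      ((∑ n ∈ Ioc 0 N, (goodInd ℝ m W ^ m.totient) n * f n : ℝ) : ℂ) := by
    simp_rw [← ofReal_goodInd_pow]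
    push_cast
    rfl
  rw [h3, Complex.norm_real] at h2
  have h4 := Real.le_norm_self (∑ n ∈ Ioc 0 N, (goodInd ℝ m W ^ m.totient) n * f n)
  have hN0 : (0 : ℝ) < N := by exact_mod_cast hN1
  clear_value N
  have h5 : 0 < η / 2 * N := by positivity
  linarith

open Finset in
theorem exists_eq_mul_sq_int {y : ℤ} (hy : y ≠ 0) :
    ∃ D z : ℤ, y = D * z ^ 2 ∧ Squarefree D := by
  obtain ⟨a, b, hab, ha⟩ := Nat.sq_mul_squarefree y.natAbs
  refine ⟨y.sign * a, b, ?_, ?_⟩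
  · conv_lhs => rw [← Int.sign_mul_natAbs y, ← hab]
    push_cast
    ring
  · rw [← Int.squarefree_natAbs, Int.natAbs_mul, Int.natAbs_sign_of_ne_zero hy, one_mul,
      Int.natAbs_natCast]
    exact ha

theorem jacobiSym_mul_sq_right_eq {D z : ℤ} {l : ℕ} (hz : jacobiSym (D * z ^ 2) l ≠ 0) :
    jacobiSym (D * z ^ 2) l = jacobiSym D l := by
  rw [jacobiSym.mul_left, jacobiSym.pow_left] at hz ⊢
  have h0 : jacobiSym z l ≠ 0 := fun h => hz (by rw [h]; simp)
  rcases jacobiSym.trichotomy z l with h | h | h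
  · exact absurd h h0
  · rw [h]; simp
  · rw [h]; simp

theorem exists_prime_modEq_not_dvd {n b B : ℕ} (hn : n ≠ 0) (hb : b.Coprime n) (hB : B ≠ 0) :
    ∃ l : ℕ, l.Prime ∧ l ≡ b [MOD n] ∧ ¬ l ∣ B := by
  have : NeZero n := ⟨hn⟩
  have hu : IsUnit (b : ZMod n) := (ZMod.isUnit_iff_coprime b n).2 hb
  have hinf := Nat.infinite_setOfPred_prime_and_eq_mod hu
  obtain ⟨l, hl, hlB⟩ := hinf.exists_gt B
  refine ⟨l, hl.1, (ZMod.natCast_eq_natCast_iff _ _ _).1 hl.2, fun h => ?_⟩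
  exact absurd (Nat.le_of_dvd (Nat.pos_of_ne_zero hB) h) (not_le.2 hlB)

theorem jacobiSym_eq_one_of_forall_prime {m B : ℕ} (hm : m ≠ 0) (hB : B ≠ 0) {D : ℤ} (hD : D ≠ 0)
    (h : ∀ l : ℕ, l.Prime → l ≡ 1 [MOD m] → ¬ l ∣ B → jacobiSym D l = 1)
    {b : ℕ} (hb : Odd b) (hbm : b ≡ 1 [MOD m]) (hbD : b.Coprime D.natAbs) :
    jacobiSym D b = 1 := by
  have hbm' : b.Coprime m := by
    rw [Nat.Coprime, hbm.gcd_eq, Nat.gcd_one_left]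
  have hb4 : b.Coprime 4 := by
    rw [show 4 = 2 ^ 2 by norm_num]
    exact (Nat.coprime_two_right.2 hb).pow_right 2
  have hcop : b.Coprime (4 * D.natAbs * (2 * m)) :=
    (hb4.mul_right hbD).mul_right ((Nat.coprime_two_right.2 hb).mul_right hbm')
  have hD' := Int.natAbs_ne_zero.2 hD
  obtain ⟨l, hl, hlb, hlB⟩ := exists_prime_modEq_not_dvd (n := 4 * D.natAbs * (2 * m))
    (by positivity) hcop hB
  have h1 : l ≡ b [MOD 4 * D.natAbs] := Nat.ModEq.of_mul_right _ hlb
  have h2 : l ≡ b [MOD m] := Nat.ModEq.of_mul_left _ (Nat.ModEq.of_mul_left _ hlb)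
  have hlodd : Odd l := by
    have h3 : l ≡ b [MOD 2] := Nat.ModEq.of_mul_right _ (Nat.ModEq.of_mul_left _ hlb)
    rw [Nat.odd_iff] at hb ⊢
    rw [← hb]; exact h3
  have := h l hl (h2.trans hbm) hlB
  rw [jacobiSym.mod_right D hlodd] at this
  rw [jacobiSym.mod_right D hb, ← h1]
  exact this

theorem prime_dvd_two_mul_of_jacobiSym_eq_one {m : ℕ} {D : ℤ} (hD : Squarefree D)
    (h : ∀ b : ℕ, Odd b → b ≡ 1 [MOD m] → b.Coprime D.natAbs → jacobiSym D b = 1)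
    {q : ℕ} (hq : q.Prime) (hqD : (q : ℤ) ∣ D) : q ∣ 2 * m := by
  by_contra hqm
  have hq2 : q ≠ 2 := by rintro rfl; exact hqm (dvd_mul_right _ _)
  have : Fact q.Prime := ⟨hq⟩
  obtain ⟨D', rfl⟩ := hqD
  have hD0 := hD.ne_zero
  have hD'0 : D'.natAbs ≠ 0 := Int.natAbs_ne_zero.2 (right_ne_zero_of_mul hD0)
  have hqD' : ¬ q ∣ D'.natAbs := by
    intro h1
    have h2 : (q : ℤ) ∣ D' := Int.natCast_dvd.2 h1
    have := hD (q : ℤ) (mul_dvd_mul_left _ h2)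
    rw [Int.isUnit_iff] at this
    have := hq.two_le
    omega
  have hqodd : Odd q := hq.odd_of_ne_two hq2
  have hcop : (8 * m * D'.natAbs).Coprime q := by
    rw [Nat.coprime_comm, Nat.Prime.coprime_iff_not_dvd hq]
    intro h1
    rcases hq.dvd_mul.1 h1 with h1 | h1
    · rcases hq.dvd_mul.1 h1 with h1 | h1
      · rw [show 8 = 2 ^ 3 by norm_num] at h1
        exact hq2 ((Nat.prime_dvd_prime_iff_eq hq Nat.prime_two).1 (hq.dvd_of_dvd_pow h1))
      · exact hqm (h1.mul_left _)
    · exact hqD' h1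
  obtain ⟨a, ha⟩ := FiniteField.exists_nonsquare (F := ZMod q) (by rwa [ZMod.ringChar_zmod_n])
  obtain ⟨b, hb1, hb2⟩ := Nat.chineseRemainder hcop 1 a.val
  have hbm : b ≡ 1 [MOD m] := Nat.ModEq.of_mul_left _ (Nat.ModEq.of_mul_right _ hb1)
  have hb4 : b ≡ 1 [MOD 4] := Nat.ModEq.of_mul_left 2
    (by simpa using Nat.ModEq.of_mul_right _ (Nat.ModEq.of_mul_right _ hb1))
  have hbodd : Odd b := by
    have h4 : b % 4 = 1 := hb4
    rw [Nat.odd_iff]; omega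
  have hb4D : b ≡ 1 [MOD 4 * D'.natAbs] := by
    refine Nat.ModEq.of_mul_left (2 * m) ?_
    rwa [show 2 * m * (4 * D'.natAbs) = 8 * m * D'.natAbs by ring]
  have hbD' : b.Coprime D'.natAbs := by
    rw [Nat.Coprime, (Nat.ModEq.of_mul_left _ hb4D).gcd_eq, Nat.gcd_one_left]
  have hba : (b : ZMod q) = a := by
    rw [(ZMod.natCast_eq_natCast_iff _ _ _).2 hb2, ZMod.natCast_zmod_val]
  have hbq : b.Coprime q := by
    rw [Nat.coprime_comm, Nat.Prime.coprime_iff_not_dvd hq, ← ZMod.natCast_eq_zero_iff, hba]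
    rintro rfl
    exact ha (IsSquare.zero)
  have h1 := h b hbodd hbm (by
    rw [Int.natAbs_mul, Int.natAbs_natCast]; exact hbq.mul_right hbD')
  have h2 : jacobiSym D' b = 1 := by
    rw [jacobiSym.mod_right D' hbodd, hb4D, ← jacobiSym.mod_right D' odd_one]
    exact jacobiSym.one_right _
  have h3 : jacobiSym q b = -1 := by
    rw [jacobiSym.quadratic_reciprocity_one_mod_four' hqodd hb4,
      ← jacobiSym.legendreSym.to_jacobiSym, legendreSym.eq_neg_one_iff]
    rw [Int.cast_natCast, hba]
    exact ha
  rw [jacobiSym.mul_left, h2, h3] at h1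
  norm_num at h1

/-- An integer whose Jacobi symbol is `1` at all admissible primes `1` modulo `m` below a large
prime `p` is a square up to a bounded factor. -/
theorem exists_squarefree_mul_sq_of_jacobiSym_eq_one {m : ℕ} (hm : m ≠ 0) (hφ : m.totient ≤ 6)
    {B : ℕ} (hB : B ≠ 0) :
    ∃ p₀ : ℕ, ∀ p, p.Prime → p₀ ≤ p → ∀ y : ℤ, y ≠ 0 →
      (∀ q : ℕ, q.Prime → (q : ℤ) ∣ y → q ∣ B ∨ q = p) →
      (∀ l : ℕ, l.Prime → l < p → l ≡ 1 [MOD m] → ¬ l ∣ B → jacobiSym y l = 1) →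
      ∃ D z : ℤ, y = D * z ^ 2 ∧ Squarefree D ∧
        (∀ q : ℕ, q.Prime → (q : ℤ) ∣ D → q ∣ 2 * m) ∧
        ∀ b : ℕ, Odd b → b ≡ 1 [MOD m] → b.Coprime D.natAbs → jacobiSym D b = 1 := by
  have hBpos := Nat.pos_of_ne_zero hB
  have key : ∀ D : ℤ, ∃ p₀ : ℕ, D ≠ 0 → ∀ p, p.Prime → p₀ ≤ p →
      (∃ l : ℕ, l.Prime ∧ l < p ∧ l ≡ 1 [MOD m] ∧ ¬ l ∣ B ∧ jacobiSym (p * D) l = -1) ∧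
      ((∀ l : ℕ, l.Prime → l < p → l ≡ 1 [MOD m] → ¬ l ∣ B → jacobiSym D l = 1) →
        ∀ l : ℕ, l.Prime → l ≡ 1 [MOD m] → ¬ l ∣ B → jacobiSym D l = 1) := by
    intro D
    by_cases hD : D = 0
    · exact ⟨0, fun h => absurd hD h⟩
    obtain ⟨p₁, hp₁⟩ := exists_prime_lt_jacobiSym_eq_neg_one m hm hφ (D * (B : ℤ) ^ 2)
      (mul_ne_zero hD (pow_ne_zero _ (by exact_mod_cast hB)))
    obtain ⟨p₂, hp₂⟩ : ∃ p₂ : ℕ, ∀ p, p₂ ≤ p →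
      ((∀ l : ℕ, l.Prime → l < p → l ≡ 1 [MOD m] → ¬ l ∣ B → jacobiSym D l = 1) →
        ∀ l : ℕ, l.Prime → l ≡ 1 [MOD m] → ¬ l ∣ B → jacobiSym D l = 1) := by
      by_cases h : ∀ l : ℕ, l.Prime → l ≡ 1 [MOD m] → ¬ l ∣ B → jacobiSym D l = 1
      · exact ⟨0, fun _ _ _ => h⟩
      · push Not at h
        obtain ⟨l, hl, hlm, hlB, hl1⟩ := h
        exact ⟨l + 1, fun p hp h => absurd (h l hl hp hlm hlB) hl1⟩
    refine ⟨max p₁ p₂, fun _ p hp hpp => ⟨?_, hp₂ p (le_of_max_le_right hpp)⟩⟩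
    obtain ⟨l, hl, hlp, hlm, hlc, hlJ⟩ := hp₁ p hp (le_of_max_le_left hpp)
    have hlB : ¬ l ∣ B := by
      intro h
      have h1 : l ∣ 8 * m * (D * (B : ℤ) ^ 2).natAbs := by
        rw [Int.natAbs_mul, Int.natAbs_pow, Int.natAbs_natCast, pow_two]
        exact ((h.mul_left B).mul_left _).mul_left _
      exact (Nat.Prime.coprime_iff_not_dvd hl).1 hlc h1
    refine ⟨l, hl, hlp, hlm, hlB, ?_⟩
    rw [← mul_assoc] at hlJ
    rwa [jacobiSym_mul_sq_right_eq (by rw [hlJ]; norm_num)] at hlJ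
  choose p₀ hp₀ using key
  refine ⟨(Finset.Icc (-(B : ℤ)) B).sup p₀, fun p hp hpp y hy hyB hyJ => ?_⟩
  have hsmall : ∀ D : ℤ, Squarefree D → (∀ q : ℕ, q.Prime → (q : ℤ) ∣ D → q ∣ B) →
      p₀ D ≤ p := by
    intro D hD hDB
    refine le_trans (Finset.le_sup (f := p₀) ?_) hpp
    have h1 : D.natAbs ∣ B := by
      rw [← Nat.prod_primeFactors_of_squarefree (Int.squarefree_natAbs.2 hD)]
      refine Finset.prod_primes_dvd _ (fun q hq => (Nat.prime_of_mem_primeFactors hq).prime) ?_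
      intro q hq
      exact hDB q (Nat.prime_of_mem_primeFactors hq)
        (Int.natCast_dvd.2 (Nat.dvd_of_mem_primeFactors hq))
    have h2 := Nat.le_of_dvd hBpos h1
    rw [Finset.mem_Icc]
    omega
  obtain ⟨D, z, rfl, hD⟩ := exists_eq_mul_sq_int hy
  have hJ : ∀ l : ℕ, l.Prime → l < p → l ≡ 1 [MOD m] → ¬ l ∣ B → jacobiSym D l = 1 := by
    intro l hl hlp hlm hlB
    have := hyJ l hl hlp hlm hlB
    rwa [jacobiSym_mul_sq_right_eq (by rw [this]; norm_num)] at this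
  by_cases hpD : (p : ℤ) ∣ D
  · exfalso
    obtain ⟨D', rfl⟩ := hpD
    have hD' : Squarefree D' := hD.squarefree_of_dvd (Dvd.intro_left _ rfl)
    have hpD' : ¬ (p : ℤ) ∣ D' := by
      intro h1
      have := hD (p : ℤ) (mul_dvd_mul_left _ h1)
      rw [Int.isUnit_iff] at this
      have := hp.two_le
      omega
    obtain ⟨⟨l, hl, hlp, hlm, hlB, hlJ⟩, -⟩ := hp₀ D' hD'.ne_zero p hp (hsmall D' hD' (by
      intro q hq hqD
      rcases hyB q hq ((hqD.mul_left _).mul_right _) with h | h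
      · exact h
      · exact absurd (h ▸ hqD) hpD'))
    rw [hJ l hl hlp hlm hlB] at hlJ
    norm_num at hlJ
  · have h1 := (hp₀ D hD.ne_zero p hp (hsmall D hD (by
      intro q hq hqD
      rcases hyB q hq (hqD.mul_right _) with h | h
      · exact h
      · exact absurd (h ▸ hqD) hpD))).2 hJ
    have h2 : ∀ b : ℕ, Odd b → b ≡ 1 [MOD m] → b.Coprime D.natAbs → jacobiSym D b = 1 :=
      fun b hb hbm hbD => jacobiSym_eq_one_of_forall_prime hm hB hD.ne_zero h1 hb hbm hbD
    exact ⟨D, z, rfl, hD,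
      fun q hq hqD => prime_dvd_two_mul_of_jacobiSym_eq_one hD h2 hq hqD, h2⟩

theorem Polynomial.dvd_or_modEq_one_of_dvd_eval_cyclotomic {m q : ℕ} (hq : q.Prime) {x : ℤ}
    (h : (q : ℤ) ∣ (cyclotomic m ℤ).eval x) : q ∣ m ∨ q ≡ 1 [MOD m] := by
  by_cases hqm : q ∣ m
  · exact Or.inl hqm
  right
  have : Fact q.Prime := ⟨hq⟩
  have : NeZero (m : ZMod q) := ⟨by rwa [Ne, ZMod.natCast_eq_zero_iff]⟩
  have h1 : IsRoot (cyclotomic m (ZMod q)) (x : ZMod q) := by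
    rw [IsRoot.def, ← map_cyclotomic_int, eval_intCast_map, eq_intCast,
      ZMod.intCast_zmod_eq_zero_iff_dvd]
    exact h
  rw [isRoot_cyclotomic_iff] at h1
  have hx : (x : ZMod q) ≠ 0 := by
    intro h0
    have hm0 : m ≠ 0 := by rintro rfl; exact hqm (dvd_zero _)
    have := h1.pow_eq_one
    rw [h0, zero_pow hm0] at this
    exact zero_ne_one this
  have h2 := (h1.pow_eq_one_iff_dvd (q - 1)).1 (ZMod.pow_card_sub_one_eq_one hx)
  exact ((Nat.modEq_iff_dvd' hq.one_le).2 h2).symm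

theorem isUnit_eval_zero_cyclotomic {m : ℕ} (hm : m ≠ 0) :
    IsUnit ((cyclotomic m ℤ).eval 0) := by
  rcases (Nat.one_le_iff_ne_zero.2 hm).eq_or_lt with rfl | h
  · simp [cyclotomic_one]
  · rw [← coeff_zero_eq_eval_zero, cyclotomic_coeff_zero _ h]
    exact isUnit_one

theorem not_dvd_of_dvd_eval_cyclotomic_mul {m : ℕ} (hm : m ≠ 0) {c N : ℤ} {q : ℕ} (hq : q.Prime)
    (h : (q : ℤ) ∣ (cyclotomic m ℤ).eval (c * N)) : ¬ (q : ℤ) ∣ N := by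
  intro h1
  have h2 := sub_dvd_eval_sub (c * N) 0 (cyclotomic m ℤ)
  rw [sub_zero] at h2
  have h3 := (dvd_sub_right h).1 ((h1.mul_left c).trans h2)
  exact (Nat.prime_iff_prime_int.1 hq).not_isUnit
    (isUnit_of_dvd_unit h3 (isUnit_eval_zero_cyclotomic hm))

theorem Function.Injective.exists_ge_forall_lt {P : ℕ → ℕ} (hP : Function.Injective P) (K : ℕ) :
    ∃ n, K ≤ n ∧ K ≤ P n ∧ ∀ i, P i < P n → i < n := by
  obtain ⟨K', hK'⟩ := Filter.eventually_atTop.1 (hP.nat_tendsto_atTop.eventually_ge_atTop K)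
  obtain ⟨n, hn, hmin⟩ := (measure P).wf.has_min (Set.Ici (max K K')) ⟨_, Set.self_mem_Ici⟩
  refine ⟨n, le_of_max_le_left hn, hK' n (le_of_max_le_right hn), fun i hi => ?_⟩
  by_contra h
  exact hmin i (le_trans (Set.mem_Ici.1 hn) (not_lt.1 h)) hi

section

variable {m : ℕ} {c : ℤ} {P : ℕ → ℕ}

theorem IsGEM2Seq.prime (hP : IsGEM2Seq 1 m ((cyclotomic m ℤ).comp (C c * X)) P) (n : ℕ) :
    (P n).Prime := (hP n).1.1

theorem IsGEM2Seq.dvd_eval (hP : IsGEM2Seq 1 m ((cyclotomic m ℤ).comp (C c * X)) P) (n : ℕ) :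
    (P n : ℤ) ∣ (cyclotomic m ℤ).eval (c * ∏ i ∈ Finset.range n, (P i : ℤ)) := by
  simpa using (hP n).1.2.1

theorem IsGEM2Seq.le_of_dvd_eval (hm : m ≠ 0)
    (hP : IsGEM2Seq 1 m ((cyclotomic m ℤ).comp (C c * X)) P) {q n : ℕ} (hq : q.Prime)
    (hqm : q ≡ 1 [MOD m])
    (h : (q : ℤ) ∣ (cyclotomic m ℤ).eval (c * ∏ i ∈ Finset.range n, (P i : ℤ))) : q ≤ P n := by
  refine (hP n).2 ⟨hq, by simpa using h, ?_, hqm⟩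
  intro h1
  have h2 : (q : ℤ) ∣ (cyclotomic m ℤ).eval 0 := by simpa using h1
  exact (Nat.prime_iff_prime_int.1 hq).not_isUnit
    (isUnit_of_dvd_unit h2 (isUnit_eval_zero_cyclotomic hm))

theorem IsGEM2Seq.injective (hm : m ≠ 0)
    (hP : IsGEM2Seq 1 m ((cyclotomic m ℤ).comp (C c * X)) P) : Function.Injective P := by
  have key : ∀ i n, i < n → P i ≠ P n := by
    intro i n hin h
    refine not_dvd_of_dvd_eval_cyclotomic_mul hm (hP.prime n) (hP.dvd_eval n) ?_
    rw [← h]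
    exact Finset.dvd_prod_of_mem (fun i => (P i : ℤ)) (Finset.mem_range.2 hin)
  intro i n h
  by_contra hne
  rcases lt_or_gt_of_ne hne with h1 | h1
  · exact key _ _ h1 h
  · exact key _ _ h1 h.symm

theorem IsGEM2Seq.exists_index (hm : m ≠ 0)
    (hP : IsGEM2Seq 1 m ((cyclotomic m ℤ).comp (C c * X)) P)
    (hfin : {q : ℕ | q.Prime ∧ q ≡ 1 [MOD m] ∧ ∀ n, P n ≠ q}.Finite) {B₀ : ℕ} (hB₀ : B₀ ≠ 0) :
    ∃ B : ℕ, B ≠ 0 ∧ m ∣ B ∧ B₀ ∣ B ∧ ∀ K : ℕ, ∃ n, K ≤ n ∧ K ≤ P n ∧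
      (∀ q : ℕ, q.Prime →
        (q : ℤ) ∣ (cyclotomic m ℤ).eval (c * ∏ i ∈ Finset.range n, (P i : ℤ)) →
        q ∣ B ∨ q = P n) ∧
      ∀ l : ℕ, l.Prime → l < P n → l ≡ 1 [MOD m] → ¬ l ∣ B →
        (l : ℤ) ∣ ∏ i ∈ Finset.range n, (P i : ℤ) := by
  refine ⟨m * B₀ * ∏ q ∈ hfin.toFinset, q, ?_, ?_, ?_, fun K => ?_⟩
  · refine mul_ne_zero (mul_ne_zero hm hB₀) (Finset.prod_ne_zero_iff.2 fun q hq => ?_)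
    exact ((hfin.mem_toFinset).1 hq).1.ne_zero
  · exact (dvd_mul_right _ _).mul_right _
  · exact (dvd_mul_left _ _).mul_right _
  obtain ⟨n, hn, hPn, hlt⟩ := (hP.injective hm).exists_ge_forall_lt K
  have hdvd : ∀ l : ℕ, l.Prime → l < P n → l ≡ 1 [MOD m] →
      ¬ l ∣ m * B₀ * ∏ q ∈ hfin.toFinset, q → (l : ℤ) ∣ ∏ i ∈ Finset.range n, (P i : ℤ) := by
    intro l hl hlt' hlm hlB
    have h1 : ∃ i, P i = l := by
      by_contra h
      push Not at h
      exact hlB ((Finset.dvd_prod_of_mem (fun q => q)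
        ((hfin.mem_toFinset).2 ⟨hl, hlm, h⟩)).mul_left _)
    obtain ⟨i, rfl⟩ := h1
    exact Finset.dvd_prod_of_mem (fun i => (P i : ℤ)) (Finset.mem_range.2 (hlt i hlt'))
  refine ⟨n, hn, hPn, fun q hq hqd => ?_, hdvd⟩
  by_contra! h
  have hqm : q ≡ 1 [MOD m] := by
    rcases dvd_or_modEq_one_of_dvd_eval_cyclotomic hq hqd with h1 | h1
    · exact absurd ((h1.mul_right _).mul_right _) h.1
    · exact h1
  have hle := hP.le_of_dvd_eval hm hq hqm hqd
  exact not_dvd_of_dvd_eval_cyclotomic_mul hm hq hqd (hdvd q hq (lt_of_le_of_ne hle h.2) hqm h.1)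

theorem IsGEM2Seq.two_pow_le_prod (hP : IsGEM2Seq 1 m ((cyclotomic m ℤ).comp (C c * X)) P)
    (n : ℕ) : (2 : ℤ) ^ n ≤ ∏ i ∈ Finset.range n, (P i : ℤ) := by
  rw [← Finset.card_range n, ← Finset.prod_const, Finset.card_range]
  exact Finset.prod_le_prod (fun _ _ => by norm_num) fun i _ => by
    exact_mod_cast (hP.prime i).two_le

end

theorem jacobiSym_eq_one_of_dvd_sub_one {a : ℤ} {l : ℕ} (h : (l : ℤ) ∣ a - 1) :
    jacobiSym a l = 1 := by
  have h1 : a % l = 1 % l := ((Int.modEq_iff_dvd.2 h).symm)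
  rw [jacobiSym.mod_left, h1, ← jacobiSym.mod_left, jacobiSym.one_left]

theorem Int.eq_one_or_eq_of_squarefree {D : ℤ} {r : ℕ} (hD : Squarefree D) (hpos : 0 < D)
    (h : ∀ q : ℕ, q.Prime → (q : ℤ) ∣ D → q = r) : D = 1 ∨ D = r := by
  lift D to ℕ using hpos.le
  rw [Int.squarefree_natCast] at hD
  have hsub : D.primeFactors ⊆ {r} := fun q hq => Finset.mem_singleton.2
    (h q (Nat.prime_of_mem_primeFactors hq)
      (Int.natCast_dvd_natCast.2 (Nat.dvd_of_mem_primeFactors hq)))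
  have hprod := Nat.prod_primeFactors_of_squarefree hD
  rcases Finset.subset_singleton_iff.1 hsub with h1 | h1
  · left
    rw [h1, Finset.prod_empty] at hprod
    exact_mod_cast hprod.symm
  · right
    rw [h1, Finset.prod_singleton] at hprod
    exact_mod_cast hprod.symm

theorem IsGEM2Seq.exists_index_squarefree_mul_sq {m : ℕ} {c : ℤ} {P : ℕ → ℕ} (hm : m ≠ 0)
    (hφ : m.totient ≤ 6) (hP : IsGEM2Seq 1 m ((cyclotomic m ℤ).comp (C c * X)) P)
    (hfin : {q : ℕ | q.Prime ∧ q ≡ 1 [MOD m] ∧ ∀ n, P n ≠ q}.Finite) {B₀ : ℕ} (hB₀ : B₀ ≠ 0) :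
    ∃ B : ℕ, B ≠ 0 ∧ B₀ ∣ B ∧ ∀ K : ℕ, ∃ n, K ≤ n ∧ K ≤ P n ∧
      (∀ q : ℕ, q.Prime →
        (q : ℤ) ∣ (cyclotomic m ℤ).eval (c * ∏ i ∈ Finset.range n, (P i : ℤ)) →
        q ∣ B ∨ q = P n) ∧
      (∀ l : ℕ, l.Prime → l < P n → l ≡ 1 [MOD m] → ¬ l ∣ B →
        (l : ℤ) ∣ ∏ i ∈ Finset.range n, (P i : ℤ)) ∧
      ((cyclotomic m ℤ).eval (c * ∏ i ∈ Finset.range n, (P i : ℤ)) ≠ 0 →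
        ∃ D z : ℤ, (cyclotomic m ℤ).eval 0 *
          (cyclotomic m ℤ).eval (c * ∏ i ∈ Finset.range n, (P i : ℤ)) = D * z ^ 2 ∧
          Squarefree D ∧ (∀ q : ℕ, q.Prime → (q : ℤ) ∣ D → q ∣ 2 * m) ∧
          ∀ b : ℕ, Odd b → b ≡ 1 [MOD m] → b.Coprime D.natAbs → jacobiSym D b = 1) := by
  obtain ⟨B, hB, -, hB₀B, hind⟩ := hP.exists_index hm hfin hB₀
  obtain ⟨p₀, hp₀⟩ := exists_squarefree_mul_sq_of_jacobiSym_eq_one hm hφ hB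
  refine ⟨B, hB, hB₀B, fun K => ?_⟩
  obtain ⟨n, hn, hPn, hq, hl⟩ := hind (max K p₀)
  have hu := isUnit_eval_zero_cyclotomic hm
  refine ⟨n, le_of_max_le_left hn, le_of_max_le_left hPn, hq, hl, fun h0 => ?_⟩
  refine hp₀ (P n) (hP.prime n) (le_of_max_le_right hPn) _ (mul_ne_zero hu.ne_zero h0) ?_ ?_
  · intro q hqp hqd
    exact hq q hqp ((hu.dvd_mul_left).1 hqd)
  · intro l hlp hlt hlm hlB
    apply jacobiSym_eq_one_of_dvd_sub_one
    have h1 := sub_dvd_eval_sub (c * ∏ i ∈ Finset.range n, (P i : ℤ)) 0 (cyclotomic m ℤ)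
    rw [sub_zero] at h1
    have h2 := (((hl l hlp hlt hlm hlB).mul_left c).trans h1).mul_left ((cyclotomic m ℤ).eval 0)
    rw [mul_sub, Int.isUnit_mul_self hu] at h2
    exact h2

theorem IsGEM2Seq.exists_eval_cyclotomic_eq_sq_or {m : ℕ} {c : ℤ} {P : ℕ → ℕ} (hm : 2 < m)
    (hφ : m.totient ≤ 6) (hc : c ≠ 0)
    (hP : IsGEM2Seq 1 m ((cyclotomic m ℤ).comp (C c * X)) P)
    (hfin : {q : ℕ | q.Prime ∧ q ≡ 1 [MOD m] ∧ ∀ n, P n ≠ q}.Finite) {r K₀ : ℕ}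
    (hr : ∀ q : ℕ, q.Prime → ∀ x : ℤ, (K₀ : ℤ) ≤ |x| → (q : ℤ) ∣ (cyclotomic m ℤ).eval x →
      q ∣ 2 * m → q = r) :
    ∃ B : ℕ, B ≠ 0 ∧ ∀ K : ℕ, ∃ x : ℤ, (K : ℤ) ≤ |x| ∧
      (∃ z : ℤ, (cyclotomic m ℤ).eval x = z ^ 2 ∨ ((cyclotomic m ℤ).eval x = r * z ^ 2 ∧
        ∀ b : ℕ, Odd b → b ≡ 1 [MOD m] → b.Coprime r → jacobiSym r b = 1)) ∧
      ∀ l : ℕ, l.Prime → l < K → l ≡ 1 [MOD m] → ¬ l ∣ B → (l : ℤ) ∣ x := by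
  have hm0 : m ≠ 0 := by omega
  obtain ⟨B, hB, -, h⟩ := hP.exists_index_squarefree_mul_sq hm0 hφ hfin one_ne_zero
  refine ⟨B, hB, fun K => ?_⟩
  obtain ⟨n, hn, hPn, -, hl, hD⟩ := h (max K K₀)
  have hN : (n : ℤ) ≤ |c * ∏ i ∈ Finset.range n, (P i : ℤ)| := by
    have h1 := hP.two_pow_le_prod n
    have h2 : (n : ℤ) < 2 ^ n := by exact_mod_cast Nat.lt_two_pow_self
    have h3 : 1 ≤ |c| := Int.one_le_abs hc
    rw [abs_mul]
    have h4 := le_abs_self (∏ i ∈ Finset.range n, (P i : ℤ))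
    nlinarith
  have hpos := cyclotomic_pos hm (c * ∏ i ∈ Finset.range n, (P i : ℤ))
  refine ⟨c * ∏ i ∈ Finset.range n, (P i : ℤ), ?_, ?_, fun l hlp hlt hlm hlB =>
    (hl l hlp (hlt.trans_le (le_of_max_le_left hPn)) hlm hlB).mul_left c⟩
  · exact le_trans (by exact_mod_cast le_of_max_le_left hn) hN
  obtain ⟨D, z, hDz, hDs, hDq, hDb⟩ := hD hpos.ne'
  rw [← coeff_zero_eq_eval_zero, cyclotomic_coeff_zero _ (by omega), one_mul] at hDz
  have hDpos : 0 < D := by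
    rw [hDz] at hpos
    exact pos_of_mul_pos_left hpos (sq_nonneg z)
  rcases Int.eq_one_or_eq_of_squarefree hDs hDpos (r := r) (fun q hq hqD =>
    hr q hq _ (le_trans (by exact_mod_cast le_of_max_le_right hn) hN)
      (by rw [hDz]; exact hqD.mul_right _) (hDq q hq hqD)) with rfl | rfl
  · exact ⟨z, Or.inl (by rw [hDz, one_mul])⟩
  · exact ⟨z, Or.inr ⟨hDz, fun b hb hbm hbr => hDb b hb hbm (by simpa using hbr)⟩⟩

theorem eval_cyclotomic_mul_eq_of_dvd {p n : ℕ} (hp : p.Prime) (h : p ∣ n) (x : ℤ) :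
    (cyclotomic (n * p) ℤ).eval x = (cyclotomic n ℤ).eval (x ^ p) := by
  rw [← cyclotomic_expand_eq_cyclotomic hp h, expand_eval]

theorem eval_cyclotomic_pow_eq_of_not_dvd {p n : ℕ} (hp : p.Prime) (h : ¬ p ∣ n) (x : ℤ) :
    (cyclotomic n ℤ).eval (x ^ p) = (cyclotomic (n * p) ℤ).eval x * (cyclotomic n ℤ).eval x := by
  rw [← expand_eval, cyclotomic_expand_eq_cyclotomic_mul hp h, eval_mul]

theorem eval_cyclotomic_three (x : ℤ) : (cyclotomic 3 ℤ).eval x = x ^ 2 + x + 1 := by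
  simp [cyclotomic_three]

theorem eval_cyclotomic_four (x : ℤ) : (cyclotomic 4 ℤ).eval x = x ^ 2 + 1 := by
  rw [eval_cyclotomic_mul_eq_of_dvd (n := 2) Nat.prime_two dvd_rfl]
  simp [cyclotomic_two]

theorem eval_cyclotomic_eight (x : ℤ) : (cyclotomic 8 ℤ).eval x = x ^ 4 + 1 := by
  rw [eval_cyclotomic_mul_eq_of_dvd (n := 4) Nat.prime_two (by norm_num), eval_cyclotomic_four]
  ring

theorem eval_cyclotomic_five (x : ℤ) :
    (cyclotomic 5 ℤ).eval x = x ^ 4 + x ^ 3 + x ^ 2 + x + 1 := by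
  have : Fact (Nat.Prime 5) := ⟨by norm_num⟩
  rw [cyclotomic_prime, eval_geom_sum]
  simp only [Finset.sum_range_succ, Finset.sum_range_zero]
  ring

theorem eval_cyclotomic_seven (x : ℤ) :
    (cyclotomic 7 ℤ).eval x = x ^ 6 + x ^ 5 + x ^ 4 + x ^ 3 + x ^ 2 + x + 1 := by
  have : Fact (Nat.Prime 7) := ⟨by norm_num⟩
  rw [cyclotomic_prime, eval_geom_sum]
  simp only [Finset.sum_range_succ, Finset.sum_range_zero]
  ring

theorem eval_cyclotomic_nine (x : ℤ) : (cyclotomic 9 ℤ).eval x = x ^ 6 + x ^ 3 + 1 := by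
  rw [eval_cyclotomic_mul_eq_of_dvd (n := 3) Nat.prime_three dvd_rfl, eval_cyclotomic_three]
  ring

theorem eval_cyclotomic_two_mul {p : ℕ} (hp : p.Prime) (hp2 : p ≠ 2) {x : ℤ} (hx : x ≠ -1) :
    (cyclotomic (2 * p) ℤ).eval x = (cyclotomic p ℤ).eval (-x) := by
  have hp' : Odd p := hp.odd_of_ne_two hp2
  have : Fact p.Prime := ⟨hp⟩
  have h1 := eval_cyclotomic_pow_eq_of_not_dvd (n := 2) hp
    (fun h => hp2 ((Nat.prime_dvd_prime_iff_eq hp Nat.prime_two).1 h)) x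
  have h2 := mul_geom_sum (-x) p
  rw [cyclotomic_two] at h1
  rw [cyclotomic_prime ℤ p, eval_geom_sum]
  simp only [eval_add, eval_X, eval_one] at h1
  rw [hp'.neg_pow] at h2
  have h3 : x + 1 ≠ 0 := fun h => hx (by linarith)
  apply mul_right_cancel₀ h3
  linear_combination h2 - h1

theorem eval_cyclotomic_six {x : ℤ} (hx : x ≠ -1) :
    (cyclotomic 6 ℤ).eval x = x ^ 2 - x + 1 := by
  rw [eval_cyclotomic_two_mul Nat.prime_three (by norm_num) hx, eval_cyclotomic_three]
  ring

theorem eval_cyclotomic_ten {x : ℤ} (hx : x ≠ -1) :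
    (cyclotomic 10 ℤ).eval x = x ^ 4 - x ^ 3 + x ^ 2 - x + 1 := by
  rw [eval_cyclotomic_two_mul (p := 5) (by norm_num) (by norm_num) hx, eval_cyclotomic_five]
  ring

theorem eval_cyclotomic_fourteen {x : ℤ} (hx : x ≠ -1) :
    (cyclotomic 14 ℤ).eval x = x ^ 6 - x ^ 5 + x ^ 4 - x ^ 3 + x ^ 2 - x + 1 := by
  rw [eval_cyclotomic_two_mul (p := 7) (by norm_num) (by norm_num) hx, eval_cyclotomic_seven]
  ring

theorem eval_cyclotomic_eighteen {x : ℤ} (hx : x ≠ -1) :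
    (cyclotomic 18 ℤ).eval x = x ^ 6 - x ^ 3 + 1 := by
  have h : x ^ 3 ≠ -1 := by
    intro h
    have h1 : (-x) ^ 3 = 1 := by linear_combination -h
    have h2 : (-x) ∣ 1 := Dvd.intro_left ((-x) ^ 2) (by linear_combination h1)
    rcases Int.isUnit_iff.1 (isUnit_of_dvd_one h2) with h3 | h3
    · exact hx (by linarith)
    · rw [h3] at h1; norm_num at h1
  rw [eval_cyclotomic_mul_eq_of_dvd (n := 6) Nat.prime_three (by norm_num), eval_cyclotomic_six h]
  ring

theorem eval_cyclotomic_twelve (x : ℤ) :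
    (cyclotomic 12 ℤ).eval x = x ^ 4 - x ^ 2 + 1 := by
  have hx : x ^ 2 ≠ -1 := by nlinarith [sq_nonneg x]
  rw [eval_cyclotomic_mul_eq_of_dvd (n := 6) Nat.prime_two (by norm_num), eval_cyclotomic_six hx]
  ring

theorem Int.sq_ne_of_lt_of_lt {A w : ℤ} (hA : 0 ≤ A) (h1 : A ^ 2 < w ^ 2)
    (h2 : w ^ 2 < (A + 1) ^ 2) : False := by
  rw [sq_lt_sq, abs_of_nonneg hA] at h1
  rw [sq_lt_sq, abs_of_nonneg (by linarith : 0 ≤ A + 1)] at h2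
  linarith

theorem sq_add_self_add_one_ne_sq {x : ℤ} (hx : 2 ≤ |x|) (z : ℤ) : x ^ 2 + x + 1 ≠ z ^ 2 := by
  intro h
  rcases le_abs.1 hx with h1 | h1
  · exact Int.sq_ne_of_lt_of_lt (A := x) (w := z) (by linarith) (by linarith) (by linarith)
  · exact Int.sq_ne_of_lt_of_lt (A := -x - 1) (w := z) (by linarith) (by linarith) (by linarith)

theorem sq_add_one_ne_sq {x : ℤ} (hx : 2 ≤ |x|) (z : ℤ) : x ^ 2 + 1 ≠ z ^ 2 := by
  intro h
  rw [← sq_abs x] at h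
  exact Int.sq_ne_of_lt_of_lt (A := |x|) (w := z) (by linarith) (by linarith) (by linarith)

theorem geom_five_ne_sq {x : ℤ} (hx : 4 ≤ |x|) (z : ℤ) :
    x ^ 4 + x ^ 3 + x ^ 2 + x + 1 ≠ z ^ 2 := by
  intro h
  rcases le_abs.1 hx with h1 | h1
  · exact Int.sq_ne_of_lt_of_lt (A := 2 * x ^ 2 + x) (w := 2 * z) (by nlinarith) (by nlinarith)
      (by nlinarith)
  · exact Int.sq_ne_of_lt_of_lt (A := 2 * x ^ 2 + x) (w := 2 * z) (by nlinarith) (by nlinarith)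
      (by nlinarith)

theorem geom_seven_ne_sq {x : ℤ} (hx : 10 ≤ |x|) (z : ℤ) :
    x ^ 6 + x ^ 5 + x ^ 4 + x ^ 3 + x ^ 2 + x + 1 ≠ z ^ 2 := by
  intro h
  rcases le_abs.1 hx with h1 | h1
  · obtain ⟨t, ht, rfl⟩ : ∃ t : ℤ, 0 ≤ t ∧ x = t + 10 := ⟨x - 10, by linarith, by ring⟩
    refine Int.sq_ne_of_lt_of_lt (A := 16 * (t + 10) ^ 3 + 8 * (t + 10) ^ 2 + 6 * (t + 10) + 5)
      (w := 16 * z) (by positivity) ?_ ?_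
    · rw [mul_pow, ← h, ← sub_pos]; ring_nf; positivity
    · rw [mul_pow, ← h, ← sub_pos]; ring_nf; positivity
  · obtain ⟨t, ht, rfl⟩ : ∃ t : ℤ, 0 ≤ t ∧ x = -(t + 10) := ⟨-x - 10, by linarith, by ring⟩
    refine Int.sq_ne_of_lt_of_lt (A := 16 * (t + 10) ^ 3 - 8 * (t + 10) ^ 2 + 6 * (t + 10) - 5)
      (w := 16 * z) (by ring_nf; positivity) ?_ ?_
    · rw [mul_pow, ← h, ← sub_pos]; ring_nf; positivity
    · rw [mul_pow, ← h, ← sub_pos]; ring_nf; positivity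

theorem Nat.Prime.eq_two_or_eq_of_dvd {q p a b : ℕ} (hq : q.Prime) (hp : p.Prime)
    (h : q ∣ 2 ^ a * p ^ b) : q = 2 ∨ q = p := by
  rcases hq.dvd_mul.1 h with h | h
  · exact Or.inl ((Nat.prime_dvd_prime_iff_eq hq Nat.prime_two).1 (hq.dvd_of_dvd_pow h))
  · exact Or.inr ((Nat.prime_dvd_prime_iff_eq hq hp).1 (hq.dvd_of_dvd_pow h))

theorem IsGEM2Seq.infinite_of_ne_sq {m : ℕ} {c : ℤ} {P : ℕ → ℕ} (hm : 2 < m)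
    (hφ : m.totient ≤ 6) (hc : c ≠ 0)
    (hP : IsGEM2Seq 1 m ((cyclotomic m ℤ).comp (C c * X)) P) {r : ℕ}
    (hr : ∀ q : ℕ, q.Prime → ∀ x : ℤ, 10 ≤ |x| → (q : ℤ) ∣ (cyclotomic m ℤ).eval x →
      q ∣ 2 * m → q = r)
    (hsq : ∀ x : ℤ, 10 ≤ |x| → ∀ z : ℤ, (cyclotomic m ℤ).eval x ≠ z ^ 2)
    (hb : r = 1 ∨ ∃ b : ℕ, Odd b ∧ b ≡ 1 [MOD m] ∧ b.Coprime r ∧ jacobiSym r b ≠ 1) :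
    {q : ℕ | q.Prime ∧ q ≡ 1 [MOD m] ∧ ∀ n, P n ≠ q}.Infinite := by
  intro hfin
  obtain ⟨B, -, h⟩ := hP.exists_eval_cyclotomic_eq_sq_or hm hφ hc hfin (r := r) (K₀ := 10)
    (by exact_mod_cast hr)
  obtain ⟨x, hx, ⟨z, hz | ⟨hz, hz'⟩⟩, -⟩ := h 10
  · exact hsq x hx z hz
  · rcases hb with rfl | ⟨b, hb, hbm, hbr, hbJ⟩
    · exact hsq x hx z (by rw [hz, Nat.cast_one, one_mul])
    · exact hbJ (hz' b hb hbm hbr)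

theorem ne_neg_one_of_ten_le_abs {x : ℤ} (hx : 10 ≤ |x|) : x ≠ -1 := by
  rintro rfl
  norm_num at hx

section

variable {c : ℤ} {P : ℕ → ℕ}

theorem IsGEM2Seq.infinite_three (hc : c ≠ 0)
    (hP : IsGEM2Seq 1 3 ((cyclotomic 3 ℤ).comp (C c * X)) P) :
    {q : ℕ | q.Prime ∧ q ≡ 1 [MOD 3] ∧ ∀ n, P n ≠ q}.Infinite := by
  refine hP.infinite_of_ne_sq (r := 3) (by norm_num) (by decide) hc ?_ ?_
    (Or.inr ⟨19, by decide, by decide, by decide, by norm_num⟩)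
  · intro q hq x _ hqx hqm
    refine (hq.eq_two_or_eq_of_dvd (a := 1) (b := 1) Nat.prime_three hqm).resolve_left ?_
    rintro rfl
    rw [eval_cyclotomic_three, ← ZMod.intCast_zmod_eq_zero_iff_dvd] at hqx
    push_cast at hqx
    generalize (x : ZMod 2) = y at hqx
    revert y
    decide
  · intro x hx z
    rw [eval_cyclotomic_three]
    exact sq_add_self_add_one_ne_sq (by linarith) z

theorem IsGEM2Seq.infinite_six (hc : c ≠ 0)
    (hP : IsGEM2Seq 1 6 ((cyclotomic 6 ℤ).comp (C c * X)) P) :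
    {q : ℕ | q.Prime ∧ q ≡ 1 [MOD 6] ∧ ∀ n, P n ≠ q}.Infinite := by
  refine hP.infinite_of_ne_sq (r := 3) (by norm_num) (by decide) hc ?_ ?_
    (Or.inr ⟨19, by decide, by decide, by decide, by norm_num⟩)
  · intro q hq x hx hqx hqm
    refine (hq.eq_two_or_eq_of_dvd (a := 2) (b := 1) Nat.prime_three hqm).resolve_left ?_
    rintro rfl
    rw [eval_cyclotomic_six (ne_neg_one_of_ten_le_abs hx),
      ← ZMod.intCast_zmod_eq_zero_iff_dvd] at hqx
    push_cast at hqx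
    generalize (x : ZMod 2) = y at hqx
    revert y
    decide
  · intro x hx z
    rw [eval_cyclotomic_six (ne_neg_one_of_ten_le_abs hx)]
    have := sq_add_self_add_one_ne_sq (x := -x) (by rw [abs_neg]; linarith) z
    contrapose! this
    linear_combination this

theorem IsGEM2Seq.infinite_four (hc : c ≠ 0)
    (hP : IsGEM2Seq 1 4 ((cyclotomic 4 ℤ).comp (C c * X)) P) :
    {q : ℕ | q.Prime ∧ q ≡ 1 [MOD 4] ∧ ∀ n, P n ≠ q}.Infinite := by
  refine hP.infinite_of_ne_sq (r := 2) (by norm_num) (by decide) hc ?_ ?_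
    (Or.inr ⟨5, by decide, by decide, by decide, by norm_num⟩)
  · intro q hq x hx hqx hqm
    rcases hq.eq_two_or_eq_of_dvd (a := 3) (b := 0) Nat.prime_two hqm with h | h <;> exact h
  · intro x hx z
    rw [eval_cyclotomic_four]
    exact sq_add_one_ne_sq (by linarith) z

theorem IsGEM2Seq.infinite_seven (hc : c ≠ 0)
    (hP : IsGEM2Seq 1 7 ((cyclotomic 7 ℤ).comp (C c * X)) P) :
    {q : ℕ | q.Prime ∧ q ≡ 1 [MOD 7] ∧ ∀ n, P n ≠ q}.Infinite := by
  refine hP.infinite_of_ne_sq (r := 7) (by norm_num) (by decide) hc ?_ ?_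
    (Or.inr ⟨15, by decide, by decide, by decide, by norm_num⟩)
  · intro q hq x hx hqx hqm
    refine (hq.eq_two_or_eq_of_dvd (p := 7) (a := 1) (b := 1) (by norm_num) hqm).resolve_left ?_
    rintro rfl
    rw [eval_cyclotomic_seven, ← ZMod.intCast_zmod_eq_zero_iff_dvd] at hqx
    push_cast at hqx
    generalize (x : ZMod 2) = y at hqx
    revert y
    decide
  · intro x hx z
    rw [eval_cyclotomic_seven]
    exact geom_seven_ne_sq hx z

theorem IsGEM2Seq.infinite_fourteen (hc : c ≠ 0)
    (hP : IsGEM2Seq 1 14 ((cyclotomic 14 ℤ).comp (C c * X)) P) :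
    {q : ℕ | q.Prime ∧ q ≡ 1 [MOD 14] ∧ ∀ n, P n ≠ q}.Infinite := by
  refine hP.infinite_of_ne_sq (r := 7) (by norm_num) (by decide) hc ?_ ?_
    (Or.inr ⟨15, by decide, by decide, by decide, by norm_num⟩)
  · intro q hq x hx hqx hqm
    refine (hq.eq_two_or_eq_of_dvd (p := 7) (a := 2) (b := 1) (by norm_num) hqm).resolve_left ?_
    rintro rfl
    rw [eval_cyclotomic_fourteen (ne_neg_one_of_ten_le_abs hx),
      ← ZMod.intCast_zmod_eq_zero_iff_dvd] at hqx
    push_cast at hqx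
    generalize (x : ZMod 2) = y at hqx
    revert y
    decide
  · intro x hx z
    rw [eval_cyclotomic_fourteen (ne_neg_one_of_ten_le_abs hx)]
    have := geom_seven_ne_sq (x := -x) (by rwa [abs_neg]) z
    contrapose! this
    linear_combination this

theorem ten_le_abs_pow {x : ℤ} (hx : 10 ≤ |x|) {k : ℕ} (hk : k ≠ 0) : 10 ≤ |x ^ k| := by
  rw [abs_pow]
  exact hx.trans (le_self_pow₀ (by linarith) hk)

theorem IsGEM2Seq.infinite_nine (hc : c ≠ 0)
    (hP : IsGEM2Seq 1 9 ((cyclotomic 9 ℤ).comp (C c * X)) P) :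
    {q : ℕ | q.Prime ∧ q ≡ 1 [MOD 9] ∧ ∀ n, P n ≠ q}.Infinite := by
  refine hP.infinite_of_ne_sq (r := 3) (by norm_num) (by decide) hc ?_ ?_
    (Or.inr ⟨19, by decide, by decide, by decide, by norm_num⟩)
  · intro q hq x hx hqx hqm
    refine (hq.eq_two_or_eq_of_dvd (a := 1) (b := 2) Nat.prime_three hqm).resolve_left ?_
    rintro rfl
    rw [eval_cyclotomic_nine, ← ZMod.intCast_zmod_eq_zero_iff_dvd] at hqx
    push_cast at hqx
    generalize (x : ZMod 2) = y at hqx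
    revert y
    decide
  · intro x hx z
    rw [eval_cyclotomic_nine]
    have := sq_add_self_add_one_ne_sq (x := x ^ 3)
      (by linarith [ten_le_abs_pow hx three_ne_zero]) z
    contrapose! this
    linear_combination this

theorem IsGEM2Seq.infinite_eighteen (hc : c ≠ 0)
    (hP : IsGEM2Seq 1 18 ((cyclotomic 18 ℤ).comp (C c * X)) P) :
    {q : ℕ | q.Prime ∧ q ≡ 1 [MOD 18] ∧ ∀ n, P n ≠ q}.Infinite := by
  refine hP.infinite_of_ne_sq (r := 3) (by norm_num) (by decide) hc ?_ ?_
    (Or.inr ⟨19, by decide, by decide, by decide, by norm_num⟩)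
  · intro q hq x hx hqx hqm
    refine (hq.eq_two_or_eq_of_dvd (a := 2) (b := 2) Nat.prime_three hqm).resolve_left ?_
    rintro rfl
    rw [eval_cyclotomic_eighteen (ne_neg_one_of_ten_le_abs hx),
      ← ZMod.intCast_zmod_eq_zero_iff_dvd] at hqx
    push_cast at hqx
    generalize (x : ZMod 2) = y at hqx
    revert y
    decide
  · intro x hx z
    rw [eval_cyclotomic_eighteen (ne_neg_one_of_ten_le_abs hx)]
    have := sq_add_self_add_one_ne_sq (x := -x ^ 3)
      (by rw [abs_neg]; linarith [ten_le_abs_pow hx three_ne_zero]) z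
    contrapose! this
    linear_combination this

theorem IsGEM2Seq.infinite_twelve (hc : c ≠ 0)
    (hP : IsGEM2Seq 1 12 ((cyclotomic 12 ℤ).comp (C c * X)) P) :
    {q : ℕ | q.Prime ∧ q ≡ 1 [MOD 12] ∧ ∀ n, P n ≠ q}.Infinite := by
  refine hP.infinite_of_ne_sq (r := 1) (by norm_num) (by decide) hc ?_ ?_ (Or.inl rfl)
  · intro q hq x hx hqx hqm
    exfalso
    rw [eval_cyclotomic_twelve, ← ZMod.intCast_zmod_eq_zero_iff_dvd] at hqx
    push_cast at hqx
    rcases hq.eq_two_or_eq_of_dvd (a := 3) (b := 1) Nat.prime_three hqm with rfl | rfl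
    · generalize (x : ZMod 2) = y at hqx
      revert y
      decide
    · generalize (x : ZMod 3) = y at hqx
      revert y
      decide
  · intro x hx z
    rw [eval_cyclotomic_twelve]
    have := sq_add_self_add_one_ne_sq (x := -x ^ 2)
      (by rw [abs_neg]; linarith [ten_le_abs_pow hx two_ne_zero]) z
    contrapose! this
    linear_combination this

end

theorem exists_prime_dvd_jacobiSym_ne_one {a : ℤ} {n : ℕ} (hn : n ≠ 0)
    (h : jacobiSym a n ≠ 1) : ∃ l : ℕ, l.Prime ∧ l ∣ n ∧ jacobiSym a l ≠ 1 := by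
  contrapose! h
  induction n using Nat.recOnMul with
  | zero => exact absurd rfl hn
  | one => exact jacobiSym.one_right a
  | prime p hp => exact h p hp dvd_rfl
  | mul x y hx hy =>
    have hx0 := left_ne_zero_of_mul hn
    have hy0 := right_ne_zero_of_mul hn
    have : NeZero x := ⟨hx0⟩
    have : NeZero y := ⟨hy0⟩
    rw [jacobiSym.mul_right, hx hx0 fun l hl hlx => h l hl (hlx.mul_right _),
      hy hy0 fun l hl hly => h l hl (hly.mul_left _), one_mul]

theorem isSquare_one_add_of_sq_eq_two {F : Type*} [Field F] {a b σ : F} (hF : IsSquare (-1 : F))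
    (h1 : a ^ 2 - b ^ 2 + 2 * a * b = 0) (h2 : a ^ 2 - b ^ 2 - 2 * a * b = 1) (hσ : σ ^ 2 = 2) :
    IsSquare (1 + σ) := by
  obtain ⟨i, hi⟩ := hF
  have h3 : (a + b) ^ 2 = (σ * b) ^ 2 := by linear_combination h1 - b ^ 2 * hσ
  rcases sq_eq_sq_iff_eq_or_eq_neg.1 h3 with h | h
  · have ha : a = σ * b - b := by linear_combination h
    subst ha
    refine ⟨i * (2 * b), ?_⟩
    linear_combination (-(1 + σ)) * h2 + 4 * b ^ 2 * hi + (σ - 3) * b ^ 2 * hσ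
  · have ha : a = -σ * b - b := by linear_combination h
    subst ha
    refine ⟨(1 + σ) * (2 * b), ?_⟩
    linear_combination (-(1 + σ)) * h2 + (σ + 1) * b ^ 2 * hσ

theorem isSquare_one_add_of_dvd {l : ℕ} [Fact l.Prime] (hl : l % 4 ≠ 3) {x z : ℤ}
    (h : x ^ 4 + 1 = 2 * z ^ 2) (hx : (l : ℤ) ∣ x) {σ : ZMod l} (hσ : σ ^ 2 = 2) :
    IsSquare (1 + σ) := by
  have hodd : Odd x := by
    by_contra hx
    rw [Int.not_odd_iff_even] at hx
    obtain ⟨k, rfl⟩ := hx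
    have : 2 * (z ^ 2 - 8 * k ^ 4) = 1 := by linear_combination -h
    omega
  obtain ⟨k, rfl⟩ := hodd
  have hk : Even (k * (k + 1)) := Int.even_mul_succ_self k
  obtain ⟨j, hj⟩ := hk
  have hpy : PythagoreanTriple (4 * j + 1) (4 * j) |z| := by
    have : |z| * |z| = z * z := abs_mul_abs_self z
    rw [PythagoreanTriple, this]
    have h2 : (2 * k + 1) ^ 2 = 8 * j + 1 := by linear_combination 4 * hj
    have h3 : ((2 * k + 1) ^ 2) ^ 2 + 1 = 2 * z ^ 2 := by linear_combination h
    rw [h2] at h3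
    linarith
  have hz : 0 < |z| := by
    rw [abs_pos]
    rintro rfl
    have : 0 ≤ (2 * k + 1) ^ 4 := by positivity
    linarith
  have hg : Int.gcd (4 * j + 1) (4 * j) = 1 := by
    rw [← Int.isCoprime_iff_gcd_eq_one]
    exact ⟨1, -1, by ring⟩
  obtain ⟨a, b, h1, h2, -⟩ := hpy.coprime_classification' hg (by omega) hz
  have hF : IsSquare (-1 : ZMod l) := ZMod.exists_sq_eq_neg_one_iff.2 hl
  refine isSquare_one_add_of_sq_eq_two hF (a := (a : ZMod l)) (b := (b : ZMod l)) ?_ ?_ hσ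
  · have h3 : a ^ 2 - b ^ 2 + 2 * a * b = (2 * k + 1) ^ 2 := by
      linear_combination -h1 - h2 - 4 * hj
    have h4 : ((2 * k + 1 : ℤ) : ZMod l) = 0 := (ZMod.intCast_zmod_eq_zero_iff_dvd _ _).2 hx
    have h5 := congrArg (Int.cast : ℤ → ZMod l) h3
    rw [Int.cast_pow, h4] at h5
    push_cast at h5
    linear_combination h5
  · have h3 : a ^ 2 - b ^ 2 - 2 * a * b = 1 := by linear_combination -h1 + h2
    exact_mod_cast congrArg (Int.cast : ℤ → ZMod l) h3

theorem jacobiSym_mul_add_one_pow_four_eq_neg_one {s : ℕ} (hs : Odd s) :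
    jacobiSym (((2 * s) ^ 2 + 2 * s + 1 : ℕ) * (2 * s : ℕ)) ((2 * s) ^ 4 + 1) = -1 := by
  obtain ⟨k, hk⟩ := hs
  have hn8 : ((2 * s) ^ 4 + 1) % 8 = 1 := by
    rw [show (2 * s) ^ 4 + 1 = 1 + 8 * (2 * s ^ 4) by ring, Nat.add_mul_mod_self_left]
  have hn4 : ((2 * s) ^ 4 + 1) % 4 = 1 := by omega
  have hw4 : ((2 * s) ^ 2 + 2 * s + 1) % 4 = 3 := by
    rw [hk,
      show (2 * (2 * k + 1)) ^ 2 + 2 * (2 * k + 1) + 1 = 3 + 4 * ((2 * k + 1) ^ 2 + k) by ring,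
      Nat.add_mul_mod_self_left]
  have hnodd : Odd ((2 * s) ^ 4 + 1) := by rw [Nat.odd_iff]; omega
  have hwodd : Odd ((2 * s) ^ 2 + 2 * s + 1) := by rw [Nat.odd_iff]; omega
  have hsodd : Odd s := ⟨k, hk⟩
  have e1 : jacobiSym (2 * s : ℕ) ((2 * s) ^ 4 + 1) = 1 := by
    rw [Nat.cast_mul, jacobiSym.mul_left, Nat.cast_two, jacobiSym.at_two hnodd,
      jacobiSym.quadratic_reciprocity_one_mod_four' hsodd hn4, ZMod.χ₈_nat_mod_eight, hn8]
    have : jacobiSym ((2 * s) ^ 4 + 1 : ℕ) s = 1 := jacobiSym_eq_one_of_dvd_sub_one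
      ⟨2 * (2 * s) ^ 3, by push_cast; ring⟩
    rw [this]
    decide
  have e2 : jacobiSym ((2 * s) ^ 2 + 2 * s + 1 : ℕ) ((2 * s) ^ 4 + 1) = -1 := by
    rw [jacobiSym.quadratic_reciprocity_one_mod_four' hwodd hn4]
    have h1 : (((2 * s) ^ 4 + 1 : ℕ) : ℤ) % ((2 * s) ^ 2 + 2 * s + 1 : ℕ) =
        (-1 * (2 * s) ^ 2) % ((2 * s) ^ 2 + 2 * s + 1 : ℕ) := by
      refine (Int.modEq_iff_dvd.2 ⟨-((2 * s) ^ 2 - 2 * s + 1), ?_⟩)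
      push_cast
      ring
    have h2 : jacobiSym (-1) ((2 * s) ^ 2 + 2 * s + 1) = -1 := by
      rw [jacobiSym.at_neg_one hwodd, ZMod.χ₄_nat_three_mod_four hw4]
    rw [jacobiSym.mod_left, h1, ← jacobiSym.mod_left, jacobiSym_mul_sq_right_eq, h2]
    rw [jacobiSym.mul_left, h2, jacobiSym.pow_left]
    refine mul_ne_zero (by norm_num) (pow_ne_zero _ ?_)
    rw [Ne, jacobiSym.eq_zero_iff_not_coprime, not_not, ← Int.isCoprime_iff_gcd_eq_one]
    refine ⟨-(2 * s + 1), 1, ?_⟩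
    push_cast
    ring
  rw [jacobiSym.mul_left, e1, e2, mul_one]

theorem exists_prime_one_mod_eight_not_isSquare {B : ℕ} (hB : B ≠ 0) :
    ∃ l : ℕ, l.Prime ∧ l ≡ 1 [MOD 8] ∧ ¬ l ∣ B ∧ ∃ σ : ZMod l, σ ^ 2 = 2 ∧ ¬ IsSquare (1 + σ) := by
  obtain ⟨k, s, hs2, hs⟩ := Nat.exists_eq_two_pow_mul_odd hB
  obtain ⟨l, hl, hln, hlJ⟩ := exists_prime_dvd_jacobiSym_ne_one
    (n := (2 * s) ^ 4 + 1) (by positivity)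
    (by rw [jacobiSym_mul_add_one_pow_four_eq_neg_one hs2]; norm_num)
  have : Fact l.Prime := ⟨hl⟩
  have hl2 : l ≠ 2 := by
    rintro rfl
    have h1 : (2 * s) ^ 4 + 1 = 2 * (8 * s ^ 4) + 1 := by ring
    omega
  have hls : ¬ l ∣ 2 * s := by
    intro h
    have h1 := (Nat.dvd_add_right (h.trans (dvd_pow_self _ four_ne_zero))).1 hln
    exact hl.one_lt.ne' (Nat.dvd_one.1 h1)
  have hl8 : l ≡ 1 [MOD 8] := by
    refine (dvd_or_modEq_one_of_dvd_eval_cyclotomic hl (x := (2 * s : ℕ)) ?_).resolve_left ?_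
    · rw [eval_cyclotomic_eight]
      exact_mod_cast hln
    · intro h
      exact hl2 ((Nat.prime_dvd_prime_iff_eq hl Nat.prime_two).1
        (hl.dvd_of_dvd_pow (n := 3) (by simpa using h)))
  refine ⟨l, hl, hl8, ?_, ?_⟩
  · rw [hs]
    intro h
    rcases hl.dvd_mul.1 h with h | h
    · exact hl2 ((Nat.prime_dvd_prime_iff_eq hl Nat.prime_two).1 (hl.dvd_of_dvd_pow h))
    · exact hls (h.mul_left 2)
  obtain ⟨t, ht⟩ : ∃ t : ZMod l, t = (2 * s : ℕ) := ⟨_, rfl⟩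
  have ht4 : t ^ 4 = -1 := by
    rw [ht, eq_neg_iff_add_eq_zero]
    exact_mod_cast (ZMod.natCast_eq_zero_iff _ _).2 hln
  have ht0 : t ≠ 0 := by rwa [ht, Ne, ZMod.natCast_eq_zero_iff]
  have hσ : (t - t ^ 3) ^ 2 = 2 := by linear_combination (t ^ 2 - 2) * ht4
  refine ⟨t - t ^ 3, hσ, ?_⟩
  rintro ⟨w, hw⟩
  apply hlJ
  rw [← jacobiSym.legendreSym.to_jacobiSym, legendreSym.eq_one_iff]
  · refine ⟨t * w, ?_⟩
    push_cast at ht ⊢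
    rw [← ht]
    linear_combination t ^ 2 * hw + t * ht4
  · push_cast at ht ⊢
    rw [← ht]
    intro h
    have h1 : 1 + (t - t ^ 3) = 0 := by
      have : t ^ 2 * (1 + (t - t ^ 3)) = 0 := by linear_combination h - t * ht4
      exact (mul_eq_zero.1 this).resolve_left (pow_ne_zero _ ht0)
    have h2 : (-1 : ZMod l) = 0 := by linear_combination (1 - (t - t ^ 3)) * h1 + hσ
    exact one_ne_zero (neg_eq_zero.1 h2)

theorem IsGEM2Seq.infinite_eight {c : ℤ} {P : ℕ → ℕ} (hc : c ≠ 0)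
    (hP : IsGEM2Seq 1 8 ((cyclotomic 8 ℤ).comp (C c * X)) P) :
    {q : ℕ | q.Prime ∧ q ≡ 1 [MOD 8] ∧ ∀ n, P n ≠ q}.Infinite := by
  intro hfin
  obtain ⟨B, hB, h⟩ := hP.exists_eval_cyclotomic_eq_sq_or (r := 2) (K₀ := 0) (by norm_num)
    (by decide) hc hfin (fun q hq x _ _ hqm =>
      (Nat.prime_dvd_prime_iff_eq hq Nat.prime_two).1 (hq.dvd_of_dvd_pow (n := 4)
        (by simpa using hqm)))
  obtain ⟨l, hl, hl8, hlB, σ, hσ, hσs⟩ := exists_prime_one_mod_eight_not_isSquare hB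
  have : Fact l.Prime := ⟨hl⟩
  obtain ⟨x, hx, ⟨z, hz⟩, hlx⟩ := h (l + 2)
  rw [eval_cyclotomic_eight] at hz
  rcases hz with hz | ⟨hz, -⟩
  · refine sq_add_one_ne_sq (x := x ^ 2) ?_ z (by linear_combination hz)
    rw [abs_pow]
    push_cast at hx
    nlinarith [hl.pos]
  · refine hσs (isSquare_one_add_of_dvd ?_ hz (hlx l hl (by omega) hl8 hlB) hσ)
    have : l % 8 = 1 := hl8
    omega

theorem exists_five_add_two_mul_eq_neg_sq {F : Type*} [Field F] {ζ σ : F}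
    (hζ : ζ ^ 4 + ζ ^ 3 + ζ ^ 2 + ζ + 1 = 0) (hσ : σ ^ 2 = 5) : ∃ r : F, 5 + 2 * σ = -r ^ 2 := by
  have hs : (ζ - ζ ^ 2 - ζ ^ 3 + ζ ^ 4) ^ 2 = 5 := by
    linear_combination (-5 + 5 * ζ + ζ ^ 2 - 3 * ζ ^ 3 + ζ ^ 4) * hζ
  rcases sq_eq_sq_iff_eq_or_eq_neg.1 (hσ.trans hs.symm) with rfl | rfl
  · refine ⟨(ζ ^ 2 - ζ ^ 8) * (1 - ζ ^ 2 - ζ ^ 8), ?_⟩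
    linear_combination (5 - 3 * ζ - 4 * ζ ^ 2 + 5 * ζ ^ 4 + 2 * ζ ^ 5 - 5 * ζ ^ 6 - 2 * ζ ^ 7 +
      ζ ^ 8 + 4 *
      ζ ^ 9 - 3 * ζ ^ 11 - ζ ^ 13 + 4 * ζ ^ 14 - 2 * ζ ^ 16 - ζ ^ 17 + ζ ^ 18 + 2 * ζ ^
      19 - 2 * ζ ^ 20 - ζ ^ 22 + ζ ^ 23 - ζ ^ 27 + ζ ^ 28) * hζ
  · refine ⟨(ζ - ζ ^ 4) * (1 - ζ - ζ ^ 4), ?_⟩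
    linear_combination (5 - 7 * ζ + 5 * ζ ^ 2 - 3 * ζ ^ 3 - ζ ^ 4 + 4 * ζ ^ 5 - 3 * ζ ^ 6 +
      3 * ζ ^ 7 - 2 *
      ζ ^ 8 - ζ ^ 11 + ζ ^ 12) * hζ

theorem PythagoreanTriple.exists_add_eq_mul_sq {p q w : ℤ} (h : PythagoreanTriple p q w)
    (hw : 0 < w) (hpq : ∀ k : ℤ, k ∣ p → k ∣ q → k ∣ 2) :
    ∃ j r : ℤ, w + q = j * r ^ 2 ∧ (j = 1 ∨ j = 2 ∨ j = 4) := by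
  obtain ⟨k, m, n, h1, h2⟩ := PythagoreanTriple.classification.1 h
  have hk2 : k ∣ 2 := by
    rcases h1 with ⟨rfl, rfl⟩ | ⟨rfl, rfl⟩ <;>
    exact hpq k (dvd_mul_right _ _) (dvd_mul_right _ _)
  have hk : k = 1 ∨ k = 2 ∨ k = -1 ∨ k = -2 := by
    have h3 : k ≤ 2 := Int.le_of_dvd two_pos hk2
    have h4 : -k ≤ 2 := Int.le_of_dvd two_pos ((neg_dvd).2 hk2)
    have h5 : k ≠ 0 := by
      rintro rfl
      simp at hk2
    omega
  rcases h2 with rfl | rfl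
  · have hkpos : 0 < k := pos_of_mul_pos_left hw (by positivity)
    rcases h1 with ⟨-, rfl⟩ | ⟨-, rfl⟩
    · refine ⟨k, m + n, by ring, by omega⟩
    · refine ⟨2 * k, m, by ring, by omega⟩
  · have hkpos : 0 < -k := by
      have : 0 < -k * (m ^ 2 + n ^ 2) := by linarith
      exact pos_of_mul_pos_left this (by positivity)
    rcases h1 with ⟨-, rfl⟩ | ⟨-, rfl⟩
    · refine ⟨-k, m - n, by ring, by omega⟩
    · refine ⟨2 * -k, n, by ring, by omega⟩

theorem ZMod.exists_geom_sum_five_eq_zero {l : ℕ} [Fact l.Prime] (hl : l % 5 = 1) :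
    ∃ ζ : ZMod l, ζ ^ 4 + ζ ^ 3 + ζ ^ 2 + ζ + 1 = 0 := by
  have : Fact (Nat.Prime 5) := ⟨by norm_num⟩
  obtain ⟨u, hu⟩ := exists_prime_orderOf_dvd_card (G := (ZMod l)ˣ) 5
    (by rw [ZMod.card_units]; omega)
  refine ⟨u, ?_⟩
  have h5 : (u : ZMod l) ^ 5 = 1 := by
    rw [← Units.val_pow_eq_pow_val, ← hu, pow_orderOf_eq_one, Units.val_one]
  have h1 : (u : ZMod l) - 1 ≠ 0 := by
    intro h
    have : u = 1 := Units.ext (sub_eq_zero.1 h)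
    rw [this, orderOf_one] at hu
    norm_num at hu
  refine (mul_eq_zero.1 ?_).resolve_left h1
  linear_combination h5

theorem not_geom_five_eq_five_mul_sq_of_dvd {l : ℕ} [Fact l.Prime] (hl : l % 40 = 31) {x y : ℤ}
    (hx : (l : ℤ) ∣ x) (h : x ^ 4 + x ^ 3 + x ^ 2 + x + 1 = 5 * y ^ 2) : False := by
  have hx5 : (x - 1) % 5 = 0 := by
    have h1 : ((x - 1 : ℤ) : ZMod 5) = 0 := by
      have h2 : ((x ^ 4 + x ^ 3 + x ^ 2 + x + 1 : ℤ) : ZMod 5) = 0 :=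
        (ZMod.intCast_zmod_eq_zero_iff_dvd _ _).2 ⟨y ^ 2, h⟩
      push_cast at h2 ⊢
      generalize (x : ZMod 5) = t at h2 ⊢
      revert t
      decide
    have := (ZMod.intCast_zmod_eq_zero_iff_dvd _ 5).1 h1
    omega
  obtain ⟨w, hw⟩ : ∃ w, 2 * x ^ 2 + x + 2 = 5 * w := by
    obtain ⟨k, hk⟩ : ∃ k, x = 1 + 5 * k := ⟨x / 5, by omega⟩
    exact ⟨1 + 5 * k + 10 * k ^ 2, by rw [hk]; ring⟩
  have hxy : 5 * w ^ 2 = x ^ 2 + (2 * y) ^ 2 := by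
    have : 5 * (5 * w ^ 2) = 5 * (x ^ 2 + (2 * y) ^ 2) := by
      linear_combination (-(2 * x ^ 2 + x + 2) - 5 * w) * hw + 4 * h
    linarith
  have hwpos : 0 < w := by nlinarith [sq_nonneg x, sq_nonneg (x + 1)]
  obtain ⟨v, p, q, hv, hxpq, hypq⟩ : ∃ v p q : ℤ, v ^ 2 = y ^ 2 ∧ x = 2 * p - q ∧
      2 * v = p + 2 * q := by
    have key : ∀ v : ℤ, v ^ 2 = y ^ 2 → (v + x) % 5 = 0 → ∃ v p q : ℤ, v ^ 2 = y ^ 2 ∧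
        x = 2 * p - q ∧ 2 * v = p + 2 * q := fun v hv h0 => by
      obtain ⟨k, hk⟩ : ∃ k, v = 5 * k - x := ⟨(v + x) / 5, by omega⟩
      exact ⟨v, 2 * k, 4 * k - x, hv, by ring, by rw [hk]; ring⟩
    have h1 : (5 : ℤ) ∣ (y - x) * (y + x) := ⟨y ^ 2 - w ^ 2, by linear_combination hxy⟩
    rcases Int.Prime.dvd_mul' (p := 5) (by norm_num) (by exact_mod_cast h1) with h2 | h2
    · exact key (-y) (by ring) (by omega)
    · exact key y rfl (by omega)
  have hpyth : PythagoreanTriple p q w := by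
    have : 5 * (p * p + q * q) = 5 * (w * w) := by
      linear_combination -hxy + 4 * hv + (x + 2 * p - q) * (-hxpq) + (2 * v + p + 2 * q) * (-hypq)
    rw [PythagoreanTriple]
    linarith
  have hcop : ∀ k : ℤ, k ∣ p → k ∣ q → k ∣ 2 := by
    intro k hkp hkq
    have h1 : k ∣ x := by rw [hxpq]; exact (hkp.mul_left 2).sub hkq
    have h2 : k ∣ 2 * v := by rw [hypq]; exact hkp.add (hkq.mul_left 2)
    have h3 : (2 : ℤ) = 5 * v * (2 * v) - 2 * (x ^ 3 + x ^ 2 + x + 1) * x := by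
      linear_combination -10 * hv + 2 * h
    rw [h3]
    exact (h2.mul_left _).sub (h1.mul_left _)
  obtain ⟨j, r, hjr, hj⟩ := hpyth.exists_add_eq_mul_sq hwpos hcop
  have hl2 : l ≠ 2 := by omega
  obtain ⟨t, ht⟩ : IsSquare (2 : ZMod l) := (ZMod.exists_sq_eq_two_iff hl2).2 (by omega)
  have hneg : ¬ IsSquare (-1 : ZMod l) := by
    rw [ZMod.exists_sq_eq_neg_one_iff]
    omega
  have h20 : (2 : ZMod l) ≠ 0 := by
    intro h0
    have h1 : l ∣ 2 := (ZMod.natCast_eq_zero_iff 2 l).1 (by exact_mod_cast h0)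
    exact hl2 ((Nat.prime_dvd_prime_iff_eq (Fact.out : l.Prime) Nat.prime_two).1 h1)
  have h50 : (5 : ZMod l) ≠ 0 := by
    intro h0
    have h1 : l ∣ 5 := (ZMod.natCast_eq_zero_iff 5 l).1 (by exact_mod_cast h0)
    have := Nat.le_of_dvd (by norm_num) h1
    omega
  obtain ⟨τ, hτ⟩ : IsSquare (j : ZMod l) := by
    rcases hj with rfl | rfl | rfl
    · exact ⟨1, by simp⟩
    · exact ⟨t, by simpa using ht⟩
    · exact ⟨2, by norm_num⟩
  have hx0 : (x : ZMod l) = 0 := (ZMod.intCast_zmod_eq_zero_iff_dvd _ _).2 hx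
  have e1 := congrArg (Int.cast : ℤ → ZMod l) hxpq
  have e2 := congrArg (Int.cast : ℤ → ZMod l) hw
  have e3 := congrArg (Int.cast : ℤ → ZMod l) hjr
  have e4 := congrArg (Int.cast : ℤ → ZMod l) hpyth
  push_cast at e1 e2 e3 e4
  rw [hx0] at e1 e2
  rw [hτ] at e3
  generalize (p : ZMod l) = p' at *
  generalize (q : ZMod l) = q' at *
  generalize (w : ZMod l) = w' at *
  generalize (r : ZMod l) = r' at *
  have hq' : q' = 2 * p' := by linear_combination e1
  subst hq'
  have hp0 : p' ≠ 0 := by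
    rintro rfl
    have hw0 : w' = 0 := by
      have : w' * w' = 0 := by linear_combination -e4
      simpa using this
    rw [hw0] at e2
    exact h20 (by linear_combination e2)
  have hσ : (w' / p') ^ 2 = 5 := by
    rw [div_pow, div_eq_iff (pow_ne_zero 2 hp0)]
    linear_combination -e4
  obtain ⟨σ, hσ'⟩ : ∃ σ, σ = w' / p' := ⟨_, rfl⟩
  rw [← hσ'] at hσ
  have hwσ : w' = σ * p' := by rw [hσ', div_mul_cancel₀ _ hp0]
  obtain ⟨ζ, hζ⟩ := ZMod.exists_geom_sum_five_eq_zero (l := l) (by omega)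
  obtain ⟨ρ, hρ⟩ := exists_five_add_two_mul_eq_neg_sq hζ hσ
  have hσ0 : σ ≠ 0 := by
    rintro rfl
    exact h50 (by linear_combination -hσ)
  have hp25 : 25 * p' = 2 * σ := by
    apply mul_left_cancel₀ hσ0
    linear_combination -5 * e2 - 25 * hwσ - 2 * hσ
  have hρ0 : ρ ≠ 0 := by
    rintro rfl
    exact h50 (by linear_combination (5 - 2 * σ) * hρ + 4 * hσ)
  have ht0 : t ≠ 0 := by
    rintro rfl
    exact h20 (by linear_combination ht)
  refine hneg ⟨5 * τ * r' / (t * ρ), ?_⟩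
  have htρ := mul_ne_zero ht0 hρ0
  rw [div_mul_div_comm, eq_div_iff (mul_ne_zero htρ htρ)]
  linear_combination 25 * e3 + ρ ^ 2 * ht - 2 * hρ + 5 * e2 - 2 * hp25

section

variable {c : ℤ} {P : ℕ → ℕ}

theorem IsGEM2Seq.infinite_five (hc : c ≠ 0)
    (hP : IsGEM2Seq 1 5 ((cyclotomic 5 ℤ).comp (C c * X)) P) :
    {q : ℕ | q.Prime ∧ q ≡ 1 [MOD 5] ∧ ∀ n, P n ≠ q}.Infinite := by
  intro hfin
  obtain ⟨B, hB, h⟩ := hP.exists_eval_cyclotomic_eq_sq_or (r := 5) (K₀ := 0) (by norm_num)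
    (by decide) hc hfin (fun q hq x _ hqx hqm => by
      refine (hq.eq_two_or_eq_of_dvd (p := 5) (a := 1) (b := 1) (by norm_num) hqm).resolve_left ?_
      rintro rfl
      rw [eval_cyclotomic_five, ← ZMod.intCast_zmod_eq_zero_iff_dvd] at hqx
      push_cast at hqx
      generalize (x : ZMod 2) = y at hqx
      revert y
      decide)
  obtain ⟨l, hl, hl40, hlB⟩ := exists_prime_modEq_not_dvd (n := 40) (b := 31) (by norm_num)
    (by norm_num) hB
  have : Fact l.Prime := ⟨hl⟩
  obtain ⟨x, hx, ⟨z, hz⟩, hlx⟩ := h (l + 4)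
  rw [eval_cyclotomic_five] at hz
  rcases hz with hz | ⟨hz, -⟩
  · refine geom_five_ne_sq (x := x) ?_ z hz
    push_cast at hx
    linarith
  · exact not_geom_five_eq_five_mul_sq_of_dvd hl40
      (hlx l hl (by omega) ((Nat.ModEq.of_mul_left (n := 5) 8 hl40).trans rfl) hlB) hz

theorem IsGEM2Seq.infinite_ten (hc : c ≠ 0)
    (hP : IsGEM2Seq 1 10 ((cyclotomic 10 ℤ).comp (C c * X)) P) :
    {q : ℕ | q.Prime ∧ q ≡ 1 [MOD 10] ∧ ∀ n, P n ≠ q}.Infinite := by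
  intro hfin
  obtain ⟨B, hB, h⟩ := hP.exists_eval_cyclotomic_eq_sq_or (r := 5) (K₀ := 10) (by norm_num)
    (by decide) hc hfin (fun q hq x hx hqx hqm => by
      refine (hq.eq_two_or_eq_of_dvd (p := 5) (a := 2) (b := 1) (by norm_num) hqm).resolve_left ?_
      rintro rfl
      rw [eval_cyclotomic_ten (ne_neg_one_of_ten_le_abs hx),
        ← ZMod.intCast_zmod_eq_zero_iff_dvd] at hqx
      push_cast at hqx
      generalize (x : ZMod 2) = y at hqx
      revert y
      decide)
  obtain ⟨l, hl, hl40, hlB⟩ := exists_prime_modEq_not_dvd (n := 40) (b := 31) (by norm_num)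
    (by norm_num) hB
  have : Fact l.Prime := ⟨hl⟩
  obtain ⟨x, hx, ⟨z, hz⟩, hlx⟩ := h (l + 10)
  have hx10 : 10 ≤ |x| := by
    push_cast at hx
    linarith
  rw [eval_cyclotomic_ten (ne_neg_one_of_ten_le_abs hx10)] at hz
  rcases hz with hz | ⟨hz, -⟩
  · refine geom_five_ne_sq (x := -x) (by rw [abs_neg]; linarith) z ?_
    linear_combination hz
  · refine not_geom_five_eq_five_mul_sq_of_dvd (x := -x) (y := z) hl40
      (hlx l hl (by omega) ((Nat.ModEq.of_mul_left (n := 10) 4 hl40).trans rfl) hlB).neg_right ?_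
    linear_combination hz

end

theorem Int.eq_one_of_jacobiSym_eq_one {m : ℕ} (hm : m = 1 ∨ m = 2) {D : ℤ} (hD : Squarefree D)
    (hq : ∀ q : ℕ, q.Prime → (q : ℤ) ∣ D → q ∣ 2 * m)
    (hJ : ∀ b : ℕ, Odd b → b ≡ 1 [MOD m] → b.Coprime D.natAbs → jacobiSym D b = 1) : D = 1 := by
  have hmod : ∀ b : ℕ, Odd b → b ≡ 1 [MOD m] := by
    rintro b hb
    rcases hm with rfl | rfl
    · exact Nat.modEq_one
    · exact Nat.odd_iff.1 hb
  have h2 : |D| = 1 ∨ |D| = (2 : ℕ) := by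
    refine Int.eq_one_or_eq_of_squarefree ?_ (abs_pos.2 hD.ne_zero) fun q hqp hqD => ?_
    · rwa [← Int.squarefree_natAbs, Int.natAbs_abs, Int.squarefree_natAbs]
    · have h := hq q hqp ((dvd_abs _ _).1 hqD)
      rcases hm with rfl | rfl
      · exact (Nat.prime_dvd_prime_iff_eq hqp Nat.prime_two).1 (by simpa using h)
      · exact (Nat.prime_dvd_prime_iff_eq hqp Nat.prime_two).1
          (hqp.dvd_of_dvd_pow (n := 2) (by simpa using h))
  have h3 := hJ 3 (by decide) (hmod 3 (by decide))
  have h5 := hJ 5 (by decide) (hmod 5 (by decide))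
  rcases h2 with h2 | h2
  · rcases (abs_eq (by norm_num)).1 h2 with rfl | rfl
    · rfl
    · norm_num at h3
  · rcases (abs_eq (by norm_num)).1 h2 with rfl | rfl
    · norm_num at h3
    · norm_num at h5

theorem jacobiSym_eq_one_of_sq_eq_one {l : ℕ} (hl : l.Prime) (hl4 : l ≡ 1 [MOD 4]) {z : ℤ}
    (h : (l : ℤ) ∣ z ^ 2 - 1) : jacobiSym z l = 1 := by
  have : Fact l.Prime := ⟨hl⟩
  have hl' : l % 4 = 1 := hl4
  have h1 : ((z : ZMod l)) ^ 2 = 1 := by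
    have := (ZMod.intCast_zmod_eq_zero_iff_dvd _ _).2 h
    push_cast at this
    linear_combination this
  have h0 : (z : ZMod l) ≠ 0 := by
    intro h0
    rw [h0, zero_pow two_ne_zero] at h1
    exact zero_ne_one h1
  rw [← jacobiSym.legendreSym.to_jacobiSym, legendreSym.eq_one_iff _ h0,
    ZMod.euler_criterion _ h0]
  rw [show l / 2 = 2 * (l / 4) by omega, pow_mul, h1, one_pow]

theorem jacobiSym_eq_one_of_pow_four_eq_one {l : ℕ} (hl : l.Prime) (hl8 : l ≡ 1 [MOD 8]) {z : ℤ}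
    (h : (l : ℤ) ∣ z ^ 4 - 1) : jacobiSym z l = 1 := by
  have : Fact l.Prime := ⟨hl⟩
  have hl' : l % 8 = 1 := hl8
  have h1 : ((z : ZMod l)) ^ 4 = 1 := by
    have := (ZMod.intCast_zmod_eq_zero_iff_dvd _ _).2 h
    push_cast at this
    linear_combination this
  have h0 : (z : ZMod l) ≠ 0 := by
    intro h0
    rw [h0, zero_pow four_ne_zero] at h1
    exact zero_ne_one h1
  rw [← jacobiSym.legendreSym.to_jacobiSym, legendreSym.eq_one_iff _ h0,
    ZMod.euler_criterion _ h0]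
  rw [show l / 2 = 4 * (l / 8) by omega, pow_mul, h1, one_pow]

theorem Int.eq_sq_of_squarefree_mul_sq {k : ℕ} {D w z : ℤ} (hz : 0 < z) (hodd : Odd z)
    (hzw : z = D * w ^ 2) (hD : Squarefree D)
    (hq : ∀ q : ℕ, q.Prime → (q : ℤ) ∣ D → q ∣ 2 ^ k) : ∃ v : ℤ, 0 < v ∧ Odd v ∧ z = v ^ 2 := by
  have hDpos : 0 < D := by
    rw [hzw] at hz
    exact pos_of_mul_pos_left hz (sq_nonneg w)
  have hD1 : D = 1 := by
    rcases Int.eq_one_or_eq_of_squarefree hD hDpos (r := 2) (fun q hqp hqD =>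
      (Nat.prime_dvd_prime_iff_eq hqp Nat.prime_two).1 (hqp.dvd_of_dvd_pow (hq q hqp hqD)))
      with h | h
    · exact h
    · rw [hzw, h] at hodd
      simp [Int.odd_mul] at hodd
      exact absurd hodd.1 (by decide)
  rw [hD1, one_mul] at hzw
  have hw : w ≠ 0 := by
    rintro rfl
    simp [hzw] at hz
  refine ⟨|w|, abs_pos.2 hw, ?_, by rw [sq_abs, hzw]⟩
  rw [hzw, Int.odd_pow] at hodd
  exact odd_abs.2 (hodd.resolve_right (by norm_num))

section

variable {m : ℕ} {c ε : ℤ} {P : ℕ → ℕ}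

theorem IsGEM2Seq.exists_one_add_mul_prod_eq_sq (hm : m = 1 ∨ m = 2) (hc : c ≠ 0)
    (hε : ∀ x, (cyclotomic m ℤ).eval 0 * (cyclotomic m ℤ).eval x = 1 + ε * x) (hε0 : ε ≠ 0)
    (hP : IsGEM2Seq 1 m ((cyclotomic m ℤ).comp (C c * X)) P)
    (hfin : {q : ℕ | q.Prime ∧ q ≡ 1 [MOD m] ∧ ∀ n, P n ≠ q}.Finite) :
    0 < ε * c ∧ ∃ B : ℕ, B ≠ 0 ∧ ∀ K : ℕ, ∃ n, K ≤ n ∧ K ≤ P n ∧ ∃ z : ℤ, 0 < z ∧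
      1 + ε * c * ∏ i ∈ Finset.range n, (P i : ℤ) = z ^ 2 ∧
      (∀ q : ℕ, q.Prime → (q : ℤ) ∣ z → q ∣ B ∨ q = P n) ∧
      ∀ l : ℕ, l.Prime → l < P n → l ≡ 1 [MOD m] → ¬ l ∣ B →
        (l : ℤ) ∣ ∏ i ∈ Finset.range n, (P i : ℤ) := by
  have hm0 : m ≠ 0 := by omega
  have hφ : m.totient ≤ 6 := by rcases hm with rfl | rfl <;> decide
  have hu := isUnit_eval_zero_cyclotomic hm0
  obtain ⟨B, hB, -, h⟩ := hP.exists_index_squarefree_mul_sq hm0 hφ hfin one_ne_zero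
  have key : ∀ K : ℕ, ∃ n, K ≤ n ∧ 1 ≤ n ∧ K ≤ P n ∧ ∃ z : ℤ, 0 < z ∧
      1 + ε * c * ∏ i ∈ Finset.range n, (P i : ℤ) = z ^ 2 ∧
      (∀ q : ℕ, q.Prime → (q : ℤ) ∣ z → q ∣ B ∨ q = P n) ∧
      ∀ l : ℕ, l.Prime → l < P n → l ≡ 1 [MOD m] → ¬ l ∣ B →
        (l : ℤ) ∣ ∏ i ∈ Finset.range n, (P i : ℤ) := by
    intro K
    obtain ⟨n, hn, hPn, hq, hl, hD⟩ := h (max K 1)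
    have hn1 : 1 ≤ n := le_of_max_le_right hn
    have hN : (2 : ℤ) ≤ ∏ i ∈ Finset.range n, (P i : ℤ) :=
      le_trans (le_self_pow₀ (by norm_num) (by omega)) (hP.two_pow_le_prod n)
    have hF := hε (c * ∏ i ∈ Finset.range n, (P i : ℤ))
    have hF0 : (cyclotomic m ℤ).eval (c * ∏ i ∈ Finset.range n, (P i : ℤ)) ≠ 0 := by
      intro h0
      rw [h0, mul_zero] at hF
      have h1 : ∏ i ∈ Finset.range n, (P i : ℤ) ∣ 1 :=
        ⟨-(ε * c), by linear_combination -hF⟩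
      have := Int.le_of_dvd one_pos h1
      omega
    obtain ⟨D, z, hDz, hDs, hDq, hDJ⟩ := hD hF0
    have hD1 := Int.eq_one_of_jacobiSym_eq_one hm hDs hDq hDJ
    rw [hD1, one_mul] at hDz
    refine ⟨n, le_of_max_le_left hn, hn1, le_of_max_le_left hPn, |z|, ?_, ?_, ?_, hl⟩
    · rw [abs_pos]
      rintro rfl
      exact mul_ne_zero hu.ne_zero hF0 (by rw [hDz]; norm_num)
    · rw [sq_abs, ← hDz, hF]
      ring
    · intro q hqp hqz
      refine hq q hqp ((hu.dvd_mul_left).1 ?_)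
      rw [hDz]
      exact ((dvd_abs _ _).1 hqz).trans (dvd_pow_self _ two_ne_zero)
  refine ⟨?_, B, hB, fun K => ?_⟩
  · obtain ⟨n, -, hn, -, z, hz, hz', -⟩ := key 0
    have hN : (2 : ℤ) ≤ ∏ i ∈ Finset.range n, (P i : ℤ) :=
      le_trans (le_self_pow₀ (by norm_num) (by omega)) (hP.two_pow_le_prod n)
    have hεc := mul_ne_zero hε0 hc
    by_contra hneg
    have h1 : ε * c ≤ -1 := by omega
    nlinarith [sq_nonneg z]
  · obtain ⟨n, hn, -, h⟩ := key K
    exact ⟨n, hn, h⟩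

theorem IsGEM2Seq.odd_prod (hε : ∀ x, (cyclotomic m ℤ).eval 0 * (cyclotomic m ℤ).eval x = 1 + ε * x)
    (hP : IsGEM2Seq 1 m ((cyclotomic m ℤ).comp (C c * X)) P) (hc : 2 ∣ c) (n : ℕ) :
    Odd (∏ i ∈ Finset.range n, (P i : ℤ)) := by
  refine Finset.prod_induction _ Odd (fun _ _ => Odd.mul) odd_one fun i _ => ?_
  have h1 := (hP.dvd_eval i).mul_left ((cyclotomic m ℤ).eval 0)
  rw [hε] at h1
  by_contra h2
  rw [Int.not_odd_iff_even] at h2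
  have h3 := (even_iff_two_dvd.1 h2).trans h1
  have h4 := (dvd_add_left ((hc.mul_right _).mul_left ε)).1 h3
  norm_num at h4

theorem IsGEM2Seq.infinite_of_even (hm : m = 1 ∨ m = 2) (hc : c ≠ 0)
    (hε : ∀ x, (cyclotomic m ℤ).eval 0 * (cyclotomic m ℤ).eval x = 1 + ε * x)
    (hε1 : IsUnit ε)
    (hP : IsGEM2Seq 1 m ((cyclotomic m ℤ).comp (C c * X)) P) (hc2 : 2 ∣ c) (hc32 : ¬ 32 ∣ c) :
    {q : ℕ | q.Prime ∧ q ≡ 1 [MOD m] ∧ ∀ n, P n ≠ q}.Infinite := by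
  intro hfin
  have hmod : ∀ {l k : ℕ}, l ≡ 1 [MOD 2 * k] → l ≡ 1 [MOD m] := by
    intro l k hlk
    rcases hm with hm | hm
    · exact hm ▸ Nat.modEq_one
    · exact hm ▸ Nat.ModEq.of_mul_right _ hlk
  obtain ⟨-, B, hB, h⟩ := hP.exists_one_add_mul_prod_eq_sq hm hc hε hε1.ne_zero hfin
  obtain ⟨p₄, hp₄⟩ := exists_squarefree_mul_sq_of_jacobiSym_eq_one (m := 4) (by norm_num)
    (by decide) hB
  obtain ⟨p₈, hp₈⟩ := exists_squarefree_mul_sq_of_jacobiSym_eq_one (m := 8) (by norm_num)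
    (by decide) hB
  obtain ⟨n, -, hPn, z, hz, hzN, hzq, hl⟩ := h (max p₄ p₈)
  have hN := hP.odd_prod hε hc2 n
  generalize ∏ i ∈ Finset.range n, (P i : ℤ) = N at *
  have hzodd : Odd z := by
    have h1 : Odd (z ^ 2) := by
      rw [← hzN]
      exact odd_one.add_even (((even_iff_two_dvd.2 hc2).mul_left _).mul_right _)
    exact (Int.odd_pow.1 h1).resolve_right (by norm_num)
  obtain ⟨D, w, hzw, hD, hDq, -⟩ := hp₄ (P n) (hP.prime n) (le_of_max_le_left hPn) z hz.ne' hzq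
    fun l hlp hlt hl4 hlB => jacobiSym_eq_one_of_sq_eq_one hlp hl4 (by
      rw [← hzN, add_sub_cancel_left]
      exact (hl l hlp hlt (hmod (k := 2) hl4) hlB).mul_left _)
  obtain ⟨v, hv, hvodd, rfl⟩ := Int.eq_sq_of_squarefree_mul_sq (k := 3) hz hzodd hzw hD
    (by simpa using hDq)
  obtain ⟨D', w', hvw', hD', hDq', -⟩ := hp₈ (P n) (hP.prime n) (le_of_max_le_right hPn) v hv.ne'
    (fun q hq hqv => hzq q hq (hqv.trans (dvd_pow_self _ two_ne_zero)))
    fun l hlp hlt hl8 hlB => jacobiSym_eq_one_of_pow_four_eq_one hlp hl8 (by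
      rw [show v ^ 4 = (v ^ 2) ^ 2 by ring, ← hzN, add_sub_cancel_left]
      exact (hl l hlp hlt (hmod (k := 4) hl8) hlB).mul_left _)
  obtain ⟨u, hu, huodd, rfl⟩ := Int.eq_sq_of_squarefree_mul_sq (k := 4) hv hvodd hvw' hD'
    (by simpa using hDq')
  refine hc32 ?_
  have h8 : (8 : ℤ) ∣ u ^ 2 - 1 := Int.eight_dvd_sq_sub_one_of_odd huodd
  have h2 : (2 : ℤ) ∣ u ^ 2 + 1 := by
    obtain ⟨k, rfl⟩ := huodd
    exact ⟨2 * k ^ 2 + 2 * k + 1, by ring⟩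
  have h2' : (2 : ℤ) ∣ u ^ 4 + 1 := by
    obtain ⟨k, hk⟩ := huodd.pow (n := 4)
    exact ⟨k + 1, by rw [hk]; ring⟩
  have h32 : (32 : ℤ) ∣ ε * (c * N) := by
    have : ε * (c * N) = (u ^ 2 - 1) * (u ^ 2 + 1) * (u ^ 4 + 1) := by linear_combination hzN
    rw [this]
    exact mul_dvd_mul (mul_dvd_mul h8 h2) h2'
  have h3 : (32 : ℤ) ∣ c * N := (hε1.dvd_mul_left).1 h32
  have hcop : IsCoprime (32 : ℤ) N := by
    rw [show (32 : ℤ) = 2 ^ 5 by norm_num]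
    refine IsCoprime.pow_left ?_
    obtain ⟨k, rfl⟩ := hN
    exact ⟨-k, 1, by ring⟩
  exact hcop.dvd_of_dvd_mul_right h3

theorem IsGEM2Seq.infinite_of_exists_eq_two (hm : m = 1 ∨ m = 2)
    (hε : ∀ x, (cyclotomic m ℤ).eval 0 * (cyclotomic m ℤ).eval x = 1 + ε * x)
    (hε1 : IsUnit ε)
    (hP : IsGEM2Seq 1 m ((cyclotomic m ℤ).comp (C c * X)) P) (hc : Odd c) {i : ℕ}
    (hi : P i = 2) :
    {q : ℕ | q.Prime ∧ q ≡ 1 [MOD m] ∧ ∀ n, P n ≠ q}.Infinite := by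
  intro hfin
  have hc0 : c ≠ 0 := by rintro rfl; exact absurd hc (by decide)
  obtain ⟨-, B, -, h⟩ := hP.exists_one_add_mul_prod_eq_sq hm hc0 hε hε1.ne_zero hfin
  obtain ⟨n, hn, -, z, -, hz, -⟩ := h (i + 1)
  have hodd : Odd (∏ j ∈ (Finset.range n).erase i, (P j : ℤ)) := by
    refine Finset.prod_induction _ Odd (fun _ _ => Odd.mul) odd_one fun j hj => ?_
    have h1 : P j ≠ 2 := fun h => Finset.ne_of_mem_erase hj
      (hP.injective (by omega) (h.trans hi.symm))
    exact_mod_cast (hP.prime j).odd_of_ne_two h1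
  rw [← Finset.mul_prod_erase _ _ (Finset.mem_range.2 (by omega : i < n)), hi] at hz
  have hεodd : Odd ε := by
    rcases Int.isUnit_iff.1 hε1 with rfl | rfl <;> decide
  obtain ⟨k, hk⟩ := (hεodd.mul hc).mul hodd
  have hz2 : z ^ 2 = 3 + 4 * k := by
    rw [← hz]
    push_cast
    linear_combination 2 * hk
  rcases Int.even_or_odd z with ⟨j, rfl⟩ | ⟨j, rfl⟩
  · have : 4 * (j ^ 2 - k) = 3 := by linear_combination hz2
    omega
  · have : 2 * (2 * j ^ 2 + 2 * j - 2 * k) = 2 := by linear_combination hz2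
    omega

end

theorem cyclotomic_one_eval_zero_mul_eval (x : ℤ) :
    (cyclotomic 1 ℤ).eval 0 * (cyclotomic 1 ℤ).eval x = 1 + -1 * x := by
  simp only [cyclotomic_one, eval_sub, eval_X, eval_one]
  ring

theorem cyclotomic_two_eval_zero_mul_eval (x : ℤ) :
    (cyclotomic 2 ℤ).eval 0 * (cyclotomic 2 ℤ).eval x = 1 + 1 * x := by
  simp only [cyclotomic_two, eval_add, eval_X, eval_one]
  ring

theorem IsGEM2Seq.infinite_one {c : ℤ} {P : ℕ → ℕ} (hc : c ≠ 0)
    (h : 0 < c ∨ (2 ∣ c ∧ ¬ (32 ∣ c)) ∨ c = -5 ∨ ∃ k : ℕ, 0 < k ∧ c = 1 - 2 ^ k)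
    (hP : IsGEM2Seq 1 1 ((cyclotomic 1 ℤ).comp (C c * X)) P) :
    {q : ℕ | q.Prime ∧ q ≡ 1 [MOD 1] ∧ ∀ n, P n ≠ q}.Infinite := by
  have hε := cyclotomic_one_eval_zero_mul_eval
  have hdvd : ∀ n, (P n : ℤ) ∣ c * ∏ i ∈ Finset.range n, (P i : ℤ) - 1 := fun n => by
    simpa using (hP n).1.2.1
  rcases h with h | ⟨h2, h32⟩ | rfl | ⟨k, hk, rfl⟩
  · intro hfin
    have := (hP.exists_one_add_mul_prod_eq_sq (.inl rfl) hc hε (by norm_num) hfin).1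
    omega
  · exact hP.infinite_of_even (.inl rfl) hc hε isUnit_one.neg h2 h32
  · have h0 : P 0 = 3 := by
      refine (hP 0).unique ⟨?_, ?_⟩
      · refine ⟨Nat.prime_three, ?_, ?_, Nat.modEq_one⟩ <;> norm_num
      · rintro q ⟨hq, hq6, -, -⟩
        have h6 : q ∣ 2 * 3 := by
          have : (q : ℤ) ∣ (6 : ℕ) := by
            rw [← dvd_neg]
            simpa using hq6
          exact_mod_cast this
        rcases (Nat.Prime.dvd_mul hq).1 h6 with h | h
        · exact (Nat.le_of_dvd two_pos h).trans (by norm_num)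
        · exact Nat.le_of_dvd three_pos h
    have h1 : P 1 = 2 := by
      have h := hdvd 1
      rw [Finset.prod_range_one, h0] at h
      have h16 : P 1 ∣ 2 ^ 4 := by
        have : ((P 1 : ℕ) : ℤ) ∣ ((2 ^ 4 : ℕ) : ℤ) := by
          rw [← dvd_neg]
          exact h
        exact_mod_cast this
      exact (Nat.prime_dvd_prime_iff_eq (hP.prime 1) Nat.prime_two).1
        ((hP.prime 1).dvd_of_dvd_pow h16)
    exact hP.infinite_of_exists_eq_two (.inl rfl) hε isUnit_one.neg (by decide) h1
  · have h0 : P 0 = 2 := by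
      have h := hdvd 0
      have h2 : P 0 ∣ 2 ^ k := by
        have : ((P 0 : ℕ) : ℤ) ∣ ((2 ^ k : ℕ) : ℤ) := by
          rw [← dvd_neg]
          simpa using h
        exact_mod_cast this
      exact (Nat.prime_dvd_prime_iff_eq (hP.prime 0) Nat.prime_two).1
        ((hP.prime 0).dvd_of_dvd_pow h2)
    refine hP.infinite_of_exists_eq_two (.inl rfl) hε isUnit_one.neg ?_ h0
    exact odd_one.sub_even ((even_two).pow_of_ne_zero hk.ne')

theorem IsGEM2Seq.infinite_two {c : ℤ} {P : ℕ → ℕ} (hc : c ≠ 0)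
    (h : c < 0 ∨ (2 ∣ c ∧ ¬ (32 ∣ c)))
    (hP : IsGEM2Seq 1 2 ((cyclotomic 2 ℤ).comp (C c * X)) P) :
    {q : ℕ | q.Prime ∧ q ≡ 1 [MOD 2] ∧ ∀ n, P n ≠ q}.Infinite := by
  have hε := cyclotomic_two_eval_zero_mul_eval
  rcases h with h | ⟨h2, h32⟩
  · intro hfin
    have := (hP.exists_one_add_mul_prod_eq_sq (.inr rfl) hc hε one_ne_zero hfin).1
    omega
  · exact hP.infinite_of_even (.inr rfl) hc hε isUnit_one h2 h32

theorem ne_zero_of_mem_Sset {m : ℕ} {c : ℤ} (hc : c ∈ Sset m) : c ≠ 0 := by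
  rintro rfl
  unfold Sset at hc
  split_ifs at hc <;> simp at hc

/-- For `m ∈ {1,…,10,12,14,18}` and `c ∈ S(m)` (with further restrictions on `c` for
`m ∈ {1,2}`), the sequence `GEM₂(Φ_m(cx);1,m)` omits infinitely many primes
`p ≡ 1 (mod m)`, unconditionally. -/
theorem gem2_cyclotomic_omits_infinitely_many_unconditional
    (m : ℕ) (hm : m ∈ ({1, 2, 3, 4, 5, 6, 7, 8, 9, 10, 12, 14, 18} : Set ℕ))
    (c : ℤ) (hc : c ∈ Sset m)
    (hc1 : m = 1 → (0 < c ∨ (2 ∣ c ∧ ¬ (32 ∣ c)) ∨ c = -5 ∨ ∃ k : ℕ, 0 < k ∧ c = 1 - 2 ^ k))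
    (hc2 : m = 2 → (c < 0 ∨ (2 ∣ c ∧ ¬ (32 ∣ c))))
    (P : ℕ → ℕ) (hP : IsGEM2Seq 1 m ((cyclotomic m ℤ).comp (C c * X)) P) :
    {q : ℕ | q.Prime ∧ q ≡ 1 [MOD m] ∧ ∀ n, P n ≠ q}.Infinite := by
  have hc0 := ne_zero_of_mem_Sset hc
  simp only [Set.mem_insert_iff, Set.mem_singleton_iff] at hm
  rcases hm with rfl | rfl | rfl | rfl | rfl | rfl | rfl | rfl | rfl | rfl | rfl | rfl | rfl
  · exact hP.infinite_one hc0 (hc1 rfl)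
  · exact hP.infinite_two hc0 (hc2 rfl)
  · exact hP.infinite_three hc0
  · exact hP.infinite_four hc0
  · exact hP.infinite_five hc0
  · exact hP.infinite_six hc0
  · exact hP.infinite_seven hc0
  · exact hP.infinite_eight hc0
  · exact hP.infinite_nine hc0
  · exact hP.infinite_ten hc0
  · exact hP.infinite_twelve hc0
  · exact hP.infinite_fourteen hc0
  · exact hP.infinite_eighteen hc0
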